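/- Let f be a loxodromic automorphism of ℂ². Assume that for some transversal γ : 𝔻 → ℂ² to J⁺, the Julia slice E_γ = 𝔻 ∩ ∂(γ⁻¹(K⁺)) is contained in a C¹ smooth curve, i.e., there exist an open interval I ⊆ ℝ and an injective continuously differentiable map η : I → ℂ with nowhere-vanishing derivative such that E_γ ⊆ η(I). Then for every saddle periodic point p of f and every unstable parametrization ψ of p, the frontier in ℂ of ψ⁻¹(K⁺) is contained in a real line through the origin {t·v : t ∈ ℝ} for some v ∈ ℂ \ {0}; in particular the unstable multiplier λᵘ(p) is a real number. -/

import Mathlib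

open Function Set Filter Topology

noncomputable section

/-- A polynomial map of `ℂ²`. -/
def IsPolyMap (F : ℂ × ℂ → ℂ × ℂ) : Prop :=
  ∃ P Q : MvPolynomial (Fin 2) ℂ, ∀ z : ℂ × ℂ,
    F z = (MvPolynomial.eval ![z.1, z.2] P, MvPolynomial.eval ![z.1, z.2] Q)

/-- A polynomial automorphism of `ℂ²`. -/
def IsPolyAuto (F : ℂ × ℂ → ℂ × ℂ) : Prop :=
  IsPolyMap F ∧ ∃ G : ℂ × ℂ → ℂ × ℂ, IsPolyMap G ∧
    (∀ z, G (F z) = z) ∧ (∀ z, F (G z) = z)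

/-- A generalized Hénon map. -/
def IsHenon (h : ℂ × ℂ → ℂ × ℂ) : Prop :=
  ∃ (p : Polynomial ℂ) (a : ℂ), a ≠ 0 ∧ 2 ≤ p.natDegree ∧
    ∀ z : ℂ × ℂ, h z = (Polynomial.eval z.1 p - a * z.2, z.1)

/-- A loxodromic automorphism of `ℂ²`. -/
def IsLoxodromic (f : ℂ × ℂ → ℂ × ℂ) : Prop :=
  IsPolyAuto f ∧
  ∃ (u uinv : ℂ × ℂ → ℂ × ℂ) (hs : List (ℂ × ℂ → ℂ × ℂ)),
    IsPolyAuto u ∧ (∀ z, uinv (u z) = z) ∧ (∀ z, u (uinv z) = z) ∧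
    hs ≠ [] ∧ (∀ h ∈ hs, IsHenon h) ∧
    ∀ z, f z = uinv (hs.foldr (fun h acc => h ∘ acc) id (u z))

/-- The set of points with bounded forward orbit. -/
def Kplus (f : ℂ × ℂ → ℂ × ℂ) : Set (ℂ × ℂ) :=
  {z | ∃ C : ℝ, ∀ n : ℕ, ‖f^[n] z‖ ≤ C}

/-- `lam` is an eigenvalue of the continuous linear map `T`. -/
def IsEigenvalue (T : (ℂ × ℂ) →L[ℂ] ℂ × ℂ) (lam : ℂ) : Prop :=
  ∃ v : ℂ × ℂ, v ≠ 0 ∧ T v = lam • v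

/-- `p` is a saddle periodic point of period `n` with stable multiplier `ls`
and unstable multiplier `lu`. -/
def IsSaddle (f : ℂ × ℂ → ℂ × ℂ) (p : ℂ × ℂ) (n : ℕ) (ls lu : ℂ) : Prop :=
  1 ≤ n ∧ f^[n] p = p ∧
  IsEigenvalue (fderiv ℂ (f^[n]) p) ls ∧ IsEigenvalue (fderiv ℂ (f^[n]) p) lu ∧
  ‖ls‖ < 1 ∧ 1 < ‖lu‖

/-- Coordinatewise complex conjugation `σ(x,y) = (x̄, ȳ)`. -/
def conjMap (z : ℂ × ℂ) : ℂ × ℂ := (starRingEnd ℂ z.1, starRingEnd ℂ z.2)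

/-- The open unit disk in `ℂ`. -/
def unitDisk : Set ℂ := Metric.ball 0 1

/-- `γ` is a transversal to `J⁺`. -/
def IsTransversal (f : ℂ × ℂ → ℂ × ℂ) (γ : ℂ → ℂ × ℂ) : Prop :=
  Set.InjOn γ unitDisk ∧ DifferentiableOn ℂ γ unitDisk ∧
  (∃ z ∈ unitDisk, γ z ∈ Kplus f) ∧ ¬ (∀ z ∈ unitDisk, γ z ∈ Kplus f)

/-- The Julia slice associated to a transversal. -/
def juliaSlice (f : ℂ × ℂ → ℂ × ℂ) (γ : ℂ → ℂ × ℂ) : Set ℂ :=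
  unitDisk ∩ frontier {z | z ∈ unitDisk ∧ γ z ∈ Kplus f}

/-- An unstable parametrization of a saddle periodic point. -/
def IsUnstableParam (f : ℂ × ℂ → ℂ × ℂ) (n : ℕ) (lu : ℂ) (p : ℂ × ℂ) (ψ : ℂ → ℂ × ℂ) : Prop :=
  Function.Injective ψ ∧ Differentiable ℂ ψ ∧ ψ 0 = p ∧
  ∀ ζ : ℂ, f^[n] (ψ ζ) = ψ (lu * ζ)

/-- `S` is contained in a proper real-analytic subvariety of `ℂ²`. -/
def ContainedInProperRealAnalyticSubvariety (S : Set (ℂ × ℂ)) : Prop :=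
  ∃ V : Set (ℂ × ℂ), IsClosed V ∧ V ≠ Set.univ ∧ S ⊆ V ∧
    ∀ x ∈ V, ∃ (U : Set (ℂ × ℂ)) (g : ℂ × ℂ → ℝ),
      IsOpen U ∧ x ∈ U ∧ (∀ y ∈ U, AnalyticAt ℝ g y) ∧
      (∃ y ∈ U, g y ≠ 0) ∧ ∀ y ∈ V ∩ U, g y = 0

section Part01

theorem ultralimit {E : Type*} [NormedAddCommGroup E] [NormedSpace ℂ E] [ProperSpace E]
    {U : Set ℂ} (hU : IsOpen U) (𝒰 : Ultrafilter ℕ) (γ : ℕ → ℂ → E)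
    (hb : ∀ z ∈ U, ∃ r > 0, ∃ C : ℝ, ∀ᶠ j in (𝒰 : Filter ℕ),
      DifferentiableOn ℂ (γ j) (Metric.ball z r) ∧ ∀ w ∈ Metric.ball z r, ‖γ j w‖ ≤ C) :
    ∃ g : ℂ → E, DifferentiableOn ℂ g U ∧ TendstoLocallyUniformlyOn γ g (𝒰 : Filter ℕ) U := by
  have hpt : ∀ z : ℂ, ∃ y : E, z ∈ U → Tendsto (fun j => γ j z) 𝒰 (𝓝 y) := by
    intro z
    by_cases hz : z ∈ U
    · obtain ⟨r, hr, C, h⟩ := hb z hz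
      have h1 : ∀ᶠ j in (𝒰 : Filter ℕ), γ j z ∈ Metric.closedBall (0:E) C := by
        filter_upwards [h] with j hj
        simpa using hj.2 z (Metric.mem_ball_self hr)
      obtain ⟨x, -, hx⟩ := (isCompact_closedBall (0:E) C).ultrafilter_le_nhds
        (𝒰.map (fun j => γ j z)) (by
          rw [Filter.le_principal_iff]; exact h1)
      exact ⟨x, fun _ => hx⟩
    · exact ⟨0, fun h => absurd h hz⟩
  choose g hg using hpt
  have hlu : TendstoLocallyUniformlyOn γ g (𝒰 : Filter ℕ) U := by
    rw [Metric.tendstoLocallyUniformlyOn_iff]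
    intro ε hε z hz
    obtain ⟨r, hr, C, h⟩ := hb z hz
    have hC0 : 0 ≤ C := by
      obtain ⟨j, hj⟩ := h.exists
      exact (norm_nonneg _).trans (hj.2 z (Metric.mem_ball_self hr))
    obtain ⟨r1, hr1, hr1U⟩ := Metric.isOpen_iff.1 hU z hz
    set K := 2 * C / r with hK
    have hK0 : 0 ≤ K := by positivity
    obtain ⟨δ, hδ, hδ1, hδ2, hδ3⟩ : ∃ δ > 0, δ ≤ r ∧ δ ≤ r1 ∧ K * δ < ε / 3 := by
      refine ⟨min (min r r1) (ε / (3 * (K + 1)) / 2), by positivity, ?_, ?_, ?_⟩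
      · exact (min_le_left _ _).trans (min_le_left _ _)
      · exact (min_le_left _ _).trans (min_le_right _ _)
      · calc K * min (min r r1) (ε / (3 * (K + 1)) / 2) ≤ (K + 1) * (ε / (3 * (K + 1)) / 2) := by
              gcongr
              · linarith
              · exact min_le_right _ _
          _ = ε / 6 := by field_simp; norm_num
          _ < ε / 3 := by linarith
    have hLip : ∀ᶠ j in (𝒰 : Filter ℕ), ∀ w ∈ Metric.ball z δ, dist (γ j w) (γ j z) < ε / 3 := by
      filter_upwards [h] with j hj w hw
      have := Complex.dist_le_div_mul_dist_of_mapsTo_ball (R₂ := 2 * C) hj.1 (by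
        intro w' hw'
        rw [Metric.mem_closedBall, dist_eq_norm]
        have := norm_sub_le (γ j w') (γ j z)
        have h1 := hj.2 w' hw'
        have h2 := hj.2 z (Metric.mem_ball_self hr)
        linarith) (Metric.ball_subset_ball hδ1 hw)
      refine this.trans_lt (lt_of_le_of_lt ?_ hδ3)
      exact mul_le_mul_of_nonneg_left (Metric.mem_ball.1 hw).le hK0
    refine ⟨Metric.ball z δ, mem_nhdsWithin_of_mem_nhds (Metric.ball_mem_nhds z hδ), ?_⟩
    have hz' : ∀ᶠ j in (𝒰 : Filter ℕ), dist (γ j z) (g z) < ε / 3 :=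
      (hg z hz).eventually (Metric.ball_mem_nhds _ (by positivity))
    filter_upwards [hLip, hz'] with j hj1 hj2 w hw
    have h3 : dist (g w) (g z) ≤ ε / 3 := by
      have hwU : w ∈ U := hr1U (Metric.ball_subset_ball hδ2 hw)
      refine le_of_tendsto ((hg w hwU).dist (hg z hz)) ?_
      filter_upwards [hLip] with i hi
      exact (hi w hw).le
    have h4 := dist_triangle4 (g w) (g z) (γ j z) (γ j w)
    have h5 := hj1 w hw
    rw [dist_comm] at h5 hj2
    linarith
  refine ⟨g, ?_, hlu⟩
  intro z hz
  obtain ⟨r, hr, C, h⟩ := hb z hz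
  obtain ⟨r1, hr1, hr1U⟩ := Metric.isOpen_iff.1 hU z hz
  have := (hlu.mono (s' := Metric.ball z (min r r1))
    ((Metric.ball_subset_ball (min_le_right _ _)).trans hr1U)).differentiableOn (by
      filter_upwards [h] with j hj
      exact hj.1.mono (Metric.ball_subset_ball (min_le_left _ _))) Metric.isOpen_ball
  exact (this.differentiableAt (Metric.ball_mem_nhds z (lt_min hr hr1))).differentiableWithinAt

open InnerProductSpace

/-- maximum principle core -/
theorem mp_core {B : Set ℂ} (hB : IsOpen B) (hbd : Bornology.IsBounded B) {v : ℂ → ℝ}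
    (hv : ContinuousOn v (closure B)) (hfr : ∀ z ∈ frontier B, v z ≤ 0)
    (hh : ∀ z ∈ B, 0 < v z → HarmonicAt v z) : ∀ z ∈ closure B, v z ≤ 0 := by
  by_contra hcon
  push Not at hcon
  obtain ⟨z0, hz0, hz0'⟩ := hcon
  have hK : IsCompact (closure B) := hbd.isCompact_closure
  obtain ⟨m, hm, hmax⟩ := hK.exists_isMaxOn ⟨z0, hz0⟩ hv
  have hMpos : 0 < v m := hz0'.trans_le (hmax hz0)
  set S := closure B ∩ v ⁻¹' {v m} with hS
  have hSc : IsCompact S := by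
    have : IsClosed S := hv.preimage_isClosed_of_isClosed isClosed_closure isClosed_singleton
    exact hK.of_isClosed_subset this inter_subset_left
  obtain ⟨w, hw, hwmax⟩ := hSc.exists_isMaxOn ⟨m, hm, rfl⟩ Complex.continuous_re.continuousOn
  have hwv : v w = v m := hw.2
  have hwB : w ∈ B := by
    by_contra hwB
    have : w ∈ frontier B := by
      rw [hB.frontier_eq]; exact ⟨hw.1, hwB⟩
    have := hfr w this
    linarith
  have hharm := hh w hwB (by rw [hwv]; exact hMpos)
  obtain ⟨r, hr, hrB⟩ := Metric.isOpen_iff.1 hB w hwB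
  obtain ⟨r2, hr2, hr2'⟩ : ∃ r2 > 0, HarmonicOnNhd v (Metric.ball w r2) := by
    have := (HarmonicAt.eventually hharm)
    obtain ⟨r2, hr2, h⟩ := Metric.eventually_nhds_iff_ball.1 this
    exact ⟨r2, hr2, h⟩
  obtain ⟨H, hH, hHre⟩ := hr2'.exists_analyticOnNhd_ball_re_eq
  have hloc : IsLocalMax (norm ∘ fun z => Complex.exp (H z)) w := by
    filter_upwards [Metric.ball_mem_nhds w hr, Metric.ball_mem_nhds w hr2] with z hz hz2
    simp only [Function.comp, Complex.norm_exp]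
    have e1 := hHre hz2
    have e2 := hHre (Metric.mem_ball_self hr2)
    simp only at e1 e2
    rw [e1, e2, hwv]
    exact Real.exp_le_exp.2 (hmax (subset_closure (hrB hz)))
  have hev := Complex.eventually_eq_of_isLocalMax_norm (by
    filter_upwards [Metric.ball_mem_nhds w hr2] with z hz
    exact (hH z hz).differentiableAt.cexp) hloc
  obtain ⟨r3, hr3, h3⟩ := Metric.eventually_nhds_iff_ball.1 hev
  set ρ := min (min r r2) r3 / 2 with hρ
  have hρ0 : 0 < ρ := by positivity
  have hρr : ρ < r := by
    have : min (min r r2) r3 ≤ r := (min_le_left _ _).trans (min_le_left _ _)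
    linarith
  have hρr2 : ρ < r2 := by
    have : min (min r r2) r3 ≤ r2 := (min_le_left _ _).trans (min_le_right _ _)
    linarith
  have hρr3 : ρ < r3 := by
    have : min (min r r2) r3 ≤ r3 := (min_le_right _ _)
    linarith
  have hd : dist (w + (ρ:ℂ)) w = ρ := by simp [abs_of_pos hρ0]
  have hin : w + (ρ:ℂ) ∈ S := by
    refine ⟨subset_closure (hrB (by rw [Metric.mem_ball, hd]; exact hρr)), ?_⟩
    have e0 := h3 (w + ρ) (by rw [Metric.mem_ball, hd]; exact hρr3)
    have e1 := hHre (show w + (ρ:ℂ) ∈ Metric.ball w r2 by rw [Metric.mem_ball, hd]; exact hρr2)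
    have e2 := hHre (Metric.mem_ball_self hr2)
    simp only at e1 e2
    have e3 := congrArg norm e0
    rw [Complex.norm_exp, Complex.norm_exp, Real.exp_eq_exp, e1, e2] at e3
    simp [e3, hwv]
  have := hwmax hin
  simp at this
  linarith

/-- Green-like functions -/
structure GLF (U : Set ℂ) (u : ℂ → ℝ) : Prop where
  cont : ContinuousOn u U
  nonneg : ∀ z ∈ U, 0 ≤ u z
  harm : ∀ z ∈ U, 0 < u z → HarmonicAt u z

theorem GLF.mono {U V : Set ℂ} {u : ℂ → ℝ} (h : GLF U u) (hV : V ⊆ U) : GLF V u :=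
  ⟨h.cont.mono hV, fun z hz => h.nonneg z (hV hz), fun z hz => h.harm z (hV hz)⟩

theorem harmAt_re {B : Set ℂ} (hB : IsOpen B) {P : ℂ → ℂ} (hP : DiffContOnCl ℂ P B)
    {z : ℂ} (hz : z ∈ B) : HarmonicAt (fun z => (P z).re) z :=
  AnalyticAt.harmonicAt_re (hP.differentiableOn.analyticAt (hB.mem_nhds hz))

theorem harmAt_neg {v : ℂ → ℝ} {z : ℂ} (h : HarmonicAt v z) :
    HarmonicAt (fun z => - v z) z := by
  have := HarmonicAt.const_smul (c := (-1:ℝ)) h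
  convert this using 2
  simp

theorem harmAt_sub {v w : ℂ → ℝ} {z : ℂ} (h : HarmonicAt v z) (h' : HarmonicAt w z) :
    HarmonicAt (fun z => v z - w z) z := by
  have := HarmonicAt.add h (harmAt_neg h')
  convert this using 2
  simp [sub_eq_add_neg]


theorem GLF.sub {U : Set ℂ} {u : ℂ → ℝ} (h : GLF U u) {B : Set ℂ} (hB : IsOpen B)
    (hbd : Bornology.IsBounded B) (hBU : closure B ⊆ U) {P : ℂ → ℂ} (hP : DiffContOnCl ℂ P B)
    (hfr : ∀ z ∈ frontier B, u z ≤ (P z).re) : ∀ z ∈ closure B, u z ≤ (P z).re := by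
  have hPc : ContinuousOn (fun z => (P z).re) (closure B) :=
    Complex.continuous_re.comp_continuousOn hP.continuousOn
  have h1 : ∀ z ∈ closure B, - (P z).re ≤ 0 := by
    refine mp_core hB hbd (v := fun z => - (P z).re) hPc.neg ?_ ?_
    · intro z hz
      have := h.nonneg z (hBU (frontier_subset_closure hz))
      have := hfr z hz
      linarith
    · intro z hz _
      exact harmAt_neg (harmAt_re hB hP hz)
  have h2 : ∀ z ∈ closure B, u z - (P z).re ≤ 0 := by
    refine mp_core hB hbd (v := fun z => u z - (P z).re) ((h.cont.mono hBU).sub hPc) ?_ ?_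
    · intro z hz
      have := hfr z hz
      linarith
    · intro z hz hz'
      have := h1 z (subset_closure hz)
      exact harmAt_sub (h.harm z (hBU (subset_closure hz)) (by linarith)) (harmAt_re hB hP hz)
  intro z hz
  have := h2 z hz
  linarith

theorem GLF.super {U : Set ℂ} {u : ℂ → ℝ} (h : GLF U u) {B : Set ℂ} (hB : IsOpen B)
    (hbd : Bornology.IsBounded B) (hBU : closure B ⊆ U) (hpos : ∀ z ∈ B, 0 < u z) {P : ℂ → ℂ}
    (hP : DiffContOnCl ℂ P B)
    (hfr : ∀ z ∈ frontier B, (P z).re ≤ u z) : ∀ z ∈ closure B, (P z).re ≤ u z := by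
  have hPc : ContinuousOn (fun z => (P z).re) (closure B) :=
    Complex.continuous_re.comp_continuousOn hP.continuousOn
  have h2 : ∀ z ∈ closure B, (P z).re - u z ≤ 0 := by
    refine mp_core hB hbd (v := fun z => (P z).re - u z) (hPc.sub (h.cont.mono hBU)) ?_ ?_
    · intro z hz
      have := hfr z hz
      linarith
    · intro z hz hz'
      exact harmAt_sub (harmAt_re hB hP hz) (h.harm z (hBU (subset_closure hz)) (hpos z hz))
  intro z hz
  have := h2 z hz
  linarith

theorem harnack_re {H : ℂ → ℂ} {w : ℂ} {r : ℝ} (hH : DifferentiableOn ℂ H (Metric.ball w r))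
    (hpos : ∀ z ∈ Metric.ball w r, 0 < (H z).re) {z : ℂ} (hz : z ∈ Metric.ball w r) :
    (H z).re * (r - ‖z - w‖) ≤ (r + ‖z - w‖) * (H w).re ∧
    (H w).re * (r - ‖z - w‖) ≤ (r + ‖z - w‖) * (H z).re := by
  have hr : 0 < r := Metric.pos_of_mem_ball hz
  have hw : w ∈ Metric.ball w r := Metric.mem_ball_self hr
  set b : ℂ := (starRingEnd ℂ) (H w) with hb
  have hne : ∀ z ∈ Metric.ball w r, H z + b ≠ 0 := by
    intro z hz h0
    have := congrArg Complex.re h0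
    simp [hb] at this
    have := hpos z hz
    have := hpos w hw
    linarith
  have key : ∀ z ∈ Metric.ball w r, ‖(H z - H w)‖ ≤ ‖H z + b‖ := by
    intro z hz
    have h1 := hpos z hz
    have h2 := hpos w hw
    rw [← sq_le_sq₀ (norm_nonneg _) (norm_nonneg _), Complex.sq_norm, Complex.sq_norm,
      Complex.normSq_apply, Complex.normSq_apply]
    simp [hb]
    nlinarith
  have hS := Complex.dist_le_div_mul_dist_of_mapsTo_ball (R₁ := r) (R₂ := 1)
    (f := fun z => (H z - H w) / (H z + b)) (c := w) (z := z)
    ((hH.sub_const _).div (hH.add_const _) hne) (by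
      intro z hz
      simp only [sub_self, zero_div, mem_closedBall_iff_norm, sub_zero, norm_div]
      exact div_le_one_of_le₀ (key z hz) (norm_nonneg _)) hz
  simp only [sub_self, zero_div, dist_zero_right, norm_div] at hS
  rw [div_le_iff₀ (norm_pos_iff.2 (hne z hz)), dist_eq_norm] at hS
  set t := ‖z - w‖ with ht
  have htr : t < r := by simpa [dist_eq_norm] using hz
  have ht0 : 0 ≤ t := norm_nonneg _
  have h1 := hpos z hz
  have h2 := hpos w hw
  clear_value t
  have hS2 : (r * ‖H z - H w‖) ^ 2 ≤ (t * ‖H z + b‖) ^ 2 := by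
    have : r * ‖H z - H w‖ ≤ t * ‖H z + b‖ := by
      calc r * ‖H z - H w‖ ≤ r * (1 / r * t * ‖H z + b‖) := by gcongr
        _ = t * ‖H z + b‖ := by field_simp
    gcongr
  rw [mul_pow, mul_pow, Complex.sq_norm, Complex.sq_norm,
      Complex.normSq_apply, Complex.normSq_apply] at hS2
  simp only [hb, Complex.sub_re, Complex.sub_im, Complex.add_re, Complex.add_im, Complex.conj_re, Complex.conj_im] at hS2
  have h3 : (r * ((H z).re - (H w).re)) ^ 2 ≤ (t * ((H z).re + (H w).re)) ^ 2 := by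
    have h5 : t ^ 2 ≤ r ^ 2 := by gcongr
    have h6 := mul_le_mul_of_nonneg_right h5 (sq_nonneg ((H z).im - (H w).im))
    nlinarith
  have h4 := abs_le.1 (abs_le_of_sq_le_sq h3 (by positivity))
  constructor
  · nlinarith [h4.2]
  · nlinarith [h4.1]

theorem GLF.exists_re {U : Set ℂ} {u : ℂ → ℝ} (h : GLF U u) {w : ℂ} {r : ℝ}
    (hb : Metric.ball w r ⊆ U) (hpos : ∀ z ∈ Metric.ball w r, 0 < u z) :
    ∃ H : ℂ → ℂ, DifferentiableOn ℂ H (Metric.ball w r) ∧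
      ∀ z ∈ Metric.ball w r, (H z).re = u z := by
  have : HarmonicOnNhd u (Metric.ball w r) := fun z hz => h.harm z (hb hz) (hpos z hz)
  obtain ⟨H, hH, hHre⟩ := this.exists_analyticOnNhd_ball_re_eq
  exact ⟨H, hH.differentiableOn, fun z hz => hHre hz⟩

theorem GLF.harnack {U : Set ℂ} {u : ℂ → ℝ} (h : GLF U u) {w : ℂ} {r : ℝ}
    (hb : Metric.ball w r ⊆ U) (hpos : ∀ z ∈ Metric.ball w r, 0 < u z) {z : ℂ}
    (hz : z ∈ Metric.ball w r) :
    u z * (r - ‖z - w‖) ≤ (r + ‖z - w‖) * u w ∧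
    u w * (r - ‖z - w‖) ≤ (r + ‖z - w‖) * u z := by
  obtain ⟨H, hH, hre⟩ := h.exists_re hb hpos
  have := harnack_re hH (fun z hz => by rw [hre z hz]; exact hpos z hz) hz
  rwa [hre z hz, hre w (Metric.mem_ball_self (Metric.pos_of_mem_ball hz))] at this

theorem inter_frontier_of_preconn {A S : Set ℂ} (hA : IsPreconnected A)
    (h1 : (A ∩ S).Nonempty) (h2 : (A ∩ Sᶜ).Nonempty) : (A ∩ frontier S).Nonempty := by
  by_contra hcon
  rw [not_nonempty_iff_eq_empty] at hcon
  have hno : ∀ z ∈ A, z ∉ frontier S := fun z hz hz' => by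
    have : z ∈ A ∩ frontier S := ⟨hz, hz'⟩
    rw [hcon] at this
    exact this
  obtain ⟨a, ha, haS⟩ := h1
  obtain ⟨b, hb, hbS⟩ := h2
  obtain ⟨c, -, hc1, hc2⟩ := hA (interior S) (closure S)ᶜ isOpen_interior isClosed_closure.isOpen_compl
    (by
      intro z hz
      by_cases h : z ∈ closure S
      · left
        by_contra h'
        exact hno z hz ⟨h, h'⟩
      · right; exact h)
    ⟨a, ha, by
      by_contra h'
      exact hno a ha ⟨subset_closure haS, h'⟩⟩
    ⟨b, hb, fun h => hno b hb ⟨h, fun h' => hbS (interior_subset h')⟩⟩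
  exact hc2 (interior_subset_closure hc1)

theorem dichotomy {U : Set ℂ} {u : ℂ → ℝ} (h : GLF U u) {A : Set ℂ} (hA : IsPreconnected A)
    (hAU : A ⊆ U) (hfr : ∀ z ∈ A, z ∉ frontier {z | z ∈ U ∧ u z = 0}) :
    (∀ z ∈ A, u z = 0) ∨ (∀ z ∈ A, 0 < u z) := by
  by_contra hcon
  push Not at hcon
  obtain ⟨⟨z1, h1, h1'⟩, z2, h2, h2'⟩ := hcon
  obtain ⟨e, he, he'⟩ := inter_frontier_of_preconn hA (S := {z | z ∈ U ∧ u z = 0})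
      ⟨z2, h2, hAU h2, le_antisymm h2' (h.nonneg z2 (hAU h2))⟩ ⟨z1, h1, fun hh => h1' hh.2⟩
  exact hfr e he he'

end Part01

section Part02

open InnerProductSpace

theorem GLF.comp {U V : Set ℂ} {u : ℂ → ℝ} (h : GLF U u) (hV : IsOpen V) {φ : ℂ → ℂ}
    (hφ : DifferentiableOn ℂ φ V) (hm : MapsTo φ V U) : GLF V (fun z => u (φ z)) := by
  refine ⟨h.cont.comp hφ.continuousOn hm, fun z hz => h.nonneg _ (hm hz), ?_⟩
  intro z hz hpos
  have h1 := h.harm _ (hm hz) hpos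
  obtain ⟨r2, hr2, hr2'⟩ := Metric.eventually_nhds_iff_ball.1 (HarmonicAt.eventually h1)
  have h2 : HarmonicOnNhd u (Metric.ball (φ z) r2) := hr2'
  obtain ⟨H, hH, hHre⟩ := h2.exists_analyticOnNhd_ball_re_eq
  have h3 : AnalyticAt ℂ (fun w => H (φ w)) z :=
    (hH (φ z) (Metric.mem_ball_self hr2)).comp (hφ.analyticAt (hV.mem_nhds hz))
  have h4 := h3.harmonicAt_re
  refine (harmonicAt_congr_nhds ?_).1 h4
  have hc : ContinuousAt φ z := (hφ.continuousOn).continuousAt (hV.mem_nhds hz)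
  filter_upwards [hc.preimage_mem_nhds (Metric.ball_mem_nhds (φ z) hr2)] with w hw
  exact hHre hw

theorem GLF.const_mul {U : Set ℂ} {u : ℂ → ℝ} (h : GLF U u) {c : ℝ} (hc : 0 < c) :
    GLF U (fun z => c * u z) := by
  refine ⟨h.cont.const_smul c, fun z hz => mul_nonneg hc.le (h.nonneg z hz), fun z hz hz' => ?_⟩
  exact HarmonicAt.const_smul (c := c) (h.harm z hz (by
    by_contra h0
    nlinarith))

theorem frontier_inter_open {S V : Set ℂ} (hV : IsOpen V) :
    frontier (S ∩ V) ∩ V = frontier S ∩ V := by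
  exact frontier_inter_open_inter hV

theorem poisson_re (c : ℝ) (ξ : ℂ) :
    ((1 + c * ξ) / (1 - c * ξ)).re = (1 - c ^ 2 * Complex.normSq ξ) / Complex.normSq (1 - c * ξ) := by
  rw [Complex.div_re, ← add_div]
  congr 1
  simp [Complex.normSq_apply]
  ring

theorem poisson_ne {c : ℝ} (hc0 : 0 ≤ c) (hc1 : c < 1) {ξ : ℂ} (hξ : ‖ξ‖ ≤ 1) : 1 - (c:ℂ) * ξ ≠ 0 := by
  intro h
  have : ‖(c:ℂ) * ξ‖ = 1 := by
    rw [← sub_eq_zero.1 h]; simp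
  rw [norm_mul, Complex.norm_real, Real.norm_of_nonneg hc0] at this
  nlinarith [norm_nonneg ξ]

theorem poisson_nonneg {c : ℝ} (hc0 : 0 ≤ c) (hc1 : c < 1) {ξ : ℂ} (hξ : ‖ξ‖ ≤ 1) :
    0 ≤ ((1 + c * ξ) / (1 - c * ξ)).re := by
  rw [poisson_re]
  refine div_nonneg ?_ (Complex.normSq_nonneg _)
  rw [← Complex.sq_norm, ← mul_pow]
  have : c * ‖ξ‖ ≤ 1 := by nlinarith [norm_nonneg ξ]
  have : 0 ≤ c * ‖ξ‖ := by positivity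
  nlinarith

theorem poisson_big {c : ℝ} (hc0 : 0 ≤ c) (hc1 : c < 1) {ξ : ℂ} (hξ : ‖ξ‖ = 1)
    (hn : ‖ξ - 1‖ ≤ 1 - c) :
    1 ≤ (4 * (1 - c) / (1 + c)) * ((1 + c * ξ) / (1 - c * ξ)).re := by
  have hne := poisson_ne hc0 hc1 hξ.le
  have h1 : ‖1 - (c:ℂ) * ξ‖ ≤ 2 * (1 - c) := by
    have : 1 - (c:ℂ) * ξ = -(ξ - 1) + ((1 - c : ℝ) : ℂ) * ξ := by push_cast; ring
    rw [this]
    refine (norm_add_le _ _).trans ?_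
    rw [norm_neg, norm_mul, hξ, Complex.norm_real, Real.norm_of_nonneg (by linarith)]
    linarith
  have h2 : 0 < ‖1 - (c:ℂ) * ξ‖ := norm_pos_iff.2 hne
  rw [poisson_re, ← Complex.sq_norm, ← Complex.sq_norm, hξ, div_mul_div_comm,
    le_div_iff₀ (by positivity)]
  have : ‖1 - (c:ℂ) * ξ‖ ^ 2 ≤ (2 * (1 - c)) ^ 2 := by gcongr
  have h3 : 0 < 1 + c := by linarith
  nlinarith

/-- Domar type estimate -/
theorem lemmaN_b {u : ℂ → ℝ} (h : GLF (Metric.ball 0 50) u) {E : Set ℂ}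
    (hE : E = frontier {z | z ∈ Metric.ball (0:ℂ) 50 ∧ u z = 0}) (h0 : (0:ℂ) ∈ E)
    (hflat : ∀ e ∈ E, ∀ e' ∈ E, ‖e‖ < 50 → ‖e'‖ < 50 → |(e - e').im| ≤ 1 / 10000 * ‖e - e'‖)
    (hp : u (Complex.I / 2) ≤ 1) (hm : u (-Complex.I / 2) ≤ 1) :
    ∀ z : ℂ, |z.re| ≤ 3 → |z.im| ≤ 3 → u z * Metric.infDist z E ^ 14 ≤ 24000 * 5 ^ 14 := by
  have hEc : IsClosed E := by rw [hE]; exact isClosed_frontier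
  have hEne : E.Nonempty := ⟨0, h0⟩
  have hdich : ∀ A : Set ℂ, IsPreconnected A → A ⊆ Metric.ball 0 50 → (∀ z ∈ A, z ∉ E) →
      (∀ z ∈ A, u z = 0) ∨ (∀ z ∈ A, 0 < u z) := by
    intro A h1 h2 h3
    exact dichotomy h h1 h2 (by rw [← hE]; exact h3)
  -- base
  have hbase : ∀ τ : ℝ, (τ = 1 ∨ τ = -1) → u (τ * Complex.I / 2) ≤ 1 →
      ∀ z : ℂ, |z.re| ≤ 3 → 1 / 2 ≤ τ * z.im → τ * z.im ≤ 3 → u z ≤ 24000 := by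
    intro τ hτ hu z hz1 hz2 hz3
    have hτ2 : τ ^ 2 = 1 := by rcases hτ with h | h <;> simp [h]
    have hnw : ‖(τ:ℂ) * (20 * Complex.I)‖ = 20 := by
      rcases hτ with h | h <;> simp [h]
    have hsub : Metric.ball ((τ:ℂ) * (20 * Complex.I)) 19.9 ⊆ Metric.ball 0 50 := by
      intro w hw
      rw [mem_ball_iff_norm] at hw ⊢
      have := norm_add_le (w - (τ:ℂ) * (20 * Complex.I)) ((τ:ℂ) * (20 * Complex.I))
      rw [sub_add_cancel, hnw] at this
      rw [sub_zero]
      linarith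
    have hnE : ∀ w ∈ Metric.ball ((τ:ℂ) * (20 * Complex.I)) 19.9, w ∉ E := by
      intro w hw hwE
      have hw' := hsub hw
      have h1 := hflat w hwE 0 h0 (by simpa using hw') (by norm_num)
      rw [mem_ball_iff_norm] at hw hw'
      have h2 := (Complex.abs_im_le_norm _).trans_lt hw
      simp at h1 h2 hw'
      have h3 : |τ * (w.im - τ * 20)| < 19.9 := by
        rcases hτ with h | h <;> subst h
        · simpa using h2
        · rw [abs_mul]; simpa using h2
      have h4 : |τ * w.im| ≤ 1 / 10000 * ‖w‖ := by
        rcases hτ with h | h <;> subst h <;> simpa using h1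
      have h3' := abs_lt.1 h3
      have h4' := abs_le.1 h4
      nlinarith
    have hdist : ∀ w : ℂ, |w.re| ≤ 3 → 1 / 2 ≤ τ * w.im → τ * w.im ≤ 3 →
        ‖w - (τ:ℂ) * (20 * Complex.I)‖ ≤ 19.73 := by
      intro w h1 h2 h3
      rw [← abs_of_nonneg (show (0:ℝ) ≤ 19.73 by norm_num), ← abs_norm, ← sq_le_sq, Complex.sq_norm,
        Complex.normSq_apply]
      simp
      have h1' := abs_le.1 h1
      have : w.re * w.re ≤ 9 := by nlinarith
      have e : (w.im - τ * 20) * (w.im - τ * 20) = (τ * w.im - 20) ^ 2 := by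
        linear_combination (- w.im ^ 2 + 400) * hτ2
      rw [e]
      nlinarith
    rcases hdich _ (convex_ball _ _).isPreconnected hsub hnE with h1 | h1
    · have : u z = 0 := h1 z (by
        rw [mem_ball_iff_norm]
        have := hdist z hz1 hz2 hz3
        linarith)
      rw [this]; norm_num
    · have d1 := hdist z hz1 hz2 hz3
      have hI : (τ * Complex.I / 2 : ℂ) - (τ:ℂ) * (20 * Complex.I) = (τ:ℂ) * (-(39/2) * Complex.I) := by ring
      have d2 : ‖(τ * Complex.I / 2 : ℂ) - (τ:ℂ) * (20 * Complex.I)‖ = 19.5 := by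
        rw [hI]
        rcases hτ with h | h <;> subst h <;> simp <;> norm_num
      have k1 := (h.harnack hsub h1 (z := z) (by rw [mem_ball_iff_norm]; linarith)).1
      have k2 := (h.harnack hsub h1 (z := τ * Complex.I / 2) (by
        rw [mem_ball_iff_norm, d2]; norm_num)).2
      rw [d2] at k2
      set t := ‖z - (τ:ℂ) * (20 * Complex.I)‖
      set a := u (τ * Complex.I / 2)
      set b := u ((τ:ℂ) * (20 * Complex.I)) with hb
      have hb0 : 0 < b := h1 _ (Metric.mem_ball_self (by norm_num))
      have hz0 : 0 < u z := h1 _ (by rw [mem_ball_iff_norm]; linarith)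
      have ht0 : 0 ≤ t := norm_nonneg _
      have hb1 : b ≤ 98.5 := by nlinarith
      have : u z * 0.17 ≤ 39.7 * 98.5 := by nlinarith
      nlinarith
  have hbase' : ∀ z : ℂ, |z.re| ≤ 3 → |z.im| ≤ 3 → 1 / 2 ≤ |z.im| → u z ≤ 24000 := by
    intro z hz1 hz2 hz3
    rcases le_total 0 z.im with h1 | h1
    · rw [abs_of_nonneg h1] at hz2 hz3
      exact hbase 1 (Or.inl rfl) (by simpa using hp) z hz1 (by linarith) (by linarith)
    · rw [abs_of_nonpos h1] at hz2 hz3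
      exact hbase (-1) (Or.inr rfl) (by simpa using hm) z hz1 (by linarith) (by linarith)
  have hn43 : ∀ z : ℂ, |z.re| ≤ 3 → |z.im| ≤ 3 → ‖z‖ ≤ 5 := by
    intro z h1 h2
    rw [← abs_of_nonneg (show (0:ℝ) ≤ 5 by norm_num), ← abs_norm, ← sq_le_sq, Complex.sq_norm,
        Complex.normSq_apply]
    have h1' := abs_le.1 h1
    have h2' := abs_le.1 h2
    nlinarith
  have hinf : ∀ z : ℂ, Metric.infDist z E ≤ ‖z‖ := by
    intro z
    have := Metric.infDist_le_dist_of_mem (x := z) h0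
    simpa using this
  -- step
  have hstep : ∀ z : ℂ, |z.re| ≤ 3 → |z.im| < 1 / 2 → 0 < Metric.infDist z E →
      ∃ z' : ℂ, |z'.re| ≤ 3 ∧ |z'.im| ≤ 3 ∧ u z ≤ 3 * u z' ∧
        1.2 * Metric.infDist z E ^ 2 ≤ Metric.infDist z' E ^ 2 := by
    intro z hz1 hz2 hδ
    set δ := Metric.infDist z E with hδd
    have hz5 : ‖z‖ ≤ 4 := by
      rw [← abs_of_nonneg (show (0:ℝ) ≤ 4 by norm_num), ← abs_norm, ← sq_le_sq, Complex.sq_norm,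
        Complex.normSq_apply]
      have h1' := abs_le.1 hz1
      have h2' := abs_lt.1 hz2
      nlinarith
    have hδ4 : δ ≤ 4 := (hinf z).trans hz5
    obtain ⟨e, heE, hed⟩ := hEc.exists_infDist_eq_dist hEne z
    rw [← hδd, dist_eq_norm] at hed
    obtain ⟨σ, hσ, hσ'⟩ : ∃ σ : ℝ, (σ = 1 ∨ σ = -1) ∧ 0 ≤ σ * (z - e).im := by
      rcases le_total 0 (z - e).im with h1 | h1
      · exact ⟨1, Or.inl rfl, by linarith⟩
      · exact ⟨-1, Or.inr rfl, by linarith⟩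
    have hσ2 : σ ^ 2 = 1 := by rcases hσ with h | h <;> simp [h]
    set w : ℂ := ((σ * δ / 2 : ℝ) : ℂ) * Complex.I with hw
    have hwre : w.re = 0 := by simp [hw]
    have hwim : w.im = σ * δ / 2 := by simp [hw]
    have hwn : ‖w‖ = δ / 2 := by
      rw [hw, norm_mul, Complex.norm_I, Complex.norm_real, Real.norm_eq_abs]
      rcases hσ with h | h <;> subst h
      · rw [abs_of_nonneg (by linarith)]; ring
      · rw [abs_of_nonpos (by linarith)]; ring
    have hen : ‖e‖ < 50 := by
      have := norm_sub_le z (z - e)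
      rw [sub_sub_cancel] at this
      linarith
    have hfar : ∀ e' ∈ E, 1.2 * δ ^ 2 ≤ ‖(z + w) - e'‖ ^ 2 := by
      intro e' he'
      by_contra hcon
      push Not at hcon
      have hlt : ‖(z + w) - e'‖ < 1.1 * δ := by
        by_contra h'
        push Not at h'
        have : (1.1 * δ) ^ 2 ≤ ‖(z + w) - e'‖ ^ 2 := by gcongr
        nlinarith
      have hee : ‖e - e'‖ ≤ 2.6 * δ := by
        have e1 : e - e' = -(z - e) - w + ((z + w) - e') := by ring
        rw [e1]
        have := norm_add_le (-(z - e) - w) ((z + w) - e')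
        have := norm_sub_le (-(z - e)) w
        rw [norm_neg] at this
        linarith
      have he'n : ‖e'‖ < 50 := by
        have := norm_sub_le e (e - e')
        rw [sub_sub_cancel] at this
        have := norm_sub_le z (z - e)
        rw [sub_sub_cancel] at this
        linarith
      have hf := hflat e heE e' he' hen he'n
      have hd' : δ ≤ ‖z - e'‖ := by
        have := Metric.infDist_le_dist_of_mem (x := z) he'
        rwa [dist_eq_norm] at this
      have hexp : ‖(z + w) - e'‖ ^ 2 = ‖z - e'‖ ^ 2 + σ * δ * (z - e').im + δ ^ 2 / 4 := by
        rw [Complex.sq_norm, Complex.sq_norm, Complex.normSq_apply, Complex.normSq_apply]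
        simp only [Complex.sub_re, Complex.add_re, Complex.sub_im, Complex.add_im, hwre, hwim]
        linear_combination (δ ^ 2 / 4) * hσ2
      have him : -(2.6 / 10000 * δ) ≤ σ * (z - e').im := by
        have e1 : (z - e').im = (z - e).im + (e - e').im := by simp
        rw [e1, mul_add]
        have : |σ * (e - e').im| ≤ 2.6 / 10000 * δ := by
          rw [abs_mul]
          have : |σ| = 1 := by rcases hσ with h | h <;> simp [h]
          rw [this]
          linarith
        have := (abs_le.1 this).1
        linarith
      have : δ ^ 2 ≤ ‖z - e'‖ ^ 2 := by gcongr
      nlinarith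
    have hfar' : 1.2 * δ ^ 2 ≤ Metric.infDist (z + w) E ^ 2 := by
      obtain ⟨e', he', hd⟩ := hEc.exists_infDist_eq_dist hEne (z + w)
      rw [hd, dist_eq_norm]
      exact hfar e' he'
    refine ⟨z + w, by simpa [hwre] using hz1, ?_, ?_, hfar'⟩
    · simp only [Complex.add_im, hwim]
      have : |σ * δ / 2| = δ / 2 := by
        rcases hσ with h | h <;> subst h
        · rw [abs_of_nonneg (by linarith)]; ring
        · rw [abs_of_nonpos (by linarith)]; ring
      have h3 := abs_add_le z.im (σ * δ / 2)
      linarith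
    · have hsub : Metric.ball (z + w) δ ⊆ Metric.ball 0 50 := by
        intro x hx
        rw [mem_ball_iff_norm] at hx ⊢
        have h1 := norm_add_le (x - (z + w)) (z + w)
        rw [sub_add_cancel] at h1
        have h2 := norm_add_le z w
        rw [sub_zero]
        linarith
      have hnE : ∀ x ∈ Metric.ball (z + w) δ, x ∉ E := by
        intro x hx hxE
        have h1 := hfar x hxE
        rw [mem_ball_iff_norm, norm_sub_rev] at hx
        have : ‖z + w - x‖ ^ 2 ≤ δ ^ 2 := by gcongr
        nlinarith
      have hzm : z ∈ Metric.ball (z + w) δ := by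
        rw [mem_ball_iff_norm]
        simp [hwn]
        linarith
      rcases hdich _ (convex_ball _ _).isPreconnected hsub hnE with h1 | h1
      · rw [h1 z hzm, h1 _ (Metric.mem_ball_self hδ)]; norm_num
      · have k := (h.harnack hsub h1 hzm).1
        have : ‖z - (z + w)‖ = δ / 2 := by simp [hwn]
        rw [this] at k
        have k2 : δ / 2 * u z ≤ δ / 2 * (3 * u (z + w)) := by linarith
        exact le_of_mul_le_mul_left k2 (by linarith)
  -- compactness
  set Q : Set ℂ := {z | |z.re| ≤ 3 ∧ |z.im| ≤ 3} with hQ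
  have hQc : IsCompact Q := by
    refine Metric.isCompact_of_isClosed_isBounded ?_ ?_
    · exact (isClosed_le (Complex.continuous_re.abs) continuous_const).inter
        (isClosed_le (Complex.continuous_im.abs) continuous_const)
    · refine (Metric.isBounded_closedBall (x := (0:ℂ)) (r := 5)).subset ?_
      intro z hz
      simpa using hn43 z hz.1 hz.2
  have hQU : Q ⊆ Metric.ball 0 50 := by
    intro z hz
    have := hn43 z hz.1 hz.2
    rw [mem_ball_iff_norm, sub_zero]; linarith
  have hcont : ContinuousOn (fun z => u z * Metric.infDist z E ^ 14) Q :=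
    (h.cont.mono hQU).mul ((Metric.continuous_infDist_pt E).pow 14).continuousOn
  obtain ⟨m, hm, hmax⟩ := hQc.exists_isMaxOn ⟨0, by simp [hQ]⟩ hcont
  suffices hs : u m * Metric.infDist m E ^ 14 ≤ 24000 * 5 ^ 14 by
    intro z hz1 hz2
    exact (hmax (show z ∈ Q from ⟨hz1, hz2⟩)).trans hs
  have hum := h.nonneg m (hQU hm)
  have hinfm : Metric.infDist m E ≤ 5 := (hinf m).trans (hn43 m hm.1 hm.2)
  have hinf0 : 0 ≤ Metric.infDist m E := Metric.infDist_nonneg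
  by_cases h1 : 1 / 2 ≤ |m.im|
  · have := hbase' m hm.1 hm.2 h1
    gcongr
  · push Not at h1
    rcases hinf0.eq_or_lt with h2 | h2
    · rw [← h2]; norm_num
    · obtain ⟨z', hz1, hz2, hz3, hz4⟩ := hstep m hm.1 h1 h2
      have hle := hmax (show z' ∈ Q from ⟨hz1, hz2⟩)
      simp only at hle
      set a := Metric.infDist m E
      set b := Metric.infDist z' E
      have hb : (1.2 * a ^ 2) ^ 7 ≤ (b ^ 2) ^ 7 := by gcongr
      have hb' : 3.5 * a ^ 14 ≤ b ^ 14 := by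
        have : (1.2 * a ^ 2) ^ 7 = 1.2 ^ 7 * a ^ 14 := by ring
        rw [this, ← pow_mul] at hb
        have h14 : 0 ≤ a ^ 14 := by positivity
        nlinarith
      have hz0 : 0 ≤ u z' := h.nonneg _ (hQU ⟨hz1, hz2⟩)
      have h14 : 0 ≤ a ^ 14 := by positivity
      have e1 : u z' * (3.5 * a ^ 14) ≤ u m * a ^ 14 := (mul_le_mul_of_nonneg_left hb' hz0).trans hle
      have e2 : u m * a ^ 14 ≤ 3 * u z' * a ^ 14 := mul_le_mul_of_nonneg_right hz3 h14
      have e3 : u z' * a ^ 14 ≤ 0 := by nlinarith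
      nlinarith

end Part02

section Part03

open InnerProductSpace

theorem near_one (ζ : ℂ) (hre : 0 ≤ ζ.re) (hsq : ζ.re ^ 2 + ζ.im ^ 2 = 1)
    (him2 : ζ.im ^ 2 ≤ (3 / 5000) ^ 2) : ‖ζ - 1‖ ≤ 1 - 999 / 1000 := by
  have h1 : ζ.re ≤ 1 := by nlinarith
  have h2 : (1 - ζ.re) ≤ (3 / 5000) ^ 2 := by nlinarith
  have h3 : ‖ζ - 1‖ ^ 2 = 2 - 2 * ζ.re := by
    rw [Complex.sq_norm, Complex.normSq_apply]
    simp only [Complex.sub_re, Complex.one_re, Complex.sub_im, Complex.one_im]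
    linear_combination hsq
  have h4 : ‖ζ - 1‖ ^ 2 ≤ (1 / 1000) ^ 2 := by rw [h3]; norm_num at h2 ⊢; linarith
  have := abs_le_of_sq_le_sq h4 (by norm_num)
  rw [abs_norm] at this
  linarith

set_option maxHeartbeats 1000000 in
theorem lemmaN_c {u : ℂ → ℝ} (h : GLF (Metric.ball 0 50) u) {E : Set ℂ}
    (hE : E = frontier {z | z ∈ Metric.ball (0:ℂ) 50 ∧ u z = 0}) (h0 : (0:ℂ) ∈ E)
    (hflat : ∀ e ∈ E, ∀ e' ∈ E, ‖e‖ < 50 → ‖e'‖ < 50 → |(e - e').im| ≤ 1 / 10000 * ‖e - e'‖)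
    (hp : u (Complex.I / 2) ≤ 1) (hm : u (-Complex.I / 2) ≤ 1) :
    ∀ s : ℂ, ‖s‖ ≤ 2 → u s ≤ 48000 * 5 ^ 14 * 20000 ^ 14 := by
  have hb := lemmaN_b h hE h0 hflat hp hm
  have hEc : IsClosed E := by rw [hE]; exact isClosed_frontier
  have hEne : E.Nonempty := ⟨0, h0⟩
  have hDU : Metric.closedBall (0:ℂ) 3 ⊆ Metric.ball 0 50 :=
    Metric.closedBall_subset_ball (by norm_num)
  have hcont : ContinuousOn (fun s => u s * (3 - ‖s‖) ^ 14) (Metric.closedBall (0:ℂ) 3) :=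
    (h.cont.mono hDU).mul ((continuous_const.sub continuous_norm).pow 14).continuousOn
  obtain ⟨s0, hs0, hmax⟩ := (isCompact_closedBall (0:ℂ) 3).exists_isMaxOn ⟨0, by simp⟩ hcont
  have hs03 : ‖s0‖ ≤ 3 := by simpa using hs0
  suffices hs : u s0 * (3 - ‖s0‖) ^ 14 ≤ 48000 * 5 ^ 14 * 20000 ^ 14 by
    intro s hs2
    have hsb : s ∈ Metric.closedBall (0:ℂ) 3 := by simp; linarith
    have h1 := (hmax hsb).trans hs
    simp only at h1
    refine le_trans ?_ h1
    have : 0 ≤ u s := h.nonneg s (hDU hsb)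
    have h2 : 1 ≤ (3 - ‖s‖) ^ 14 := one_le_pow₀ (by linarith)
    nlinarith
  by_contra hcon
  push Not at hcon
  set M := u s0 with hM
  set δ := 3 - ‖s0‖ with hδ
  have hδ0 : 0 ≤ δ := by simp [hδ]; linarith
  have hM0 : 0 ≤ M := h.nonneg s0 (hDU hs0)
  have hδpos : 0 < δ := by
    rcases hδ0.eq_or_lt with h1 | h1
    · rw [← h1] at hcon; norm_num at hcon
    · exact h1
  have hMpos : 0 < M := by
    rcases hM0.eq_or_lt with h1 | h1
    · rw [← h1] at hcon; norm_num at hcon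
    · exact h1
  set r := δ / 4 with hr
  have hrpos : 0 < r := by positivity
  -- points with large values are near E
  have hnear : ∀ s : ℂ, ‖s‖ ≤ 3 → M / 2 < u s → ∃ e ∈ E, ‖s - e‖ ≤ r / 5000 ∧ ‖e‖ < 50 := by
    intro s hs hus
    obtain ⟨e, he, hd⟩ := hEc.exists_infDist_eq_dist hEne s
    have h1 := hb s ((Complex.abs_re_le_norm s).trans hs) ((Complex.abs_im_le_norm s).trans hs)
    rw [hd, dist_eq_norm] at h1
    have hse : ‖s - e‖ ≤ r / 5000 := by
      by_contra h2
      push Not at h2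
      have h3 : (r / 5000) ^ 14 ≤ ‖s - e‖ ^ 14 := by gcongr
      have hus0 : 0 ≤ u s := by linarith
      have h4 : M / 2 * (r / 5000) ^ 14 ≤ u s * ‖s - e‖ ^ 14 := by gcongr
      have h5 : M / 2 * (r / 5000) ^ 14 = (M * δ ^ 14) / (2 * 20000 ^ 14) := by
        rw [hr]; ring
      rw [h5] at h4
      have h6 : 48000 * 5 ^ 14 * 20000 ^ 14 / (2 * 20000 ^ 14) < (M * δ ^ 14) / (2 * 20000 ^ 14) := by
        gcongr
      have h7 : (48000 * 5 ^ 14 * 20000 ^ 14 / (2 * 20000 ^ 14) : ℝ) = 24000 * 5 ^ 14 := by norm_num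
      rw [h7] at h6
      linarith
    refine ⟨e, he, hse, ?_⟩
    have := norm_sub_le s (s - e)
    rw [sub_sub_cancel] at this
    have : r ≤ 3 := by
      have := norm_nonneg s0
      simp only [hr, hδ]; linarith
    linarith
  obtain ⟨e0, he0, hse0, hn0⟩ := hnear s0 hs03 (by linarith)
  have hball : Metric.closedBall s0 r ⊆ Metric.closedBall 0 3 := by
    intro s hs
    rw [mem_closedBall_iff_norm] at hs ⊢
    have := norm_add_le (s - s0) s0
    rw [sub_add_cancel] at this
    rw [sub_zero]
    simp only [hr] at hs
    linarith
  set c : ℝ := 999 / 1000 with hc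
  have hc0 : 0 ≤ c := by norm_num [hc]
  have hc1 : c < 1 := by norm_num [hc]
  set α : ℝ := 4 * (1 - c) / (1 + c) with hα
  have hα0 : 0 ≤ α := by norm_num [hα, hc]
  set ξ : ℂ → ℂ := fun s => (s - s0) / r with hξ
  have hξn : ∀ s, ‖ξ s‖ = ‖s - s0‖ / r := by
    intro s
    simp [hξ, abs_of_pos hrpos]
  set P : ℂ → ℂ := fun s => ((M / 2 : ℝ) : ℂ) + ((57 * M * α : ℝ) : ℂ) *
    ((1 + c * ξ s) / (1 - c * ξ s) + (1 + c * (- ξ s)) / (1 - c * (- ξ s))) with hP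
  have hPre : ∀ s, (P s).re = M / 2 + 57 * M * (α * ((1 + c * ξ s) / (1 - c * ξ s)).re +
      α * ((1 + c * (- ξ s)) / (1 - c * (- ξ s))).re) := by
    intro s
    simp only [hP, Complex.add_re, Complex.re_ofReal_mul, Complex.ofReal_re]
    ring
  have hPd : DiffContOnCl ℂ P (Metric.ball s0 r) := by
    refine DifferentiableOn.diffContOnCl ?_
    rw [closure_ball _ hrpos.ne']
    intro s hs
    have hs1 : ‖ξ s‖ ≤ 1 := by
      rw [hξn, div_le_one hrpos]; simpa [dist_eq_norm] using hs
    have n1 := poisson_ne hc0 hc1 hs1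
    have n2 := poisson_ne hc0 hc1 (ξ := - ξ s) (by rwa [norm_neg])
    have hξd : DifferentiableAt ℂ ξ s := by
      simp only [hξ]; fun_prop
    refine DifferentiableAt.differentiableWithinAt ?_
    refine (differentiableAt_const _).add ((differentiableAt_const _).mul (DifferentiableAt.add ?_ ?_))
    · exact DifferentiableAt.div (by fun_prop) (by fun_prop) n1
    · exact DifferentiableAt.div (by fun_prop) (by fun_prop) n2
  have hcmp := h.sub Metric.isOpen_ball Metric.isBounded_ball (B := Metric.ball s0 r)
    (by rw [closure_ball _ hrpos.ne']; exact hball.trans hDU) hPd (by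
      intro s hs
      rw [frontier_ball _ hrpos.ne'] at hs
      have hsn : ‖s - s0‖ = r := by simpa [dist_eq_norm] using hs
      have hs3 : s ∈ Metric.closedBall (0:ℂ) 3 := hball (Metric.sphere_subset_closedBall hs)
      have hs3n : ‖s‖ ≤ 3 := by simpa using hs3
      have hs1 : ‖ξ s‖ = 1 := by rw [hξn, hsn, div_self hrpos.ne']
      have p1 := poisson_nonneg hc0 hc1 hs1.le
      have p2 := poisson_nonneg hc0 hc1 (ξ := - ξ s) (by rw [norm_neg, hs1])
      rw [hPre]
      by_cases hbig : u s ≤ M / 2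
      · have : 0 ≤ 57 * M * (α * ((1 + c * ξ s) / (1 - c * ξ s)).re +
          α * ((1 + c * (- ξ s)) / (1 - c * (- ξ s))).re) := by positivity
        linarith
      · push Not at hbig
        obtain ⟨e, he, hse, hn⟩ := hnear s hs3n hbig
        have hup : u s ≤ 57 * M := by
          have h1 := hmax hs3
          simp only at h1
          have h2 : 3 / 4 * δ ≤ 3 - ‖s‖ := by
            have := norm_add_le (s - s0) s0
            rw [sub_add_cancel, hsn] at this
            simp only [hr, hδ] at this ⊢; linarith
          have h3 : (3 / 4 * δ) ^ 14 ≤ (3 - ‖s‖) ^ 14 := by gcongr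
          have hus : 0 ≤ u s := h.nonneg s (hDU hs3)
          have h4 : u s * (3 / 4 * δ) ^ 14 ≤ M * δ ^ 14 :=
            (mul_le_mul_of_nonneg_left h3 hus).trans h1
          rw [mul_pow] at h4
          have h5 : (u s * (3 / 4) ^ 14) * δ ^ 14 ≤ M * δ ^ 14 := by linarith
          have h6 := le_of_mul_le_mul_right h5 (by positivity)
          norm_num at h6
          linarith
        have him : |(ξ s).im| ≤ 3 / 5000 := by
          have h1 := hflat e he e0 he0 hn hn0
          have h2 : ‖e - e0‖ ≤ 2 * r := by
            have : e - e0 = -(s - e) + (s - s0) + (s0 - e0) := by ring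
            rw [this]
            have k1 := norm_add_le (-(s - e) + (s - s0)) (s0 - e0)
            have k2 := norm_add_le (-(s - e)) (s - s0)
            rw [norm_neg] at k2
            linarith
          have h3 : |(s - s0).im| ≤ 3 / 5000 * r := by
            have : (s - s0).im = (s - e).im + (e - e0).im - (s0 - e0).im := by simp
            rw [this]
            have k1 := (Complex.abs_im_le_norm (s - e)).trans hse
            have k2 := (Complex.abs_im_le_norm (s0 - e0)).trans hse0
            have k1 := abs_le.1 k1
            have k2 := abs_le.1 k2
            have k3 := abs_le.1 h1
            rw [abs_le]
            constructor <;> linarith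
          have h4 : (ξ s).im = (s - s0).im / r := by
            simp only [hξ]; rw [Complex.div_ofReal_im]
          rw [h4, abs_div, abs_of_pos hrpos, div_le_iff₀ hrpos]
          exact h3
        have hsq : (ξ s).re ^ 2 + (ξ s).im ^ 2 = 1 := by
          have := Complex.sq_norm (ξ s)
          rw [hs1, Complex.normSq_apply] at this
          linarith
        have him2 : (ξ s).im ^ 2 ≤ (3 / 5000) ^ 2 := by
          rw [← sq_abs]; gcongr
        have hone : 1 ≤ α * ((1 + c * ξ s) / (1 - c * ξ s)).re +
            α * ((1 + c * (- ξ s)) / (1 - c * (- ξ s))).re := by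
          rcases le_total 0 (ξ s).re with h1 | h1
          · have := poisson_big hc0 hc1 hs1 (near_one _ h1 hsq him2)
            have : 0 ≤ α * ((1 + c * (- ξ s)) / (1 - c * (- ξ s))).re := by positivity
            linarith
          · have := poisson_big hc0 hc1 (ξ := - ξ s) (by rw [norm_neg, hs1])
              (near_one _ (by simpa using h1) (by simpa using hsq) (by simpa using him2))
            have : 0 ≤ α * ((1 + c * ( ξ s)) / (1 - c * ( ξ s))).re := by positivity
            linarith
        nlinarith)
  have := hcmp s0 (subset_closure (Metric.mem_ball_self hrpos))
  rw [hPre] at this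
  simp only [hξ, sub_self, zero_div, neg_zero, mul_zero, add_zero, sub_zero, div_one,
    Complex.one_re] at this
  rw [← hM] at this
  have hα1 : α < 0.00201 := by norm_num [hα, hc]
  nlinarith

/-- doubling -/
theorem doubling : ∃ C : ℝ, 1 ≤ C ∧ ∀ (U : Set ℂ) (z0 b : ℂ) (u : ℂ → ℝ) (M : ℝ), GLF U u → b ≠ 0 →
    0 < M → Metric.ball z0 (50 * ‖b‖) ⊆ U →
    z0 ∈ frontier {z | z ∈ U ∧ u z = 0} →
    (∀ e ∈ frontier {z | z ∈ U ∧ u z = 0}, ∀ e' ∈ frontier {z | z ∈ U ∧ u z = 0},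
      ‖e - z0‖ < 50 * ‖b‖ → ‖e' - z0‖ < 50 * ‖b‖ →
      |((e - e') / b).im| ≤ 1 / 10000 * ‖(e - e') / b‖) →
    u (z0 + b * (Complex.I / 2)) ≤ M → u (z0 + b * (-Complex.I / 2)) ≤ M →
    ∀ z : ℂ, ‖z - z0‖ ≤ 2 * ‖b‖ → u z ≤ C * M := by
  refine ⟨48000 * 5 ^ 14 * 20000 ^ 14, by norm_num, ?_⟩
  intro U z0 b u M hu hb hM hU hz0 hflat h1 h2 z hz
  have hbn : 0 < ‖b‖ := norm_pos_iff.2 hb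
  set V := Metric.ball z0 (50 * ‖b‖) with hV
  set φ : ℂ ≃ₜ ℂ := (Homeomorph.mulLeft₀ b hb).trans (Homeomorph.addLeft z0) with hφ
  have hφa : ∀ s, φ s = z0 + b * s := fun s => rfl
  have hpre : ∀ s, s ∈ Metric.ball (0:ℂ) 50 ↔ φ s ∈ V := by
    intro s
    rw [hV, mem_ball_iff_norm, mem_ball_iff_norm, hφa, add_sub_cancel_left, norm_mul, sub_zero]
    rw [mul_comm 50]
    exact (mul_lt_mul_iff_right₀ hbn).symm
  have hg : GLF (Metric.ball 0 50) (fun s => M⁻¹ * u (φ s)) := by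
    refine GLF.const_mul ?_ (inv_pos.2 hM)
    refine (hu.mono hU).comp Metric.isOpen_ball (φ := fun s => φ s) ?_ (fun s hs => (hpre s).1 hs)
    simp only [hφa]; fun_prop
  have hset : {s | s ∈ Metric.ball (0:ℂ) 50 ∧ M⁻¹ * u (φ s) = 0} = φ ⁻¹' ({z | z ∈ U ∧ u z = 0} ∩ V) := by
    ext s
    simp only [mem_ofPred_eq, mem_preimage, mem_inter_iff, mul_eq_zero, inv_eq_zero, hM.ne', false_or]
    rw [hpre s]
    exact ⟨fun h => ⟨⟨hU h.1, h.2⟩, h.1⟩, fun h => ⟨h.2, h.1.2⟩⟩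
  have hE : ∀ s, ‖s‖ < 50 → s ∈ frontier {s | s ∈ Metric.ball (0:ℂ) 50 ∧ M⁻¹ * u (φ s) = 0} →
      φ s ∈ frontier {z | z ∈ U ∧ u z = 0} := by
    intro s hs hsf
    rw [hset, ← φ.preimage_frontier] at hsf
    have h3 : φ s ∈ frontier ({z | z ∈ U ∧ u z = 0} ∩ V) ∩ V := ⟨hsf, (hpre s).1 (by simpa using hs)⟩
    rw [frontier_inter_open Metric.isOpen_ball] at h3
    exact h3.1
  have h00 : (0:ℂ) ∈ frontier {s | s ∈ Metric.ball (0:ℂ) 50 ∧ M⁻¹ * u (φ s) = 0} := by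
    rw [hset, ← φ.preimage_frontier]
    have h3 : z0 ∈ frontier ({z | z ∈ U ∧ u z = 0}) ∩ V := ⟨hz0, by
      rw [hV]; exact Metric.mem_ball_self (by positivity)⟩
    rw [← frontier_inter_open Metric.isOpen_ball] at h3
    rw [mem_preimage, hφa]; simpa using h3.1
  have hfin := lemmaN_c hg rfl h00 (by
    intro e he e' he' hn hn'
    have k := hflat _ (hE e hn he) _ (hE e' hn' he') (by
      simpa [hφa, mul_comm] using (mul_lt_mul_iff_right₀ hbn).2 hn) (by
      simpa [hφa, mul_comm] using (mul_lt_mul_iff_right₀ hbn).2 hn')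
    have : (φ e - φ e') / b = e - e' := by
      rw [hφa, hφa]; field_simp; ring
    rwa [this] at k)
    (by
      rw [hφa, inv_mul_le_iff₀ hM, mul_one]; exact h1)
    (by
      rw [hφa, inv_mul_le_iff₀ hM, mul_one]; exact h2)
    ((z - z0) / b) (by
      rw [norm_div, div_le_iff₀ hbn]; exact hz)
  rw [hφa, mul_div_cancel₀ _ hb, add_sub_cancel, inv_mul_le_iff₀ hM] at hfin
  linarith

end Part03

section Part04

def VV (R : ℝ) : Set (ℂ × ℂ) := {q | R < ‖q.1‖ ∧ ‖q.2‖ ≤ ‖q.1‖}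
def CV (R : ℝ) : Set (ℂ × ℂ) := {q | 3 * ‖q.2‖ ≤ max R ‖q.1‖}

structure HStep (h hi : ℂ × ℂ → ℂ × ℂ) (d : ℕ) (R : ℝ) : Prop where
  diff : Differentiable ℂ h
  diffi : Differentiable ℂ hi
  cd : ContDiff ℂ 1 h
  cdi : ContDiff ℂ 1 hi
  li : ∀ q, hi (h q) = q
  ri : ∀ q, h (hi q) = q
  hd : 2 ≤ d
  V : ∀ q ∈ VV R, h q ∈ VV R ∧ 2 * ‖q.1‖ ≤ ‖(h q).1‖
  logV : ∃ κ C : ℝ, 0 ≤ C ∧ ∀ q ∈ VV R, |Real.log ‖(h q).1‖ - d * Real.log ‖q.1‖ - κ| ≤ C / ‖q.1‖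
  W : ∀ q, h q ∉ CV R → q ∉ CV R ∧ 2 * ‖(h q).2‖ ≤ ‖q.2‖
  P4 : ∀ q, ‖q.2‖ ≤ 3 * R → h q ∉ VV R → ‖(h q).2‖ ≤ 3 * R
  P7 : ∀ c : ℂ, ∃ M : ℝ, ∀ y : ℂ, M < ‖y‖ → h (c, y) ∈ VV R

theorem poly_bound (p : Polynomial ℂ) (hp : 2 ≤ p.natDegree) : ∃ B : ℝ, 0 ≤ B ∧ ∀ x : ℂ, 1 ≤ ‖x‖ →
    ‖p.eval x - p.leadingCoeff * x ^ p.natDegree‖ ≤ B * ‖x‖ ^ (p.natDegree - 1) := by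
  refine ⟨∑ i ∈ Finset.range p.natDegree, ‖p.coeff i‖, Finset.sum_nonneg fun _ _ => norm_nonneg _, ?_⟩
  intro x hx
  rw [Polynomial.eval_eq_sum_range, Finset.sum_range_succ, Polynomial.coeff_natDegree,
    add_sub_cancel_right, Finset.sum_mul]
  refine (norm_sum_le _ _).trans (Finset.sum_le_sum ?_)
  intro i hi
  rw [norm_mul, norm_pow]
  have := Finset.mem_range.1 hi
  gcongr
  omega

theorem abs_log_norm_le {z w : ℂ} (hw : w ≠ 0) {ε : ℝ} (hε : ε ≤ 1 / 2)
    (h : ‖z - w‖ ≤ ε * ‖w‖) : |Real.log ‖z‖ - Real.log ‖w‖| ≤ 2 * ε := by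
  have hw0 : 0 < ‖w‖ := norm_pos_iff.2 hw
  have hε0 : 0 ≤ ε := by
    by_contra hh
    push Not at hh
    have := norm_nonneg (z - w)
    nlinarith
  have h1 : ‖z‖ ≤ (1 + ε) * ‖w‖ := by
    have := norm_add_le (z - w) w
    rw [sub_add_cancel] at this
    linarith
  have h2 : (1 - ε) * ‖w‖ ≤ ‖z‖ := by
    have := norm_sub_le z (z - w)
    rw [sub_sub_cancel] at this
    linarith
  have hz0 : 0 < ‖z‖ := lt_of_lt_of_le (by nlinarith) h2
  rw [← Real.log_div hz0.ne' hw0.ne']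
  set t := ‖z‖ / ‖w‖ with ht
  have ht0 : 0 < t := by positivity
  have t1 : t ≤ 1 + ε := by rw [ht, div_le_iff₀ hw0]; exact h1
  have t2 : 1 - ε ≤ t := by rw [ht, le_div_iff₀ hw0]; exact h2
  have l1 := Real.log_le_sub_one_of_pos ht0
  have l2 := Real.one_sub_inv_le_log_of_pos ht0
  rw [abs_le]
  constructor
  · have : t⁻¹ ≤ 1 + 2 * ε := by
      rw [inv_le_comm₀ ht0 (by linarith)]
      refine le_trans ?_ t2
      rw [inv_le_iff_one_le_mul₀ (by linarith)]
      nlinarith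
    linarith
  · linarith

theorem henon_step (p : Polynomial ℂ) (a : ℂ) (ha : a ≠ 0) (hp : 2 ≤ p.natDegree) :
    ∃ R0 : ℝ, ∀ R ≥ R0, HStep (fun z => (Polynomial.eval z.1 p - a * z.2, z.1))
      (fun z => (z.2, (Polynomial.eval z.2 p - z.1) / a)) p.natDegree R := by
  obtain ⟨B, hB0, hB⟩ := poly_bound p hp
  set b := p.leadingCoeff with hb
  have hbne : b ≠ 0 := by
    rw [hb, Polynomial.leadingCoeff_ne_zero]
    rintro rfl
    simp at hp
  have hbn : 0 < ‖b‖ := norm_pos_iff.2 hbne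
  have han : 0 < ‖a‖ := norm_pos_iff.2 ha
  set m := p.natDegree with hm
  set A : ℝ := 6 + 4 * ‖a‖ with hA
  refine ⟨3 + 3 * (A + B) / ‖b‖ + 2 * (B + ‖a‖) / ‖b‖, fun R hR => ?_⟩
  have e1 : 0 ≤ 3 * (A + B) / ‖b‖ := by positivity
  have e2 : 0 ≤ 2 * (B + ‖a‖) / ‖b‖ := by positivity
  have hR3 : 3 ≤ R := by linarith
  have hbig : ∀ x : ℂ, R / 3 ≤ ‖x‖ → A * ‖x‖ ≤ ‖p.eval x‖ := by
    intro x hx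
    have hx1 : 1 ≤ ‖x‖ := by linarith
    have h1 := hB x hx1
    have h2 : ‖b‖ * ‖x‖ ^ m - B * ‖x‖ ^ (m - 1) ≤ ‖p.eval x‖ := by
      have := norm_sub_le (p.eval x) (p.eval x - b * x ^ m)
      rw [sub_sub_cancel, norm_mul, norm_pow] at this
      linarith
    have h3 : ‖x‖ ^ m = ‖x‖ ^ (m - 1) * ‖x‖ := by
      rw [← pow_succ]; congr 1; omega
    have h4 : A + B ≤ ‖b‖ * ‖x‖ := by
      have : (A + B) / ‖b‖ ≤ ‖x‖ := by
        have : 3 * (A + B) / ‖b‖ = 3 * ((A + B) / ‖b‖) := by ring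
        linarith
      rw [div_le_iff₀ hbn] at this
      linarith
    have h5 : ‖x‖ ≤ ‖x‖ ^ (m - 1) := le_self_pow₀ hx1 (by omega)
    have hA0 : 0 ≤ A := by positivity
    calc A * ‖x‖ ≤ A * ‖x‖ ^ (m - 1) := by gcongr
      _ ≤ ‖b‖ * ‖x‖ ^ m - B * ‖x‖ ^ (m - 1) := by
        rw [h3]
        have : 0 ≤ ‖x‖ ^ (m - 1) := by positivity
        nlinarith
      _ ≤ _ := h2
  have hbig2 : ∀ x y : ℂ, R / 3 ≤ ‖x‖ → A * ‖x‖ - ‖a‖ * ‖y‖ ≤ ‖p.eval x - a * y‖ := by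
    intro x y hx
    have h1 := hbig x hx
    have := norm_sub_norm_le (p.eval x) (a * y)
    rw [norm_mul] at this
    linarith
  have hVaux : ∀ q ∈ VV R, 6 * ‖q.1‖ ≤ ‖p.eval q.1 - a * q.2‖ := by
    rintro ⟨x, y⟩ ⟨h1, h2⟩
    simp only at h1 h2 ⊢
    have h3 := hbig2 x y (by linarith)
    have : ‖a‖ * ‖y‖ ≤ ‖a‖ * ‖x‖ := by gcongr
    nlinarith
  refine ⟨?_, ?_, ?_, ?_, ?_, ?_, hp, ?_, ?_, ?_, ?_, ?_⟩
  · have : Differentiable ℂ (fun z : ℂ × ℂ => Polynomial.eval z.1 p) :=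
      p.differentiable.comp differentiable_fst
    fun_prop
  · have : Differentiable ℂ (fun z : ℂ × ℂ => Polynomial.eval z.2 p) :=
      p.differentiable.comp differentiable_snd
    exact differentiable_snd.prodMk (by simp only [div_eq_mul_inv]; exact (this.sub differentiable_fst).mul_const _)
  · have : ContDiff ℂ 1 (fun z : ℂ × ℂ => Polynomial.eval z.1 p) := by
      have := (p.contDiff_aeval (𝕜 := ℂ) 1).comp (contDiff_fst (𝕜 := ℂ) (E := ℂ) (F := ℂ))
      simp only [Polynomial.coe_aeval_eq_eval] at this
      exact this
    fun_prop
  · have : ContDiff ℂ 1 (fun z : ℂ × ℂ => Polynomial.eval z.2 p) := by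
      have := (p.contDiff_aeval (𝕜 := ℂ) 1).comp (contDiff_snd (𝕜 := ℂ) (E := ℂ) (F := ℂ))
      simp only [Polynomial.coe_aeval_eq_eval] at this
      exact this
    exact contDiff_snd.prodMk (by simp only [div_eq_mul_inv]; exact (this.sub contDiff_fst).mul contDiff_const)
  · rintro ⟨x, y⟩
    simp only [Prod.mk.injEq, true_and]
    field_simp
    ring
  · rintro ⟨x, y⟩
    simp only [Prod.mk.injEq, and_true]
    field_simp
    ring
  · intro q hq
    have h1 := hVaux q hq
    have h2 := norm_nonneg q.1
    exact ⟨⟨by have := hq.1; simp only; linarith, by simp only; linarith⟩, by simp only; linarith⟩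
  · refine ⟨Real.log ‖b‖, 2 * ((B + ‖a‖) / ‖b‖), by positivity, ?_⟩
    rintro ⟨x, y⟩ ⟨h1, h2⟩
    simp only at h1 h2 ⊢
    have hx1 : 1 ≤ ‖x‖ := by linarith
    have hx0 : 0 < ‖x‖ := by linarith
    have hxne : x ≠ 0 := norm_pos_iff.1 hx0
    have h3 := hB x hx1
    have h4 : ‖(p.eval x - a * y) - b * x ^ m‖ ≤ ((B + ‖a‖) / ‖b‖ / ‖x‖) * ‖b * x ^ m‖ := by
      have e : (p.eval x - a * y) - b * x ^ m = (p.eval x - b * x ^ m) - a * y := by ring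
      rw [e]
      refine (norm_sub_le _ _).trans ?_
      have h5 : ‖x‖ ≤ ‖x‖ ^ (m - 1) := le_self_pow₀ hx1 (by omega)
      have h6 : ‖x‖ ^ m = ‖x‖ ^ (m - 1) * ‖x‖ := by
        rw [← pow_succ]; congr 1; omega
      have h7 : ((B + ‖a‖) / ‖b‖ / ‖x‖) * ‖b * x ^ m‖ = (B + ‖a‖) * ‖x‖ ^ (m - 1) := by
        rw [norm_mul, norm_pow, h6]; field_simp
      rw [h7, norm_mul]
      have : ‖a‖ * ‖y‖ ≤ ‖a‖ * ‖x‖ ^ (m - 1) := by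
        gcongr; exact h2.trans h5
      linarith
    have h5 := abs_log_norm_le (mul_ne_zero hbne (pow_ne_zero m hxne)) (by
      rw [div_div, div_le_div_iff₀ (by positivity) (by norm_num)]
      have : 2 * (B + ‖a‖) / ‖b‖ ≤ ‖x‖ := by linarith
      rw [div_le_iff₀ hbn] at this
      linarith) h4
    rw [norm_mul, norm_pow, Real.log_mul hbn.ne' (by positivity), Real.log_pow] at h5
    rw [mul_div_assoc]
    convert h5 using 2
    ring
  · rintro ⟨x, y⟩ hq
    simp only [CV, mem_ofPred_eq, not_le, max_lt_iff] at hq ⊢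
    obtain ⟨h1, h2⟩ := hq
    have h3 := hbig2 x y (by linarith)
    have h4 : ‖a‖ * (4 * ‖x‖) ≤ ‖a‖ * ‖y‖ := by
      have := norm_nonneg x
      nlinarith
    have h5 := le_of_mul_le_mul_left h4 han
    refine ⟨⟨by linarith, by linarith⟩, by linarith⟩
  · rintro ⟨x, y⟩ h1 h2
    simp only at h1 ⊢
    by_contra h3
    push Not at h3
    have h4 := hbig2 x y (by linarith)
    have h5 : ‖a‖ * ‖y‖ ≤ ‖a‖ * ‖x‖ := by gcongr; linarith
    have h6 : 6 * ‖x‖ ≤ ‖p.eval x - a * y‖ := by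
      have := norm_nonneg x
      nlinarith
    exact h2 ⟨by simp only; linarith, by simp only; linarith⟩
  · intro c
    refine ⟨(R + ‖c‖ + ‖p.eval c‖) / ‖a‖, fun y hy => ?_⟩
    rw [div_lt_iff₀ han] at hy
    have h1 := norm_sub_le (p.eval c) (p.eval c - a * y)
    rw [sub_sub_cancel, norm_mul] at h1
    have := norm_nonneg c
    exact ⟨by simp only; linarith, by simp only; linarith⟩

theorem HStep.comp {h hi h' hi' : ℂ × ℂ → ℂ × ℂ} {d d' : ℕ} {R : ℝ} (hR : 0 ≤ R)
    (H : HStep h hi d R) (H' : HStep h' hi' d' R) : HStep (h ∘ h') (hi' ∘ hi) (d * d') R := by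
  refine ⟨H.diff.comp H'.diff, H'.diffi.comp H.diffi, H.cd.comp H'.cd, H'.cdi.comp H.cdi, ?_, ?_, ?_, ?_, ?_, ?_, ?_, ?_⟩
  · intro q; simp [H.li, H'.li]
  · intro q; simp [H.ri, H'.ri]
  · have := H.hd; have := H'.hd; nlinarith
  · intro q hq
    obtain ⟨h1, h2⟩ := H'.V q hq
    obtain ⟨h3, h4⟩ := H.V _ h1
    have := norm_nonneg (h' q).1
    exact ⟨h3, by simp only [Function.comp_apply]; linarith⟩
  · obtain ⟨κ, C, hC, hk⟩ := H.logV
    obtain ⟨κ', C', hC', hk'⟩ := H'.logV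
    refine ⟨κ + d * κ', C + d * C', by positivity, fun q hq => ?_⟩
    obtain ⟨h1, h2⟩ := H'.V q hq
    have e1 := hk _ h1
    have e2 := hk' _ hq
    have hq0 : 0 < ‖q.1‖ := by have := hq.1; linarith
    have e3 : C / ‖(h' q).1‖ ≤ C / ‖q.1‖ := by
      gcongr
      have := norm_nonneg q.1
      linarith
    have e4 : Real.log ‖((h ∘ h') q).1‖ - ((d * d' : ℕ) : ℝ) * Real.log ‖q.1‖ - (κ + d * κ') =
      (Real.log ‖(h (h' q)).1‖ - d * Real.log ‖(h' q).1‖ - κ) +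
        d * (Real.log ‖(h' q).1‖ - d' * Real.log ‖q.1‖ - κ') := by
      simp only [Function.comp_apply]; push_cast; ring
    rw [e4]
    refine (abs_add_le _ _).trans ?_
    rw [abs_mul, abs_of_nonneg (Nat.cast_nonneg (α := ℝ) d), add_div, mul_div_assoc]
    gcongr
    exact e1.trans e3
  · intro q hq
    obtain ⟨h1, h2⟩ := H.W _ hq
    obtain ⟨h3, h4⟩ := H'.W _ h1
    have := norm_nonneg (h' q).2
    exact ⟨h3, by simp only [Function.comp_apply]; linarith⟩
  · intro q hq hq'
    refine H.P4 _ (H'.P4 q hq ?_) hq'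
    intro h1
    exact hq' (H.V _ h1).1
  · intro c
    obtain ⟨M, hM⟩ := H'.P7 c
    exact ⟨M, fun y hy => (H.V _ (hM y hy)).1⟩

/-- The two step relation -/
def TwoStep (F : ℂ × ℂ → ℂ × ℂ) (R : ℝ) : Prop :=
  ∃ (p1 p2 : Polynomial ℂ) (a1 a2 : ℂ), 2 ≤ p1.natDegree ∧ 2 ≤ p2.natDegree ∧ a1 ≠ 0 ∧ a2 ≠ 0 ∧
    ∀ q ∈ CV R, ∃ y' y'' : ℂ, (F (F q)).1 = p1.eval (F (F q)).2 - a1 * y' ∧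
      (F (F q)).2 = p2.eval y' - a2 * y'' ∧ 3 * ‖y'‖ ≤ max R ‖(F (F q)).2‖ ∧
      3 * ‖y''‖ ≤ max R ‖y'‖

theorem list_step (hs : List (ℂ × ℂ → ℂ × ℂ)) (hH : ∀ h ∈ hs, IsHenon h) :
    ∃ R0 : ℝ, ∀ R ≥ R0, ∀ h ∈ hs, ∃ hi d, HStep h hi d R := by
  induction hs with
  | nil => exact ⟨0, fun R _ h hh => by simp at hh⟩
  | cons h t ih =>
    obtain ⟨R1, h1⟩ := ih (fun h hh => hH h (List.mem_cons_of_mem _ hh))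
    obtain ⟨p, a, ha, hp, hpa⟩ := hH h List.mem_cons_self
    obtain ⟨R2, h2⟩ := henon_step p a ha hp
    refine ⟨max R1 R2, fun R hR h' hh' => ?_⟩
    rcases List.mem_cons.1 hh' with rfl | hh'
    · have : h' = fun z => (Polynomial.eval z.1 p - a * z.2, z.1) := funext hpa
      rw [this]
      exact ⟨_, _, h2 R ((le_max_right _ _).trans hR)⟩
    · exact h1 R ((le_max_left _ _).trans hR) h' hh'

theorem list_fold {R : ℝ} (hR : 0 ≤ R) (hs : List (ℂ × ℂ → ℂ × ℂ))
    (H : ∀ h ∈ hs, ∃ hi d, HStep h hi d R) (hne : hs ≠ []) :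
    ∃ hi d, HStep (hs.foldr (fun h acc => h ∘ acc) id) hi d R := by
  induction hs with
  | nil => exact absurd rfl hne
  | cons h t ih =>
    obtain ⟨hi, d, h1⟩ := H h List.mem_cons_self
    by_cases ht : t = []
    · subst ht
      exact ⟨hi, d, by simpa using h1⟩
    · obtain ⟨hi', d', h2⟩ := ih (fun h hh => H h (List.mem_cons_of_mem _ hh)) ht
      exact ⟨_, _, HStep.comp (h' := t.foldr (fun h acc => h ∘ acc) id) hR h1 h2⟩

theorem fold_CV {R : ℝ} (hs : List (ℂ × ℂ → ℂ × ℂ))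
    (H : ∀ h ∈ hs, ∃ hi d, HStep h hi d R) (q : ℂ × ℂ) (hq : q ∈ CV R) :
    hs.foldr (fun h acc => h ∘ acc) id q ∈ CV R := by
  induction hs with
  | nil => simpa using hq
  | cons h t ih =>
    obtain ⟨hi, d, h1⟩ := H h List.mem_cons_self
    have := ih (fun h hh => H h (List.mem_cons_of_mem _ hh))
    by_contra hc
    exact (h1.W _ hc).1 this

theorem fold_append (a b : List (ℂ × ℂ → ℂ × ℂ)) (q : ℂ × ℂ) :
    (a ++ b).foldr (fun h acc => h ∘ acc) id q =
      a.foldr (fun h acc => h ∘ acc) id (b.foldr (fun h acc => h ∘ acc) id q) := by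
  induction a with
  | nil => rfl
  | cons h t ih => simp [List.foldr_cons] at ih ⊢; rw [ih]

theorem two_step_list {R : ℝ} (hs : List (ℂ × ℂ → ℂ × ℂ)) (hH : ∀ h ∈ hs, IsHenon h)
    (H : ∀ h ∈ hs, ∃ hi d, HStep h hi d R) (hne : hs ≠ []) :
    TwoStep (hs.foldr (fun h acc => h ∘ acc) id) R := by
  have hlen : ∃ h1 h2 l, hs ++ hs = h1 :: h2 :: l := by
    match hs, hne with
    | [h], _ => exact ⟨h, h, [], rfl⟩
    | h1 :: h2 :: t, _ => exact ⟨h1, h2, _, rfl⟩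
  obtain ⟨h1, h2, l, hl⟩ := hlen
  have hmem : ∀ h ∈ hs ++ hs, h ∈ hs := fun h hh => by simpa using hh
  have m1 : h1 ∈ hs := hmem _ (by rw [hl]; simp)
  have m2 : h2 ∈ hs := hmem _ (by rw [hl]; simp)
  have ml : ∀ h ∈ l, h ∈ hs := fun h hh => hmem _ (by rw [hl]; simp [hh])
  obtain ⟨p1, a1, ha1, hp1, e1⟩ := hH h1 m1
  obtain ⟨p2, a2, ha2, hp2, e2⟩ := hH h2 m2
  refine ⟨p1, p2, a1, a2, hp1, hp2, ha1, ha2, fun q hq => ?_⟩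
  set w := l.foldr (fun h acc => h ∘ acc) id q with hw
  have hwC : w ∈ CV R := fold_CV l (fun h hh => H h (ml h hh)) q hq
  have hFF : hs.foldr (fun h acc => h ∘ acc) id (hs.foldr (fun h acc => h ∘ acc) id q) =
      h1 (h2 w) := by
    rw [← fold_append, hl]; rfl
  have h2C : h2 w ∈ CV R := by
    obtain ⟨hi, d, k⟩ := H h2 m2
    by_contra hc
    exact (k.W _ hc).1 hwC
  rw [hFF, e1]
  rw [e2] at h2C ⊢
  exact ⟨w.1, w.2, rfl, rfl, h2C, hwC⟩

theorem henon_system (hs : List (ℂ × ℂ → ℂ × ℂ)) (hH : ∀ h ∈ hs, IsHenon h) (hne : hs ≠ []) (R1 : ℝ) :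
    ∃ R d Fi, R1 ≤ R ∧ 1 ≤ R ∧ HStep (hs.foldr (fun h acc => h ∘ acc) id) Fi d R ∧
      TwoStep (hs.foldr (fun h acc => h ∘ acc) id) R := by
  obtain ⟨R0, h0⟩ := list_step hs hH
  set R := max R0 (max R1 1) with hR
  have hR0 : R0 ≤ R := le_max_left _ _
  have hR1 : R1 ≤ R := (le_max_left _ _).trans (le_max_right _ _)
  have hR2 : 1 ≤ R := (le_max_right _ _).trans (le_max_right _ _)
  obtain ⟨Fi, d, h1⟩ := list_fold (by linarith) hs (h0 R hR0) hne
  exact ⟨R, d, Fi, hR1, hR2, h1, two_step_list hs hH (h0 R hR0) hne⟩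

end Part04

section Part05

open InnerProductSpace

structure HSys (F S : ℂ × ℂ → ℂ × ℂ) (d : ℕ) (R : ℝ) : Prop where
  st : HStep F S d R
  two : TwoStep F R
  hR : 1 ≤ R

def ell (R : ℝ) (q : ℂ × ℂ) : ℝ := Real.log (max R ‖q.1‖)

def Gseq (F : ℂ × ℂ → ℂ × ℂ) (d : ℕ) (R : ℝ) (N : ℕ) (q : ℂ × ℂ) : ℝ := ell R (F^[N] q) / d ^ N

def Gr (F : ℂ × ℂ → ℂ × ℂ) (d : ℕ) (R : ℝ) (q : ℂ × ℂ) : ℝ :=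
  limUnder atTop (fun N => Gseq F d R N q)

variable {F S : ℂ × ℂ → ℂ × ℂ} {d : ℕ} {R : ℝ}

theorem HSys.cont (H : HSys F S d R) : Continuous F := H.st.diff.continuous
theorem HSys.d0 (H : HSys F S d R) : (0:ℝ) < d := by
  have := H.st.hd
  positivity
theorem HSys.d2 (H : HSys F S d R) : (2:ℝ) ≤ d := by exact_mod_cast H.st.hd

theorem HSys.CVinv (H : HSys F S d R) {q : ℂ × ℂ} (hq : q ∈ CV R) : F q ∈ CV R := by
  by_contra h
  exact (H.st.W q h).1 hq

theorem HSys.CViter (H : HSys F S d R) {q : ℂ × ℂ} (hq : q ∈ CV R) (n : ℕ) : F^[n] q ∈ CV R := by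
  induction n with
  | zero => simpa
  | succ n ih => rw [iterate_succ_apply']; exact H.CVinv ih

theorem HSys.Viter (H : HSys F S d R) {q : ℂ × ℂ} (hq : q ∈ VV R) (n : ℕ) :
    F^[n] q ∈ VV R ∧ ‖q.1‖ ≤ ‖(F^[n] q).1‖ := by
  induction n with
  | zero => exact ⟨hq, le_rfl⟩
  | succ n ih =>
    rw [iterate_succ_apply']
    have := H.st.V _ ih.1
    exact ⟨this.1, by linarith [norm_nonneg (F^[n] q).1, ih.2]⟩

theorem CV_V {q : ℂ × ℂ} (hR : 1 ≤ R) (hq : q ∈ CV R) (h : R < ‖q.1‖) : q ∈ VV R := by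
  refine ⟨h, ?_⟩
  have h1 : 3 * ‖q.2‖ ≤ max R ‖q.1‖ := hq
  rw [max_eq_right h.le] at h1
  linarith [norm_nonneg q.2]

theorem ell_nonneg (hR : 1 ≤ R) (q : ℂ × ℂ) : 0 ≤ ell R q :=
  Real.log_nonneg (hR.trans (le_max_left _ _))

theorem ell_cont (hR : 1 ≤ R) : Continuous (ell R) := by
  refine Continuous.log (by fun_prop) ?_
  intro q
  have : R ≤ max R ‖q.1‖ := le_max_left _ _
  linarith

theorem ell_V {q : ℂ × ℂ} (hq : q ∈ VV R) : ell R q = Real.log ‖q.1‖ := by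
  rw [ell, max_eq_right hq.1.le]

theorem HSys.ellCV (H : HSys F S d R) : ∃ C : ℝ, 0 ≤ C ∧ ∀ q ∈ CV R, |ell R (F q) - d * ell R q| ≤ C := by
  have hR := H.hR
  obtain ⟨κ, C, hC, hk⟩ := H.st.logV
  have hc : Continuous (fun q => ell R (F q) - d * ell R q) :=
    ((ell_cont hR).comp H.cont).sub (continuous_const.mul (ell_cont hR))
  obtain ⟨B, hB⟩ := (isCompact_closedBall (0:ℂ × ℂ) R).exists_bound_of_continuousOn hc.continuousOn
  refine ⟨max B (|κ| + C), le_max_of_le_right (by positivity), fun q hq => ?_⟩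
  rcases le_or_gt ‖q.1‖ R with h1 | h1
  · refine (hB q ?_).trans (le_max_left _ _)
    have h2 : 3 * ‖q.2‖ ≤ max R ‖q.1‖ := hq
    rw [max_eq_left h1] at h2
    rw [mem_closedBall_iff_norm, sub_zero, Prod.norm_def]
    exact max_le h1 (by linarith [norm_nonneg q.2])
  · have hV := CV_V hR hq h1
    rw [ell_V hV, ell_V (H.st.V q hV).1]
    refine le_trans ?_ (le_max_right _ _)
    have h2 := hk q hV
    have h3 : C / ‖q.1‖ ≤ C := div_le_self hC (by linarith)
    have h4 := abs_add_le (Real.log ‖(F q).1‖ - d * Real.log ‖q.1‖ - κ) κ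
    rw [sub_add_cancel] at h4
    linarith

theorem HSys.absorb (H : HSys F S d R) {B : ℝ} : ∃ K0 : ℕ, ∀ K ≥ K0, ∀ q : ℂ × ℂ, ‖q.2‖ ≤ B →
    F^[K] q ∈ CV R := by
  have key : ∀ K : ℕ, ∀ q, F^[K] q ∉ CV R → (2:ℝ) ^ K * ‖(F^[K] q).2‖ ≤ ‖q.2‖ := by
    intro K
    induction K with
    | zero => intro q _; simp
    | succ K ih =>
      intro q hq
      rw [iterate_succ_apply'] at hq ⊢
      obtain ⟨h1, h2⟩ := H.st.W _ hq
      have := ih q h1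
      rw [pow_succ]
      have h3 : (2:ℝ) ^ K * (2 * ‖(F (F^[K] q)).2‖) ≤ 2 ^ K * ‖(F^[K] q).2‖ := by gcongr
      linarith
  obtain ⟨K0, hK0⟩ := pow_unbounded_of_one_lt (3 * B) (one_lt_two (α := ℝ))
  refine ⟨K0, fun K hK q hq => ?_⟩
  by_contra hc
  have h1 := key K q hc
  have h2 : 1 < 3 * ‖(F^[K] q).2‖ := by
    have h3 : ¬ (3 * ‖(F^[K] q).2‖ ≤ max R ‖(F^[K] q).1‖) := hc
    push Not at h3
    exact (H.hR.trans (le_max_left _ _)).trans_lt h3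
  have h4 : (2:ℝ) ^ K0 ≤ 2 ^ K := pow_le_pow_right₀ (by norm_num) hK
  have h5 : (0:ℝ) < 2 ^ K := by positivity
  nlinarith

theorem HSys.Gseq_shift (H : HSys F S d R) (N K : ℕ) (q : ℂ × ℂ) :
    Gseq F d R (N + K) q = Gseq F d R N (F^[K] q) / d ^ K := by
  rw [Gseq, Gseq, iterate_add_apply, pow_add, div_div]

theorem HSys.Gseq_step (H : HSys F S d R) {C : ℝ} (hC : ∀ q ∈ CV R, |ell R (F q) - d * ell R q| ≤ C)
    {q : ℂ × ℂ} (hq : q ∈ CV R) (N : ℕ) :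
    dist (Gseq F d R N q) (Gseq F d R (N + 1) q) ≤ C / 2 / 2 ^ N := by
  have hd := H.d0
  have h2 := H.d2
  have h1 := hC _ (H.CViter hq N)
  have hC0 : 0 ≤ C := (abs_nonneg _).trans h1
  rw [dist_comm, Real.dist_eq, Gseq, Gseq, iterate_succ_apply']
  have e : ell R (F (F^[N] q)) / (d:ℝ) ^ (N + 1) - ell R (F^[N] q) / d ^ N =
    (ell R (F (F^[N] q)) - d * ell R (F^[N] q)) / d ^ (N + 1) := by
    field_simp
    ring
  rw [e, abs_div, abs_of_nonneg (by positivity : (0:ℝ) ≤ (d:ℝ) ^ (N + 1)), div_div, ← pow_succ']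
  gcongr

theorem HSys.G_CV (H : HSys F S d R) {C : ℝ} (hC : ∀ q ∈ CV R, |ell R (F q) - d * ell R q| ≤ C)
    {q : ℂ × ℂ} (hq : q ∈ CV R) : Tendsto (fun N => Gseq F d R N q) atTop (𝓝 (Gr F d R q)) ∧
      ∀ N, dist (Gseq F d R N q) (Gr F d R q) ≤ C / 2 ^ N := by
  have hc := cauchySeq_of_le_geometric_two (H.Gseq_step hC hq)
  have h1 : Tendsto (fun N => Gseq F d R N q) atTop (𝓝 (Gr F d R q)) := hc.tendsto_limUnder
  exact ⟨h1, fun N => dist_le_of_le_geometric_two_of_tendsto (H.Gseq_step hC hq) h1 N⟩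

theorem HSys.G_lim (H : HSys F S d R) (q : ℂ × ℂ) :
    Tendsto (fun N => Gseq F d R N q) atTop (𝓝 (Gr F d R q)) := by
  obtain ⟨C, hC0, hC⟩ := H.ellCV
  obtain ⟨K, hK⟩ := H.absorb (B := ‖q.2‖)
  have h1 := (H.G_CV hC (hK K le_rfl q le_rfl)).1
  have h2 : Tendsto (fun N => Gseq F d R (N + K) q) atTop (𝓝 (Gr F d R (F^[K] q) / d ^ K)) := by
    simp only [H.Gseq_shift]
    exact h1.div_const _
  have h3 := (tendsto_add_atTop_iff_nat (f := fun N => Gseq F d R N q) K).1 h2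
  exact tendsto_nhds_limUnder ⟨_, h3⟩

theorem HSys.G_F (H : HSys F S d R) (q : ℂ × ℂ) : Gr F d R (F q) = d * Gr F d R q := by
  have h1 := (tendsto_add_atTop_iff_nat (f := fun N => Gseq F d R N q) 1).2 (H.G_lim q)
  have h2 := (H.G_lim (F q)).div_const ((d:ℝ) ^ 1)
  have h3 : (fun N => Gseq F d R (N + 1) q) = fun N => Gseq F d R N (F q) / (d:ℝ) ^ 1 := by
    funext N
    rw [H.Gseq_shift]; rfl
  rw [h3] at h1
  have := tendsto_nhds_unique h1 h2
  have hd := H.d0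
  rw [this]; field_simp

theorem HSys.G_iter (H : HSys F S d R) (q : ℂ × ℂ) (n : ℕ) :
    Gr F d R (F^[n] q) = d ^ n * Gr F d R q := by
  induction n with
  | zero => simp
  | succ n ih => rw [iterate_succ_apply', H.G_F, ih, pow_succ]; ring

theorem HSys.G_nonneg (H : HSys F S d R) (q : ℂ × ℂ) : 0 ≤ Gr F d R q :=
  ge_of_tendsto' (H.G_lim q) fun N => div_nonneg (ell_nonneg H.hR _) (by positivity)

theorem HSys.G_ell (H : HSys F S d R) : ∃ C : ℝ, 0 ≤ C ∧ ∀ q ∈ CV R, |Gr F d R q - ell R q| ≤ C := by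
  obtain ⟨C, hC0, hC⟩ := H.ellCV
  refine ⟨C, hC0, fun q hq => ?_⟩
  have := (H.G_CV hC hq).2 0
  rw [dist_comm, Real.dist_eq] at this
  simpa [Gseq] using this

theorem HSys.G_unif (H : HSys F S d R) (B : ℝ) : ∃ C : ℝ, ∃ K : ℕ, 0 ≤ C ∧ ∀ q : ℂ × ℂ, ‖q‖ ≤ B → ∀ N,
    |Gr F d R q - Gseq F d R (N + K) q| ≤ C / 2 ^ N := by
  obtain ⟨C, hC0, hC⟩ := H.ellCV
  obtain ⟨K, hK⟩ := H.absorb (B := B)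
  refine ⟨C, K, hC0, fun q hq N => ?_⟩
  have hqK := hK K le_rfl q ((norm_snd_le q).trans hq)
  have h1 := (H.G_CV hC hqK).2 N
  rw [H.G_iter, dist_comm, Real.dist_eq] at h1
  have hd : (1:ℝ) ≤ d ^ K := one_le_pow₀ (by linarith [H.d2])
  have e : Gr F d R q - Gseq F d R (N + K) q = (d ^ K * Gr F d R q - Gseq F d R N (F^[K] q)) / d ^ K := by
    rw [H.Gseq_shift]; field_simp
  rw [e, abs_div, abs_of_nonneg (by positivity : (0:ℝ) ≤ (d:ℝ) ^ K)]
  exact (div_le_self (abs_nonneg _) hd).trans h1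

theorem HSys.Gseq_cont (H : HSys F S d R) (N : ℕ) : Continuous (Gseq F d R N) :=
  ((ell_cont H.hR).comp (H.cont.iterate N)).div_const _

theorem HSys.G_cont (H : HSys F S d R) : Continuous (Gr F d R) := by
  rw [continuous_iff_continuousAt]
  intro q
  obtain ⟨C, K, hC0, hC⟩ := H.G_unif (‖q‖ + 1)
  have hU : TendstoUniformlyOn (fun N => Gseq F d R (N + K)) (Gr F d R) atTop (Metric.ball q 1) := by
    rw [Metric.tendstoUniformlyOn_iff]
    intro ε hε
    have h1 : Tendsto (fun N : ℕ => C / 2 ^ N) atTop (𝓝 0) :=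
      tendsto_const_nhds.div_atTop (tendsto_pow_atTop_atTop_of_one_lt one_lt_two)
    filter_upwards [h1.eventually (gt_mem_nhds hε)] with N hN x hx
    rw [Real.dist_eq]
    refine (hC x ?_ N).trans_lt hN
    have := norm_add_le (x - q) q
    rw [sub_add_cancel] at this
    rw [mem_ball_iff_norm] at hx
    linarith
  exact (hU.continuousOn (Frequently.of_forall fun N => (H.Gseq_cont _).continuousOn)).continuousAt
    (Metric.ball_mem_nhds q one_pos)

theorem HSys.CV_bound (H : HSys F S d R) (M : ℝ) : ∃ B : ℝ, 0 ≤ B ∧ ∀ q ∈ CV R, Gr F d R q ≤ M → ‖q‖ ≤ B := by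
  obtain ⟨C, hC0, hC⟩ := H.G_ell
  refine ⟨Real.exp (M + C), (Real.exp_pos _).le, fun q hq hG => ?_⟩
  have h1 := (abs_le.1 (hC q hq)).1
  have h2 : ell R q ≤ M + C := by linarith
  have hm : 0 < max R ‖q.1‖ := lt_of_lt_of_le (by linarith [H.hR]) (le_max_left _ _)
  rw [ell, Real.log_le_iff_le_exp hm] at h2
  have h3 : 3 * ‖q.2‖ ≤ max R ‖q.1‖ := hq
  rw [Prod.norm_def]
  exact max_le ((le_max_right _ _).trans h2) (by linarith [norm_nonneg q.2])

theorem HSys.G_zero (H : HSys F S d R) (q : ℂ × ℂ) : Gr F d R q = 0 ↔ q ∈ Kplus F := by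
  constructor
  · intro h0
    obtain ⟨B, hB0, hB⟩ := H.CV_bound 0
    obtain ⟨K, hK⟩ := H.absorb (B := ‖q.2‖)
    refine ⟨max B (∑ n ∈ Finset.range K, ‖F^[n] q‖), fun n => ?_⟩
    rcases lt_or_ge n K with hn | hn
    · refine le_trans ?_ (le_max_right _ _)
      exact Finset.single_le_sum (f := fun n => ‖F^[n] q‖) (fun _ _ => norm_nonneg _) (Finset.mem_range.2 hn)
    · refine (hB _ (hK n hn q le_rfl) ?_).trans (le_max_left _ _)
      rw [H.G_iter, h0, mul_zero]
  · rintro ⟨C, hC⟩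
    refine tendsto_nhds_unique (H.G_lim q) ?_
    have h1 : Tendsto (fun N : ℕ => Real.log (max R C) / (d:ℝ) ^ N) atTop (𝓝 0) :=
      tendsto_const_nhds.div_atTop (tendsto_pow_atTop_atTop_of_one_lt (by linarith [H.d2]))
    refine squeeze_zero (fun N => div_nonneg (ell_nonneg H.hR _) (by positivity)) (fun N => ?_) h1
    rw [Gseq, ell]
    have : (0:ℝ) < R := by linarith [H.hR]
    gcongr
    exact (norm_fst_le _).trans (hC N)

theorem HSys.G_V (H : HSys F S d R) : ∃ c0 C : ℝ, 0 ≤ C ∧ ∀ q ∈ VV R,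
    |Gr F d R q - Real.log ‖q.1‖ - c0| ≤ C / ‖q.1‖ := by
  obtain ⟨κ, C, hC, hk⟩ := H.st.logV
  have hd := H.d0
  have hd2 := H.d2
  set c0 : ℝ := κ / (d - 1) with hc0
  have hκ : κ = (d - 1) * c0 := by
    have : (d:ℝ) - 1 ≠ 0 := by linarith
    rw [hc0]; field_simp
  refine ⟨c0, C, hC, fun q hq => ?_⟩
  have hq0 : 0 < ‖q.1‖ := by linarith [hq.1, H.hR]
  set a : ℕ → ℝ := fun N => (Real.log ‖(F^[N] q).1‖ + c0) / d ^ N with ha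
  have hstep : ∀ N, dist (a N) (a (N + 1)) ≤ C / ‖q.1‖ / 2 / 2 ^ N := by
    intro N
    obtain ⟨h1, h2⟩ := H.Viter hq N
    have h3 := hk _ h1
    rw [dist_comm, Real.dist_eq]
    simp only [ha]
    rw [iterate_succ_apply']
    have e : (Real.log ‖(F (F^[N] q)).1‖ + c0) / (d:ℝ) ^ (N + 1) - (Real.log ‖(F^[N] q).1‖ + c0) / d ^ N
      = (Real.log ‖(F (F^[N] q)).1‖ - d * Real.log ‖(F^[N] q).1‖ - κ) / d ^ (N + 1) := by
      rw [hκ]; field_simp; ring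
    rw [e, abs_div, abs_of_nonneg (by positivity : (0:ℝ) ≤ (d:ℝ) ^ (N + 1)), div_div (C / ‖q.1‖), ← pow_succ']
    gcongr
    refine h3.trans ?_
    gcongr
  have hlim : Tendsto a atTop (𝓝 (Gr F d R q)) := by
    have h1 : Tendsto (fun N : ℕ => c0 / (d:ℝ) ^ N) atTop (𝓝 0) :=
      tendsto_const_nhds.div_atTop (tendsto_pow_atTop_atTop_of_one_lt (by linarith))
    have h2 := (H.G_lim q).add h1
    rw [add_zero] at h2
    refine h2.congr fun N => ?_
    rw [Gseq, ell_V (H.Viter hq N).1]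
    simp only [ha]
    rw [add_div]
  have := dist_le_of_le_geometric_two_of_tendsto hstep hlim 0
  rw [dist_comm, Real.dist_eq] at this
  simp only [ha] at this
  simpa [sub_sub] using this

theorem HSys.isGLF (H : HSys F S d R) {U : Set ℂ} (hU : IsOpen U) {γ : ℂ → ℂ × ℂ}
    (hγ : DifferentiableOn ℂ γ U) : GLF U (fun z => Gr F d R (γ z)) := by
  refine ⟨H.G_cont.comp_continuousOn hγ.continuousOn, fun z _ => H.G_nonneg _, ?_⟩
  intro z hz hpos
  have hd2 := H.d2
  -- find N0
  obtain ⟨K, hK⟩ := H.absorb (B := ‖(γ z).2‖)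
  obtain ⟨N0, hN0C, hN0⟩ : ∃ N0, F^[N0] (γ z) ∈ CV R ∧ R < ‖(F^[N0] (γ z)).1‖ := by
    have h1 : Tendsto (fun N : ℕ => Gseq F d R N (γ z) * (d:ℝ) ^ N) atTop atTop :=
      (H.G_lim (γ z)).pos_mul_atTop hpos (tendsto_pow_atTop_atTop_of_one_lt (by linarith))
    obtain ⟨N, hN1, hN2⟩ := ((h1.eventually (eventually_gt_atTop (Real.log R))).and
      (eventually_ge_atTop K)).exists
    refine ⟨N, hK N hN2 _ le_rfl, ?_⟩
    have hd := H.d0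
    have h2 : Gseq F d R N (γ z) * (d:ℝ) ^ N = ell R (F^[N] (γ z)) := by
      rw [Gseq]; field_simp
    rw [h2, ell] at hN1
    by_contra h3
    push Not at h3
    rw [max_eq_left h3] at hN1
    exact lt_irrefl _ hN1
  have hiter : ∀ N, DifferentiableOn ℂ (fun w => F^[N] (γ w)) U := fun N =>
    (H.st.diff.iterate N).comp_differentiableOn hγ
  have hcz : ContinuousAt (fun w => F^[N0] (γ w)) z := (hiter N0).continuousOn.continuousAt (hU.mem_nhds hz)
  have hlt : ‖(F^[N0] (γ z)).2‖ < ‖(F^[N0] (γ z)).1‖ := by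
    have h1 : 3 * ‖(F^[N0] (γ z)).2‖ ≤ max R ‖(F^[N0] (γ z)).1‖ := hN0C
    rw [max_eq_right hN0.le] at h1
    linarith [norm_nonneg (F^[N0] (γ z)).2, H.hR]
  have hev : ∀ᶠ w in 𝓝 z, F^[N0] (γ w) ∈ VV R ∧ w ∈ U ∧ ‖γ w‖ ≤ ‖γ z‖ + 1 := by
    have c1 : ContinuousAt (fun w => ‖(F^[N0] (γ w)).1‖) z := hcz.fst.norm
    have c2 : ContinuousAt (fun w => ‖(F^[N0] (γ w)).2‖) z := hcz.snd.norm
    have c3 : ContinuousAt (fun w => ‖γ w‖) z := (hγ.continuousOn.continuousAt (hU.mem_nhds hz)).norm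
    filter_upwards [c1.eventually (lt_mem_nhds hN0), c2.eventually_lt c1 hlt, hU.mem_nhds hz,
      c3.eventually (gt_mem_nhds (show ‖γ z‖ < ‖γ z‖ + 1 by linarith))] with w h1 h2 h3 h4
    exact ⟨⟨h1, h2.le⟩, h3, h4.le⟩
  obtain ⟨r, hr, hrb⟩ := Metric.eventually_nhds_iff_ball.1 hev
  have hV : ∀ N, ∀ w ∈ Metric.ball z r, F^[N + N0] (γ w) ∈ VV R := by
    intro N w hw
    rw [iterate_add_apply]
    exact (H.Viter (hrb w hw).1 N).1
  have hrU : Metric.ball z r ⊆ U := fun w hw => (hrb w hw).2.1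
  obtain ⟨C, K1, hC0, hC⟩ := H.G_unif (‖γ z‖ + 1)
  obtain ⟨B, hB⟩ : ∃ B : ℝ, ∀ q : ℂ × ℂ, ‖q‖ ≤ ‖γ z‖ + 1 → Gr F d R q ≤ B := by
    obtain ⟨B, hB⟩ := (isCompact_closedBall (0:ℂ × ℂ) (‖γ z‖ + 1)).exists_bound_of_continuousOn
      H.G_cont.continuousOn
    exact ⟨B, fun q hq => (le_abs_self _).trans (hB q (by simpa using hq))⟩
  have hlog : ∀ N, ∀ w ∈ Metric.ball z r,
      Gseq F d R (N + N0) (γ w) = ((d:ℝ) ^ (N + N0))⁻¹ * Real.log ‖(F^[N + N0] (γ w)).1‖ := by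
    intro N w hw
    rw [Gseq, ell_V (hV N w hw), div_eq_inv_mul]
  have hH : ∀ N, ∃ Q : ℂ → ℂ, DifferentiableOn ℂ Q (Metric.ball z r) ∧ ∀ w ∈ Metric.ball z r,
      (Q w).re = Gseq F d R (N + N0) (γ w) := by
    intro N
    have : HarmonicOnNhd (fun w => ((d:ℝ) ^ (N + N0))⁻¹ * Real.log ‖(F^[N + N0] (γ w)).1‖)
        (Metric.ball z r) := by
      intro w hw
      refine HarmonicAt.const_smul (c := ((d:ℝ) ^ (N + N0))⁻¹) ?_
      refine AnalyticAt.harmonicAt_log_norm (f := fun w => (F^[N + N0] (γ w)).1) ?_ ?_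
      · have h1 : DifferentiableOn ℂ (fun w => (F^[N + N0] (γ w)).1) U := (hiter _).fst
        exact h1.analyticAt (hU.mem_nhds (hrU hw))
      · have := (hV N w hw).1
        rw [← norm_pos_iff]
        linarith [H.hR]
    obtain ⟨Q, hQ, hQr⟩ := this.exists_analyticOnNhd_ball_re_eq
    exact ⟨Q, hQ.differentiableOn, fun w hw => by rw [hlog N w hw]; exact hQr hw⟩
  choose Q hQd hQr using hH
  have hbound : ∀ N, ∀ w ∈ Metric.ball z r, Gseq F d R (N + K1) (γ w) ≤ B + C := by
    intro N w hw
    have h1 := (abs_le.1 (hC (γ w) (hrb w hw).2.2 N)).1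
    have h2 := hB (γ w) (hrb w hw).2.2
    have h3 : C / 2 ^ N ≤ C := div_le_self hC0 (one_le_pow₀ (by norm_num))
    linarith
  obtain ⟨E, hEd, hE⟩ := ultralimit (U := Metric.ball z r) Metric.isOpen_ball (hyperfilter ℕ)
    (fun N w => Complex.exp (Q (N + K1) w)) (by
      intro w hw
      obtain ⟨ρ, hρ, hρb⟩ := Metric.isOpen_iff.1 Metric.isOpen_ball w hw
      refine ⟨ρ, hρ, Real.exp (B + C), Eventually.of_forall fun N => ⟨?_, ?_⟩⟩
      · exact (hQd _).cexp.mono hρb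
      · intro x hx
        rw [Complex.norm_exp, hQr _ _ (hρb hx)]
        have : N + K1 + N0 = (N + N0) + K1 := by ring
        rw [this]
        exact Real.exp_le_exp.2 (hbound _ _ (hρb hx)))
  have hEn : ∀ w ∈ Metric.ball z r, ‖E w‖ = Real.exp (Gr F d R (γ w)) := by
    intro w hw
    have h1 : Tendsto (fun N => ‖Complex.exp (Q (N + K1) w)‖) (hyperfilter ℕ) (𝓝 ‖E w‖) :=
      (hE.tendsto_at hw).norm
    refine tendsto_nhds_unique h1 ?_
    have h2 : Tendsto (fun N => Real.exp (Gseq F d R (N + (K1 + N0)) (γ w))) atTop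
        (𝓝 (Real.exp (Gr F d R (γ w)))) :=
      (Real.continuous_exp.tendsto _).comp
        ((tendsto_add_atTop_iff_nat (f := fun N => Gseq F d R N (γ w)) _).2 (H.G_lim _))
    refine (h2.mono_left Nat.hyperfilter_le_atTop).congr fun N => ?_
    rw [Complex.norm_exp, hQr _ _ hw, add_assoc]
  have hz' := Metric.mem_ball_self (x := z) hr
  have hEa : AnalyticAt ℂ E z := hEd.analyticAt (Metric.ball_mem_nhds z hr)
  have hEz : E z ≠ 0 := by
    rw [← norm_pos_iff, hEn z hz']; exact Real.exp_pos _
  refine (harmonicAt_congr_nhds ?_).1 (hEa.harmonicAt_log_norm hEz)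
  filter_upwards [Metric.ball_mem_nhds z hr] with w hw
  rw [hEn w hw, Real.log_exp]

end Part05

section Part06

open InnerProductSpace

structure Cl (F S : ℂ × ℂ → ℂ × ℂ) (d : ℕ) (R : ℝ) (g : ℂ → ℂ × ℂ) : Prop where
  diff : Differentiable ℂ g
  back : ∀ (m : ℕ) (s : ℂ), S^[m] (g s) ∈ CV R
  zero : ∃ s, Gr F d R (g s) = 0
  pos : ∃ s, 0 < Gr F d R (g s)
  fr : ∀ s ∈ frontier {s | Gr F d R (g s) = 0}, s.im = 0

theorem CV_closed {R : ℝ} : IsClosed (CV R) :=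
  isClosed_le (by fun_prop) (by fun_prop)

variable {F S : ℂ × ℂ → ℂ × ℂ} {d : ℕ} {R : ℝ}

theorem HSys.Scont (H : HSys F S d R) : Continuous S := H.st.diffi.continuous


theorem HSys.blowup (H : HSys F S d R) (𝒰 : Ultrafilter ℕ) (U : ℕ → Set ℂ) (g : ℕ → ℂ → ℂ × ℂ) (C0 : ℝ)
    (hU : ∀ j, IsOpen (U j)) (hd : ∀ j, DifferentiableOn ℂ (g j) (U j))
    (hball : ∀ r : ℝ, ∀ᶠ j in (𝒰 : Filter ℕ), Metric.ball 0 r ⊆ U j)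
    (hback : ∀ (m : ℕ) (r : ℝ), ∀ᶠ j in (𝒰 : Filter ℕ), ∀ s ∈ Metric.ball (0:ℂ) r, S^[m] (g j s) ∈ CV R)
    (hflat : ∀ r : ℝ, ∀ δ > (0:ℝ), ∀ᶠ j in (𝒰 : Filter ℕ), 
      ∀ e ∈ frontier {z | z ∈ U j ∧ Gr F d R (g j z) = 0},
      ∀ e' ∈ frontier {z | z ∈ U j ∧ Gr F d R (g j z) = 0}, ‖e‖ < r → ‖e'‖ < r →
        |(e - e').im| ≤ δ * ‖e - e'‖)
    (h0 : ∀ᶠ j in (𝒰 : Filter ℕ), (0:ℂ) ∈ frontier {z | z ∈ U j ∧ Gr F d R (g j z) = 0})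
    (hC : ∀ᶠ j in (𝒰 : Filter ℕ), ∀ s : ℂ, ‖s‖ ≤ 1 / 2 → Gr F d R (g j s) ≤ C0)
    (h1 : ∀ᶠ j in (𝒰 : Filter ℕ), ∃ s : ℂ, ‖s‖ ≤ 1 ∧ 1 ≤ Gr F d R (g j s)) :
    ∃ g', Cl F S d R g' ∧ TendstoLocallyUniformlyOn g g' (𝒰 : Filter ℕ) univ := by
  obtain ⟨D, hD1, hD⟩ := doubling
  have hGLF : ∀ j, GLF (U j) (fun z => Gr F d R (g j z)) := fun j => H.isGLF (hU j) (hd j)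
  -- bounds
  have hbd : ∀ k : ℕ, ∃ C : ℝ, ∀ᶠ j in (𝒰 : Filter ℕ), ∀ s : ℂ, ‖s‖ ≤ 2 ^ k / 2 → Gr F d R (g j s) ≤ C := by
    intro k
    induction k with
    | zero => exact ⟨C0, by simpa using hC⟩
    | succ k ih =>
      obtain ⟨C, hCk⟩ := ih
      refine ⟨D * max C 1, ?_⟩
      filter_upwards [hCk, hball (50 * 2 ^ k), hflat (50 * 2 ^ k) (1 / 10000) (by norm_num), h0]
        with j hj hb hf h0 s hs
      have hn : ‖(2:ℂ) ^ k‖ = 2 ^ k := by simp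
      have hp : (0:ℝ) < 2 ^ k := by positivity
      have hbn : ((2:ℂ) ^ k) = ((2 ^ k : ℝ) : ℂ) := by push_cast; rfl
      refine hD (U j) 0 (2 ^ k) _ (max C 1) (hGLF j) (pow_ne_zero _ two_ne_zero) (by positivity) (by rwa [hn]) h0 ?_ ?_ ?_ s ?_
      · intro e he e' he' h1 h2
        rw [hn, sub_zero] at h1 h2
        have := hf e he e' he' h1 h2
        rw [norm_div, hn, hbn, Complex.div_ofReal_im, abs_div, abs_of_pos hp, ← mul_div_assoc]
        gcongr
      · refine (hj _ ?_).trans (le_max_left _ _)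
        rw [zero_add, norm_mul, hn]
        simp
        rfl
      · refine (hj _ ?_).trans (le_max_left _ _)
        rw [zero_add, norm_mul, hn]
        simp
        rfl
      · rw [hn, sub_zero]; rw [pow_succ] at hs; linarith
  have hbd' : ∀ r : ℝ, ∃ C : ℝ, ∀ᶠ j in (𝒰 : Filter ℕ), ∀ s : ℂ, ‖s‖ ≤ r → Gr F d R (g j s) ≤ C := by
    intro r
    obtain ⟨k, hk⟩ := pow_unbounded_of_one_lt (2 * r) (one_lt_two)
    obtain ⟨C, hC⟩ := hbd k
    exact ⟨C, hC.mono fun j hj s hs => hj s (by linarith)⟩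
  obtain ⟨g', hg', hlim⟩ := ultralimit isOpen_univ 𝒰 g (by
    intro z _
    obtain ⟨C, hC⟩ := hbd' (‖z‖ + 1)
    obtain ⟨B, _, hB⟩ := H.CV_bound C
    refine ⟨1, one_pos, B, ?_⟩
    have hsub : Metric.ball z 1 ⊆ Metric.ball 0 (‖z‖ + 1) := by
      intro w hw
      rw [mem_ball_iff_norm] at hw ⊢
      have := norm_add_le (w - z) z
      simp at this ⊢
      linarith
    filter_upwards [hC, hball (‖z‖ + 1), hback 0 (‖z‖ + 1)] with j hj hb hk
    refine ⟨(hd j).mono (hsub.trans hb), fun w hw => ?_⟩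
    exact hB _ (hk w (hsub hw)) (hj w (mem_ball_zero_iff.1 (hsub hw)).le))
  have hg'd : Differentiable ℂ g' := differentiableOn_univ.1 hg'
  have hpt : ∀ s, Tendsto (fun j => g j s) 𝒰 (𝓝 (g' s)) := fun s => hlim.tendsto_at (mem_univ s)
  have hGpt : ∀ s, Tendsto (fun j => Gr F d R (g j s)) 𝒰 (𝓝 (Gr F d R (g' s))) := fun s =>
    (H.G_cont.tendsto _).comp (hpt s)
  have hu' : GLF univ (fun z => Gr F d R (g' z)) := H.isGLF isOpen_univ hg'
  refine ⟨g', ⟨hg'd, ?_, ⟨0, ?_⟩, ?_, ?_⟩, hlim⟩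
  · intro m s
    refine CV_closed.mem_of_tendsto (((H.Scont.iterate m).tendsto _).comp (hpt s)) ?_
    filter_upwards [hback m (‖s‖ + 1)] with j hj
    exact hj s (by simp)
  · refine tendsto_nhds_unique (hGpt 0) (tendsto_const_nhds.congr' ?_)
    filter_upwards [h0, hball 1] with j hj hb
    by_contra hne
    have h0U : (0:ℂ) ∈ U j := hb (by simp)
    have hpos : 0 < Gr F d R (g j 0) := lt_of_le_of_ne (H.G_nonneg _) hne
    have hn : {z | z ∈ U j ∧ Gr F d R (g j z) = 0}ᶜ ∈ 𝓝 (0:ℂ) := by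
      have := ((hGLF j).cont.continuousAt ((hU j).mem_nhds h0U)).eventually (lt_mem_nhds hpos)
      filter_upwards [this] with z hz hz'
      exact hz.ne' hz'.2
    rw [← mem_interior_iff_mem_nhds, interior_compl] at hn
    exact hn (frontier_subset_closure hj)
  · -- positivity
    obtain ⟨s, hs⟩ : ∃ s : ℕ → ℂ, ∀ᶠ j in (𝒰 : Filter ℕ), ‖s j‖ ≤ 1 ∧ 1 ≤ Gr F d R (g j (s j)) := by
      choose! s hs using fun (j : ℕ) (hj : ∃ s : ℂ, ‖s‖ ≤ 1 ∧ 1 ≤ Gr F d R (g j s)) => hj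
      exact ⟨s, h1.mono fun j hj => hs j hj⟩
    obtain ⟨x, -, hx⟩ := (isCompact_closedBall (0:ℂ) 1).ultrafilter_le_nhds (𝒰.map s) (by
      rw [le_principal_iff]
      refine hs.mono fun j hj => ?_
      simpa using hj.1)
    have hx' : Tendsto s 𝒰 (𝓝 x) := hx
    refine ⟨x, lt_of_lt_of_le one_pos ?_⟩
    have := (hlim.tendsto_comp (hg'.continuousOn.continuousWithinAt (mem_univ x)) (mem_univ x)
      (by rwa [nhdsWithin_univ]))
    exact ge_of_tendsto ((H.G_cont.tendsto _).comp this) (hs.mono fun j hj => hj.2)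
  · intro x hx
    by_contra him
    set ρ := |x.im| / 2 with hρ
    have hρ0 : 0 < ρ := by positivity
    have hav : ∀ᶠ j in (𝒰 : Filter ℕ), (∀ z ∈ Metric.ball x ρ, Gr F d R (g j z) = 0) ∨
        (∀ z ∈ Metric.ball x ρ, 0 < Gr F d R (g j z)) := by
      set r := ‖x‖ + ρ + 1
      filter_upwards [h0, hball r, hflat r (ρ / (2 * r)) (by positivity)] with j h0 hb hf
      have hsub : Metric.ball x ρ ⊆ Metric.ball 0 r := by
        intro w hw
        rw [mem_ball_iff_norm] at hw ⊢
        have := norm_add_le (w - x) x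
        simp at this ⊢
        linarith
      refine dichotomy (hGLF j) (convex_ball x ρ).isPreconnected (hsub.trans hb) ?_
      intro z hz hzf
      have hzr := hsub hz
      rw [mem_ball_zero_iff] at hzr
      have := hf z hzf 0 h0 hzr (by simp; positivity)
      rw [sub_zero] at this
      have h2 : ρ / (2 * r) * ‖z‖ ≤ ρ / 2 := by
        calc ρ / (2 * r) * ‖z‖ ≤ ρ / (2 * r) * r := by gcongr
          _ = ρ / 2 := by
            have : r ≠ 0 := by positivity
            field_simp
      rw [mem_ball_iff_norm] at hz
      have h3 := (Complex.abs_im_le_norm (z - x)).trans_lt hz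
      rw [Complex.sub_im] at h3
      have h4 := abs_sub_abs_le_abs_sub x.im z.im
      rw [abs_sub_comm] at h4
      have : |x.im| = 2 * ρ := by rw [hρ]; ring
      linarith
    have hclosed : IsClosed {s | Gr F d R (g' s) = 0} :=
      isClosed_eq (H.G_cont.comp hg'd.continuous) continuous_const
    have hx0 : Gr F d R (g' x) = 0 := by
      have := frontier_subset_closure hx
      rwa [hclosed.closure_eq] at this
    have hall : ∀ z ∈ Metric.ball x ρ, Gr F d R (g' z) = 0 := by
      rcases Ultrafilter.eventually_or.1 hav with hz | hz
      · intro z hzb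
        exact tendsto_nhds_unique (hGpt z) (tendsto_const_nhds.congr' (hz.mono fun j hj => (hj z hzb).symm))
      · intro z hzb
        have hh : ∀ᶠ j in (𝒰 : Filter ℕ), Gr F d R (g j z) * (ρ - ‖z - x‖) ≤ (ρ + ‖z - x‖) * Gr F d R (g j x) := by
          filter_upwards [hz, hball (‖x‖ + ρ)] with j hj hb
          refine ((hGLF j).harnack (r := ρ) (w := x) ?_ hj hzb).1
          refine Subset.trans ?_ hb
          intro w hw
          rw [mem_ball_iff_norm] at hw ⊢
          have := norm_add_le (w - x) x
          simp at this ⊢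
          linarith
        have := le_of_tendsto_of_tendsto ((hGpt z).mul_const _) ((hGpt x).const_mul _) hh
        rw [hx0, mul_zero] at this
        rw [mem_ball_iff_norm] at hzb
        have h3 := H.G_nonneg (g' z)
        nlinarith
    refine hx.2 (mem_interior_iff_mem_nhds.2 ?_)
    filter_upwards [Metric.ball_mem_nhds x hρ0] with z hz using hall z hz

end Part06

section Part07

open InnerProductSpace

theorem flat_point {E D : Set ℂ} {Fr : Set ℂ} (hE : E = D ∩ Fr) (hD : IsOpen D) (hFr : IsClosed Fr)
    (hne : E.Nonempty) {I : Set ℝ} {η : ℝ → ℂ} (hI : IsOpen I)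
    (hinj : InjOn η I) (hC : ContDiffOn ℝ 1 η I) (hder : ∀ t ∈ I, deriv η t ≠ 0) (hsub : E ⊆ η '' I) :
    ∃ z0 ∈ E, ∃ c : ℂ, ‖c‖ = 1 ∧ ∀ δ > (0:ℝ), ∃ r > (0:ℝ), ∀ e ∈ E, ∀ e' ∈ E, ‖e - z0‖ < r → ‖e' - z0‖ < r →
      |((e - e') / c).im| ≤ δ * ‖e - e'‖ := by
  have hlc : LocallyCompactSpace E := by
    have : IsLocallyClosed E := ⟨D, Fr, hD, hFr, hE⟩
    exact this.locallyCompactSpace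
  have : Nonempty E := hne.to_subtype
  haveI : LocallyCompactSpace I := hI.locallyCompactSpace
  let Kn : ℕ → Set ℝ := fun n => (↑) '' (compactCovering I n)
  have hKc : ∀ n, IsCompact (Kn n) := fun n => (isCompact_compactCovering I n).image continuous_subtype_val
  have hKI : ∀ n, Kn n ⊆ I := by
    rintro n _ ⟨x, _, rfl⟩; exact x.2
  have hKu : ∀ t ∈ I, ∃ n, t ∈ Kn n := by
    intro t ht
    have : (⟨t, ht⟩ : I) ∈ ⋃ n, compactCovering I n := by rw [iUnion_compactCovering]; trivial
    obtain ⟨n, hn⟩ := mem_iUnion.1 this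
    exact ⟨n, ⟨t, ht⟩, hn, rfl⟩
  have hcont : ContinuousOn η I := hC.continuousOn
  have hKη : ∀ n, IsCompact (η '' Kn n) := fun n => (hKc n).image_of_continuousOn (hcont.mono (hKI n))
  obtain ⟨n, hn⟩ := nonempty_interior_of_iUnion_of_closed
    (f := fun n => ((↑) : E → ℂ) ⁻¹' (η '' Kn n))
    (fun n => (hKη n).isClosed.preimage continuous_subtype_val) (by
      rw [eq_univ_iff_forall]
      rintro ⟨x, hx⟩
      obtain ⟨t, ht, rfl⟩ := hsub hx
      obtain ⟨n, hn⟩ := hKu t ht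
      exact mem_iUnion.2 ⟨n, t, hn, rfl⟩)
  obtain ⟨⟨z0, hz0⟩, hz0'⟩ := hn
  rw [mem_interior_iff_mem_nhds, nhds_subtype, mem_comap] at hz0'
  obtain ⟨W, hW, hW'⟩ := hz0'
  obtain ⟨r0, hr0, hr0'⟩ := Metric.mem_nhds_iff.1 hW
  have hin : ∀ e ∈ E, ‖e - z0‖ < r0 → e ∈ η '' Kn n := fun e he hb =>
    hW' (a := ⟨e, he⟩) (hr0' (mem_ball_iff_norm.2 hb))
  obtain ⟨t0, ht0, rfl⟩ := hin z0 hz0 (by simpa)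
  have ht0I := hKI n ht0
  have hclose : ∀ ε > 0, ∃ r > 0, ∀ e ∈ E, ‖e - η t0‖ < r → ∃ t, |t - t0| < ε ∧ e = η t := by
    intro ε hε
    have hc : IsCompact (η '' (Kn n \ Metric.ball t0 ε)) :=
      ((hKc n).diff Metric.isOpen_ball).image_of_continuousOn (hcont.mono (diff_subset.trans (hKI n)))
    have hnot : η t0 ∈ (η '' (Kn n \ Metric.ball t0 ε))ᶜ := by
      rintro ⟨t, ht, hte⟩
      have := hinj (hKI n ht.1) ht0I hte
      subst this
      exact ht.2 (Metric.mem_ball_self hε)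
    obtain ⟨r, hr, hr'⟩ := Metric.isOpen_iff.1 hc.isClosed.isOpen_compl _ hnot
    refine ⟨min r r0, lt_min hr hr0, fun e he hb => ?_⟩
    obtain ⟨t, ht, rfl⟩ := hin e he (hb.trans_le (min_le_right _ _))
    refine ⟨t, ?_, rfl⟩
    by_contra hcon
    exact hr' (mem_ball_iff_norm.2 (hb.trans_le (min_le_left _ _))) ⟨t, ⟨ht, fun h => hcon (by
      simpa [Real.dist_eq] using h)⟩, rfl⟩
  have hstrict : HasStrictDerivAt η (deriv η t0) t0 :=
    (hC.contDiffAt (hI.mem_nhds ht0I)).hasStrictDerivAt (by norm_num)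
  have hη := hder t0 ht0I
  set w := deriv η t0 with hw
  have hwn : 0 < ‖w‖ := norm_pos_iff.2 hη
  have hc1 : ‖w / (‖w‖ : ℂ)‖ = 1 := by rw [norm_div]; simp [hwn.ne']
  refine ⟨η t0, hz0, w / ‖w‖, hc1, ?_⟩
  intro δ hδ
  set ε' := min (‖w‖ / 2) (δ * ‖w‖ / 2) with hε'
  have hε'0 : 0 < ε' := by positivity
  have hlo := hstrict.hasStrictFDerivAt.isLittleO
  have hev := hlo.def hε'0
  obtain ⟨ε, hε, hεT⟩ := Metric.eventually_nhds_iff_ball.1 hev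
  obtain ⟨r, hr, hr'⟩ := hclose ε hε
  refine ⟨r, hr, fun e he e' he' h1 h2 => ?_⟩
  obtain ⟨t, ht, rfl⟩ := hr' e he h1
  obtain ⟨t', ht', rfl⟩ := hr' e' he' h2
  have key := hεT (t, t') (by
    rw [← ball_prod_same]
    exact ⟨by simpa [Real.dist_eq] using ht, by simpa [Real.dist_eq] using ht'⟩)
  simp only [ContinuousLinearMap.toSpanSingleton_apply, Complex.real_smul] at key
  rw [Real.norm_eq_abs] at key
  have h3 : ((η t - η t') / (w / ‖w‖)).im = ((η t - η t' - ((t - t' : ℝ):ℂ) * w) / (w / ‖w‖)).im := by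
    have : ((t - t' : ℝ):ℂ) * w / (w / ‖w‖) = (((t - t') * ‖w‖ : ℝ) : ℂ) := by
      field_simp; push_cast; ring
    rw [sub_div (η t - η t'), this, Complex.sub_im, Complex.ofReal_im, sub_zero]
  rw [h3]
  have h4 : |((η t - η t' - ((t - t' : ℝ):ℂ) * w) / (w / ‖w‖)).im| ≤ ε' * |t - t'| := by
    refine (Complex.abs_im_le_norm _).trans ?_
    rw [norm_div, hc1, div_one]
    exact key
  have h5 : ‖((t - t' : ℝ):ℂ) * w‖ ≤ ‖η t - η t'‖ + ε' * |t - t'| := by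
    have := norm_sub_le (η t - η t') (η t - η t' - ((t - t' : ℝ):ℂ) * w)
    rw [sub_sub_cancel] at this
    linarith
  rw [norm_mul, Complex.norm_real, Real.norm_eq_abs] at h5
  have h6 : ε' ≤ ‖w‖ / 2 := min_le_left _ _
  have h7 : ε' ≤ δ * ‖w‖ / 2 := min_le_right _ _
  have h8 := abs_nonneg (t - t')
  calc _ ≤ ε' * |t - t'| := h4
    _ ≤ δ * ‖w‖ / 2 * |t - t'| := by gcongr
    _ = δ * (‖w‖ / 2 * |t - t'|) := by ring
    _ ≤ δ * ‖η t - η t'‖ := by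
      gcongr
      nlinarith

/-- the affine change of variable -/
def aff (z0 b : ℂ) (hb : b ≠ 0) : ℂ ≃ₜ ℂ := (Homeomorph.mulLeft₀ b hb).trans (Homeomorph.addLeft z0)

theorem aff_apply (z0 b : ℂ) (hb : b ≠ 0) (s : ℂ) : aff z0 b hb s = z0 + b * s := rfl

theorem mem_frontier_aff (z0 : ℂ) {b : ℂ} (hb : b ≠ 0) {P : ℂ → Prop} {s : ℂ} :
    s ∈ frontier {s | P (z0 + b * s)} ↔ z0 + b * s ∈ frontier {z | P z} := by
  have := (aff z0 b hb).preimage_frontier {z | P z}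
  have h2 : s ∈ (aff z0 b hb) ⁻¹' frontier {z | P z} ↔ s ∈ frontier ((aff z0 b hb) ⁻¹' {z | P z}) := by rw [this]
  exact h2.symm

variable {F S : ℂ × ℂ → ℂ × ℂ} {d : ℕ} {R : ℝ}

theorem HSys.SF (H : HSys F S d R) {m K : ℕ} (h : m ≤ K) (q : ℂ × ℂ) : S^[m] (F^[K] q) = F^[K - m] q := by
  obtain ⟨k, rfl⟩ := Nat.exists_eq_add_of_le h
  rw [iterate_add_apply, Nat.add_sub_cancel_left]
  exact (LeftInverse.iterate H.st.li m) _

theorem HSys.G_iter_zero (H : HSys F S d R) (q : ℂ × ℂ) (n : ℕ) :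
    Gr F d R (F^[n] q) = 0 ↔ Gr F d R q = 0 := by
  rw [H.G_iter]
  have := H.d0
  simp [this.ne']

theorem HSys.phase1 (H : HSys F S d R) {γ : ℂ → ℂ × ℂ} (hd : DifferentiableOn ℂ γ unitDisk)
    (hK : ∃ z ∈ unitDisk, γ z ∈ Kplus F) (hK' : ¬ (∀ z ∈ unitDisk, γ z ∈ Kplus F))
    {I : Set ℝ} {η : ℝ → ℂ} (hI : IsOpen I)
    (hinj : InjOn η I) (hC : ContDiffOn ℝ 1 η I) (hder : ∀ t ∈ I, deriv η t ≠ 0)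
    (hsub : juliaSlice F γ ⊆ η '' I) : ∃ g, Cl F S d R g := by
  have hUo : IsOpen unitDisk := Metric.isOpen_ball
  set Z := {z | z ∈ unitDisk ∧ γ z ∈ Kplus F} with hZ
  have hne : (juliaSlice F γ).Nonempty := by
    push Not at hK'
    obtain ⟨z1, h1, h1'⟩ := hK
    obtain ⟨z2, h2, h2'⟩ := hK'
    exact inter_frontier_of_preconn (convex_ball (0:ℂ) 1).isPreconnected ⟨z1, h1, h1, h1'⟩ ⟨z2, h2, fun h => h2' h.2⟩
  obtain ⟨z0, hz0, c, hc1, hflat⟩ := flat_point (E := juliaSlice F γ) rfl hUo isClosed_frontier hne hI hinj hC hder hsub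
  have hc : c ≠ 0 := by rintro rfl; simp at hc1
  set u : ℂ → ℝ := fun z => Gr F d R (γ z) with hu
  have hZu : Z = {z | z ∈ unitDisk ∧ u z = 0} := by
    ext z; simp only [hZ, mem_ofPred_eq, hu, H.G_zero]
  have hGLF : GLF unitDisk u := H.isGLF hUo hd
  have hz0U : z0 ∈ unitDisk := hz0.1
  have hz0F : z0 ∈ frontier Z := hz0.2
  obtain ⟨r1, hr1, hr1'⟩ := Metric.isOpen_iff.1 hUo z0 hz0U
  set r0 := r1 / 2
  have hr0 : 0 < r0 := by positivity
  have hcb : Metric.closedBall z0 r0 ⊆ unitDisk := (Metric.closedBall_subset_ball (by simp [r0]; linarith)).trans hr1'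
  have hucb : ContinuousOn u (Metric.closedBall z0 r0) := hGLF.cont.mono hcb
  have huz0 : u z0 = 0 := by
    by_contra hne
    have hpos : 0 < u z0 := lt_of_le_of_ne (H.G_nonneg _) (Ne.symm hne)
    have hn : Zᶜ ∈ 𝓝 z0 := by
      have := (hGLF.cont.continuousAt (hUo.mem_nhds hz0U)).eventually (lt_mem_nhds hpos)
      filter_upwards [this] with z hz hz'
      rw [hZu] at hz'
      exact hz.ne' hz'.2
    rw [← mem_interior_iff_mem_nhds, interior_compl] at hn
    exact hn (frontier_subset_closure hz0F)
  have hnear : ∀ ε > 0, ∃ z, ‖z - z0‖ < ε ∧ ‖z - z0‖ ≤ r0 ∧ 0 < u z := by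
    intro ε hε
    have h1 : z0 ∈ closure Zᶜ := by
      rw [closure_compl]; exact hz0F.2
    obtain ⟨z, hz, hzd⟩ := Metric.mem_closure_iff.1 h1 (min ε r0) (lt_min hε hr0)
    rw [dist_comm, dist_eq_norm] at hzd
    have hzr : ‖z - z0‖ ≤ r0 := (hzd.trans_le (min_le_right _ _)).le
    refine ⟨z, hzd.trans_le (min_le_left _ _), hzr, lt_of_le_of_ne (H.G_nonneg _) fun h => hz ?_⟩
    rw [hZu]
    exact ⟨hcb (mem_closedBall_iff_norm.2 hzr), h.symm⟩
  have hdpos := H.d0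
  have hd2 := H.d2
  have hgrow : ∀ ε > 0, ∃ K0 : ℕ, ∀ K ≥ K0, ∃ z, ‖z - z0‖ < ε ∧ ‖z - z0‖ ≤ r0 ∧ 1 ≤ (d:ℝ) ^ K * u z := by
    intro ε hε
    obtain ⟨z, h1, h2, h3⟩ := hnear ε hε
    obtain ⟨K0, hK0⟩ := pow_unbounded_of_one_lt (1 / u z) (by linarith : (1:ℝ) < d)
    refine ⟨K0, fun K hK => ⟨z, h1, h2, ?_⟩⟩
    have : (d:ℝ) ^ K0 ≤ d ^ K := pow_le_pow_right₀ (by linarith) hK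
    rw [div_lt_iff₀ h3] at hK0
    nlinarith
  set A : ℕ → Set ℂ := fun K => Metric.closedBall z0 r0 ∩ {z | 1 ≤ (d:ℝ) ^ K * u z} with hA
  have hAc : ∀ K, IsCompact (A K) := fun K =>
    (isCompact_closedBall z0 r0).of_isClosed_subset
      ((continuousOn_const.mul hucb).preimage_isClosed_of_isClosed Metric.isClosed_closedBall isClosed_Ici) inter_subset_left
  have hex : ∀ K, ∃ a : ℂ, (A K).Nonempty → a ∈ A K ∧ ∀ z ∈ A K, ‖a - z0‖ ≤ ‖z - z0‖ := by
    intro K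
    by_cases h : (A K).Nonempty
    · obtain ⟨a, ha, hm⟩ := (hAc K).exists_isMinOn h (f := fun z => ‖z - z0‖) (by fun_prop)
      exact ⟨a, fun _ => ⟨ha, fun z hz => hm hz⟩⟩
    · exact ⟨0, fun h' => absurd h' h⟩
  choose a ha using hex
  set b : ℕ → ℂ := fun K => c * ((‖a K - z0‖ : ℝ) : ℂ) with hb
  have hbn : ∀ K, ‖b K‖ = ‖a K - z0‖ := by intro K; simp [hb, hc1]
  have hAev : ∀ ε > 0, ∀ᶠ K in atTop, (A K).Nonempty ∧ ‖a K - z0‖ < ε := by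
    intro ε hε
    obtain ⟨K0, hK0⟩ := hgrow ε hε
    filter_upwards [eventually_ge_atTop K0] with K hK
    obtain ⟨z, h1, h2, h3⟩ := hK0 K hK
    have hz : z ∈ A K := ⟨mem_closedBall_iff_norm.2 h2, h3⟩
    exact ⟨⟨z, hz⟩, ((ha K ⟨z, hz⟩).2 z hz).trans_lt h1⟩
  have hbne : ∀ᶠ K in atTop, b K ≠ 0 := by
    filter_upwards [hAev 1 one_pos] with K hK
    have h1 := (ha K hK.1).1.2
    rw [← norm_pos_iff, hbn, norm_pos_iff, sub_ne_zero]
    rintro h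
    simp only [mem_ofPred_eq] at h1
    rw [h, huz0] at h1
    norm_num at h1
  have hle : (hyperfilter ℕ : Filter ℕ) ≤ atTop := Nat.hyperfilter_le_atTop
  -- small scales
  have hsmall : ∀ r ε : ℝ, 0 < ε → ∀ᶠ K in atTop, ∀ s : ℂ, ‖s‖ < r → ‖b K * s‖ < ε := by
    intro r ε hε
    filter_upwards [hAev (ε / (|r| + 1)) (by positivity)] with K hK s hs
    rw [norm_mul, hbn]
    have h2 := le_abs_self r
    calc ‖a K - z0‖ * ‖s‖ ≤ ‖a K - z0‖ * (|r| + 1) := by gcongr; linarith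
      _ < ε / (|r| + 1) * (|r| + 1) := by
        have := hK.2
        gcongr
      _ = ε := by field_simp
  have hmem : ∀ r : ℝ, ∀ᶠ K in atTop, ∀ s : ℂ, ‖s‖ < r → z0 + b K * s ∈ Metric.closedBall z0 r0 := by
    intro r
    filter_upwards [hsmall r r0 hr0] with K hK s hs
    rw [mem_closedBall_iff_norm, add_sub_cancel_left]
    exact (hK s hs).le
  have hGg : ∀ (K : ℕ) z, Gr F d R (F^[K] (γ z)) = d ^ K * u z := fun K z => H.G_iter _ K
  have hset : ∀ K : ℕ, {s | z0 + b K * s ∈ unitDisk ∧ Gr F d R (F^[K] (γ (z0 + b K * s))) = 0} =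
      {s | (fun z => z ∈ unitDisk ∧ u z = 0) (z0 + b K * s)} := by
    intro K
    ext s
    simp only [mem_ofPred_eq, H.G_iter_zero, hu]
  refine Exists.imp (fun g' h => h.1) (H.blowup (hyperfilter ℕ) (fun K => {s | z0 + b K * s ∈ unitDisk})
    (fun K s => F^[K] (γ (z0 + b K * s))) 1 ?_ ?_ ?_ ?_ ?_ ?_ ?_ ?_)
  · intro K; exact hUo.preimage (by fun_prop : Continuous fun s => z0 + b K * s)
  · intro K
    refine (H.st.diff.iterate K).comp_differentiableOn (hd.comp (by fun_prop) ?_)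
    intro s hs; exact hs
  · intro r
    refine Eventually.filter_mono hle ?_
    filter_upwards [hmem r] with K hK s hs
    exact hcb (hK s (mem_ball_zero_iff.1 hs))
  · intro m r
    refine Eventually.filter_mono hle ?_
    obtain ⟨B, hB⟩ := (isCompact_closedBall z0 r0).exists_bound_of_continuousOn (hd.continuousOn.mono hcb)
    obtain ⟨K0, hK0⟩ := H.absorb (B := B)
    filter_upwards [hmem r, eventually_ge_atTop (K0 + m)] with K hK hK2 s hs
    rw [H.SF (by omega)]
    exact hK0 _ (by omega) _ ((norm_snd_le _).trans (hB _ (hK s (mem_ball_zero_iff.1 hs))))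
  · intro r δ hδ
    refine Eventually.filter_mono hle ?_
    obtain ⟨r', hr', hfl⟩ := hflat δ hδ
    filter_upwards [hmem r, hsmall r r' hr', hbne] with K hK hK2 hbK e he e' he' h1 h2
    rw [hset, mem_frontier_aff z0 hbK (P := fun z => z ∈ unitDisk ∧ u z = 0), ← hZu] at he he'
    have h3 := hfl _ ⟨hcb (hK e h1), he⟩ _ ⟨hcb (hK e' h2), he'⟩ (by simpa using hK2 e h1) (by simpa using hK2 e' h2)
    have e1 : (z0 + b K * e - (z0 + b K * e')) / c = ((‖a K - z0‖ : ℝ) : ℂ) * (e - e') := by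
      simp only [hb]; field_simp; ring
    have e2 : z0 + b K * e - (z0 + b K * e') = b K * (e - e') := by ring
    rw [e1, e2, norm_mul, hbn, Complex.im_ofReal_mul, abs_mul, abs_of_nonneg (norm_nonneg _)] at h3
    have hp : 0 < ‖a K - z0‖ := by rw [← hbn]; exact norm_pos_iff.2 hbK
    refine le_of_mul_le_mul_left ?_ hp
    linarith
  · refine Eventually.filter_mono hle ?_
    filter_upwards [hbne] with K hbK
    rw [hset, mem_frontier_aff z0 hbK (P := fun z => z ∈ unitDisk ∧ u z = 0), ← hZu]
    simpa using hz0F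
  · refine Eventually.filter_mono hle ?_
    filter_upwards [hbne, hmem 1, hAev 1 one_pos] with K hbK hmK hAK s hs
    rw [hGg]
    by_contra hcon
    push Not at hcon
    have h1 := (ha K hAK.1).2 (z0 + b K * s) ⟨hmK s (by linarith), hcon.le⟩
    rw [add_sub_cancel_left, norm_mul, hbn] at h1
    have : 0 < ‖a K - z0‖ := by rw [← hbn]; exact norm_pos_iff.2 hbK
    nlinarith
  · refine Eventually.filter_mono hle ?_
    filter_upwards [hbne, hAev 1 one_pos] with K hbK hAK
    refine ⟨(a K - z0) / b K, ?_, ?_⟩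
    · rw [norm_div, hbn, div_self]
      rw [← hbn]; exact norm_ne_zero_iff.2 hbK
    · rw [hGg, mul_div_cancel₀ _ hbK, add_sub_cancel]
      exact (ha K hAK.1).1.2

end Part07

section Part08

open InnerProductSpace

theorem hopf {v : ℂ → ℝ} (hc : ContinuousOn v {z | 0 ≤ z.im}) (hn : ∀ z : ℂ, 0 ≤ z.im → 0 ≤ v z)
    (hh : ∀ z : ℂ, 0 < z.im → HarmonicAt v z) {R : ℝ} (hR : 0 < R) {z : ℂ} (hy : 0 ≤ z.im)
    (h1 : |z.re| ≤ R) (h2 : 2 * z.im ≤ R) : v (8 * R * Complex.I) * z.im ≤ 60 * R * v z := by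
  set m := v (8 * R * Complex.I) / 80 with hm
  have hm0 : 0 ≤ m := div_nonneg (hn _ (by simp; positivity)) (by norm_num)
  -- Harnack at the top
  have htop : ∀ s : ℂ, s.im = R / 2 → |s.re| ≤ 2 * R → m ≤ v s := by
    intro s hs1 hs2
    have hd : ‖s - 8 * R * Complex.I‖ ≤ 7.8 * R := by
      rw [← sq_le_sq₀ (norm_nonneg _) (by positivity), Complex.sq_norm, Complex.normSq_apply]
      simp [hs1]
      have := sq_le_sq' (abs_le.1 hs2).1 (abs_le.1 hs2).2
      nlinarith
    have hε : ∀ ε > 0, m - ε ≤ v s := by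
      intro ε hε
      have hball : ∀ z ∈ Metric.ball (8 * R * Complex.I) (8 * R), 0 < z.im := by
        intro z hz
        rw [mem_ball_iff_norm] at hz
        have := (Complex.abs_im_le_norm _).trans_lt hz
        simp at this
        linarith [(abs_lt.1 this).1]
      have hG : GLF {z : ℂ | 0 < z.im} (fun z => v z + ε) :=
        ⟨(hc.mono fun z (hz : 0 < z.im) => hz.le).add continuousOn_const, fun z hz => by
          have := hn z (le_of_lt hz); positivity, fun z hz _ => (hh z hz).add (by
            exact harmonicAt_const ε)⟩
      have := (hG.harnack (w := 8 * R * Complex.I) (r := 8 * R) hball (fun z hz => by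
        have := hn z (hball z hz).le; positivity) (z := s) (by
          rw [mem_ball_iff_norm]; linarith)).2
      have h3 := hn (8 * R * Complex.I) (by simp; positivity)
      have h4 := hn s (by rw [hs1]; positivity)
      have h5 : v (8 * R * Complex.I) * (0.2 * R) ≤ 16 * R * (v s + ε) := by
        calc v (8 * R * Complex.I) * (0.2 * R) ≤ (v (8 * R * Complex.I) + ε) * (8 * R - ‖s - 8 * R * Complex.I‖) := by
              gcongr <;> linarith
          _ ≤ _ := this
          _ ≤ 16 * R * (v s + ε) := by gcongr; linarith
      have h6 : v (8 * R * Complex.I) * (0.2) ≤ 16 * (v s + ε) := by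
        refine le_of_mul_le_mul_right ?_ hR
        linarith
      rw [hm]; linarith
    exact le_of_forall_pos_le_add fun ε h => by linarith [hε ε h]
  set B : Set ℂ := Ioo (z.re - R) (z.re + R) ×ℂ Ioo 0 (R / 2) with hB
  have hBo : IsOpen B := isOpen_Ioo.reProdIm isOpen_Ioo
  have hBb : Bornology.IsBounded B := (Metric.isBounded_Ioo _ _).reProdIm (Metric.isBounded_Ioo _ _)
  have hBcl : closure B = Icc (z.re - R) (z.re + R) ×ℂ Icc 0 (R / 2) := by
    rw [hB, Complex.closure_reProdIm, closure_Ioo (by linarith), closure_Ioo (by linarith)]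
  set P : ℂ → ℂ := fun s => (4 / 3 * m : ℝ) * (-Complex.I * ((s - z.re) / R) - ((s - z.re) / R) ^ 2) with hP
  have hPd : Differentiable ℂ P := by simp only [hP]; fun_prop
  have hPre : ∀ s : ℂ, (P s).re = 4 / 3 * m * (s.im / R - ((s.re - z.re) / R) ^ 2 + (s.im / R) ^ 2) := by
    intro s
    have : P s = (4 / 3 * m : ℝ) * (-Complex.I * (⟨(s.re - z.re) / R, s.im / R⟩ : ℂ) - (⟨(s.re - z.re) / R, s.im / R⟩ : ℂ) ^ 2) := by
      have : (s - z.re) / (R:ℂ) = (⟨(s.re - z.re) / R, s.im / R⟩ : ℂ) := by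
        apply Complex.ext
        · rw [Complex.div_ofReal_re]; simp
        · rw [Complex.div_ofReal_im]; simp
      simp only [hP, this]
    rw [this, Complex.re_ofReal_mul]
    simp [pow_two]
    left; ring
  have hre := abs_le.1 h1
  have hmain := mp_core hBo hBb (v := fun s => (P s).re - v s) ?_ ?_ ?_ z ?_
  · simp only [hPre, sub_self, zero_div, ne_eq, OfNat.ofNat_ne_zero, not_false_eq_true, zero_pow, sub_zero, mul_add] at hmain
    have h3 : 4 / 3 * m * (z.im / R) ≤ v z := by
      have h4 : 0 ≤ 4 / 3 * m * (z.im / R) ^ 2 := by positivity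
      linarith
    rw [hm] at h3
    have h4 : 4 / 3 * (v (8 * R * Complex.I) / 80) * (z.im / R) = v (8 * R * Complex.I) * z.im / (60 * R) := by
      field_simp; ring
    rw [h4, div_le_iff₀ (by positivity)] at h3
    linarith
  · refine (Complex.continuous_re.comp hPd.continuous).continuousOn.sub (hc.mono ?_)
    rw [hBcl]
    rintro s ⟨_, hs⟩
    exact hs.1
  · intro s hs
    rw [hB, Complex.frontier_reProdIm, closure_Ioo (by linarith), closure_Ioo (by linarith), frontier_Ioo (by linarith), frontier_Ioo (by linarith)] at hs
    rw [hPre]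
    rcases hs with ⟨ha, hb⟩ | ⟨ha, hb⟩
    · have ha : s.re ∈ Icc (z.re - R) (z.re + R) := ha
      have hb : s.im ∈ ({0, R/2} : Set ℝ) := hb
      rcases hb with hb | hb
      · have := hn s hb.ge
        have h4 : 0 ≤ 4 / 3 * m * ((s.re - z.re) / R) ^ 2 := by positivity
        rw [hb]
        simp
        linarith
      · have hb : s.im = R / 2 := hb
        have h5 := htop s hb (abs_le.2 ⟨by linarith [ha.1], by linarith [ha.2]⟩)
        have h4 : 0 ≤ 4 / 3 * m * ((s.re - z.re) / R) ^ 2 := by positivity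
        have h6 : s.im / R = 1 / 2 := by rw [hb]; field_simp
        rw [h6]
        linarith
    · have hb : s.im ∈ Icc 0 (R / 2) := hb
      have ha : s.re ∈ ({z.re - R, z.re + R} : Set ℝ) := ha
      have h3 : ((s.re - z.re) / R) ^ 2 = 1 := by
        rcases ha with ha | ha
        · rw [ha]; field_simp; ring
        · have ha : s.re = z.re + R := ha
          rw [ha]; field_simp; ring
      rw [h3]
      have h4 := hn s hb.1
      have h5 : s.im / R ≤ 1 / 2 := by rw [div_le_iff₀ hR]; linarith [hb.2]
      have h6 : 0 ≤ s.im / R := div_nonneg hb.1 hR.le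
      have : 4 / 3 * m * (s.im / R - 1 + (s.im / R) ^ 2) ≤ 0 :=
        mul_nonpos_of_nonneg_of_nonpos (by positivity) (by nlinarith)
      linarith
  · intro s hs _
    refine harmAt_sub (AnalyticAt.harmonicAt_re (hPd.analyticAt s)) (hh s hs.2.1)
  · rw [hBcl]
    exact ⟨⟨by linarith, by linarith⟩, hy, by linarith⟩

theorem upper_box {u : ℂ → ℝ} (h : GLF univ u) (h0 : ∀ z : ℂ, z.im ≤ 0 → u z = 0) {R M : ℝ} (hR : 0 < R)
    (hM : ∀ z : ℂ, ‖z‖ ≤ 4 * R → u z ≤ M) {z : ℂ} (hy : 0 ≤ z.im) (h1 : |z.re| ≤ R) (h2 : z.im ≤ R) :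
    u z ≤ 3 * M * (z.im / R) := by
  have hM0 : 0 ≤ M := by rw [← h0 0 (by simp)]; exact hM 0 (by simp; positivity)
  set B : Set ℂ := Ioo (z.re - R) (z.re + R) ×ℂ Ioo 0 R with hB
  have hBo : IsOpen B := isOpen_Ioo.reProdIm isOpen_Ioo
  have hBb : Bornology.IsBounded B := (Metric.isBounded_Ioo _ _).reProdIm (Metric.isBounded_Ioo _ _)
  have hBcl : closure B = Icc (z.re - R) (z.re + R) ×ℂ Icc 0 R := by
    rw [hB, Complex.closure_reProdIm, closure_Ioo (by linarith), closure_Ioo (by linarith)]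
  set P : ℂ → ℂ := fun s => (M : ℝ) * (-3 * Complex.I * ((s - z.re) / R) + ((s - z.re) / R) ^ 2) with hP
  have hPd : Differentiable ℂ P := by simp only [hP]; fun_prop
  have hPre : ∀ s : ℂ, (P s).re = M * (3 * (s.im / R) + ((s.re - z.re) / R) ^ 2 - (s.im / R) ^ 2) := by
    intro s
    have : (s - z.re) / (R:ℂ) = (⟨(s.re - z.re) / R, s.im / R⟩ : ℂ) := by
      apply Complex.ext
      · rw [Complex.div_ofReal_re]; simp
      · rw [Complex.div_ofReal_im]; simp
    simp only [hP, this]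
    rw [Complex.re_ofReal_mul]
    simp [pow_two]
    left; ring
  have hre := abs_le.1 h1
  have hmain := h.sub hBo hBb (subset_univ _) hPd.diffContOnCl ?_ z ?_
  · rw [hPre] at hmain
    have : 0 ≤ M * (z.im / R) ^ 2 := by positivity
    simp at hmain
    nlinarith
  · intro s hs
    have hcl := frontier_subset_closure hs
    rw [hBcl] at hcl
    obtain ⟨⟨hx1, hx2⟩, hy1, hy2⟩ := hcl
    have hy1 : 0 ≤ s.im := hy1
    have hy2 : s.im ≤ R := hy2
    have hus : u s ≤ M := hM s (by
      have := Complex.norm_le_abs_re_add_abs_im s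
      have h3 : |s.re| ≤ 2 * R := abs_le.2 ⟨by linarith, by linarith⟩
      have h4 : |s.im| ≤ R := abs_le.2 ⟨by linarith, by linarith⟩
      linarith)
    have h5 : s.im / R ≤ 1 := by rw [div_le_iff₀ hR]; linarith
    have h6 : 0 ≤ s.im / R := div_nonneg hy1 hR.le
    rw [hB, Complex.frontier_reProdIm, closure_Ioo (by linarith), closure_Ioo (by linarith), frontier_Ioo (by linarith), frontier_Ioo (by linarith)] at hs
    rw [hPre]
    rcases hs with ⟨ha, hb⟩ | ⟨ha, hb⟩
    · have hb : s.im ∈ ({0, R} : Set ℝ) := hb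
      rcases hb with hb | hb
      · rw [h0 s hb.le, hb]
        simp
        positivity
      · have hb : s.im = R := hb
        have h6 : s.im / R = 1 := by rw [hb]; field_simp
        rw [h6]
        have : 0 ≤ M * ((s.re - z.re) / R) ^ 2 := by positivity
        nlinarith
    · have ha : s.re ∈ ({z.re - R, z.re + R} : Set ℝ) := ha
      have h3 : ((s.re - z.re) / R) ^ 2 = 1 := by
        rcases ha with ha | ha
        · rw [ha]; field_simp; ring
        · have ha : s.re = z.re + R := ha
          rw [ha]; field_simp; ring
      rw [h3]
      have : 1 ≤ 3 * (s.im / R) + 1 - (s.im / R) ^ 2 := by nlinarith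
      nlinarith
  · rw [hBcl]
    exact ⟨⟨by linarith, by linarith⟩, hy, by linarith⟩

theorem linear_halfplane {u : ℂ → ℝ} (h : GLF univ u) (h0 : ∀ z : ℂ, z.im ≤ 0 → u z = 0)
    (hp : ∀ z : ℂ, 0 < z.im → 0 < u z) : ∃ a : ℝ, 0 < a ∧ ∀ z : ℂ, 0 ≤ z.im → u z = a * z.im := by
  have hZ : {z : ℂ | z ∈ univ ∧ u z = 0} = {z | z.im ≤ 0} := by
    ext z
    constructor
    · rintro ⟨_, hz⟩
      by_contra hc
      exact (hp z (not_le.1 hc)).ne' hz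
    · intro hz; exact ⟨mem_univ _, h0 z hz⟩
  have hfr : frontier {z : ℂ | z ∈ univ ∧ u z = 0} = {z | z.im = 0} := by
    rw [hZ, Complex.frontier_setOf_im_le]
  obtain ⟨C, hC1, hC⟩ := doubling
  have hc : Continuous u := continuousOn_univ.1 h.cont
  have hhopf := fun {R : ℝ} (hR : 0 < R) {z : ℂ} => hopf (v := u) hc.continuousOn (fun z _ => h.nonneg z (mem_univ _))
    (fun z hz => h.harm z (mem_univ _) (hp z hz)) (R := R) hR (z := z)
  have hI : 0 < u Complex.I := hp _ (by simp)
  have hgrow : ∀ R : ℝ, 16 ≤ R → u (R * Complex.I) ≤ 8 * R * u Complex.I := by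
    intro R hR
    have := hhopf (R := R / 8) (by linarith) (z := Complex.I) (by simp) (by simp; linarith) (by simp; linarith)
    have e : 8 * ((R / 8 : ℝ) : ℂ) * Complex.I = R * Complex.I := by push_cast; ring
    rw [e] at this
    simp at this
    nlinarith
  have hupper : ∀ z : ℂ, 0 ≤ z.im → u z ≤ (24 * C * u Complex.I) * z.im := by
    intro z hz
    set R := max 16 (max |z.re| z.im) with hR
    have hR16 : 16 ≤ R := le_max_left _ _
    have hR1 : |z.re| ≤ R := (le_max_left _ _).trans (le_max_right _ _)
    have hR2 : z.im ≤ R := (le_max_right _ _).trans (le_max_right _ _)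
    have hR0 : 0 < R := by linarith
    have hn2 : ‖(2 * R : ℂ)‖ = 2 * R := by
      rw [norm_mul, Complex.norm_real, Real.norm_of_nonneg hR0.le]; simp
    have hRI : 0 < u (R * Complex.I) := hp _ (by simp; linarith)
    have hM : ∀ s : ℂ, ‖s‖ ≤ 4 * R → u s ≤ C * u (R * Complex.I) := by
      intro s hs
      refine hC univ 0 (2 * R) u _ h ?_ hRI (subset_univ _) ?_ ?_ ?_ ?_ s ?_
      · rw [← norm_pos_iff, hn2]; positivity
      · rw [hfr]; simp
      · rw [hfr]
        intro e he e' he' _ _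
        have h1 : ((e - e') / (2 * R)).im = 0 := by
          have : (2 * R : ℂ) = ((2 * R : ℝ) : ℂ) := by push_cast; rfl
          rw [this, Complex.div_ofReal_im, Complex.sub_im]
          have he : e.im = 0 := he
          have he' : e'.im = 0 := he'
          simp [he, he']
        rw [h1, abs_zero]; positivity
      · apply le_of_eq; congr 1; ring
      · rw [h0 _ (by simp; linarith)]; exact hRI.le
      · rw [hn2, sub_zero]; linarith
    have := upper_box h h0 hR0 hM hz hR1 hR2
    have h3 := hgrow R hR16
    calc u z ≤ 3 * (C * u (R * Complex.I)) * (z.im / R) := this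
      _ ≤ 3 * (C * (8 * R * u Complex.I)) * (z.im / R) := by gcongr
      _ = _ := by field_simp; ring
  set T : Set ℝ := (fun z : ℂ => u z / z.im) '' {z | 0 < z.im} with hT
  have hTne : T.Nonempty := ⟨_, Complex.I, by simp, rfl⟩
  have hTa : BddAbove T := ⟨24 * C * u Complex.I, by
    rintro _ ⟨z, hz, rfl⟩
    have hz : 0 < z.im := hz
    simp only
    rw [div_le_iff₀ hz]; exact hupper z hz.le⟩
  have hTb : BddBelow T := ⟨0, by
    rintro _ ⟨z, hz, rfl⟩
    exact div_nonneg (h.nonneg z (mem_univ _)) (le_of_lt hz)⟩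
  set α := sInf T
  set β := sSup T
  have hα : ∀ z : ℂ, 0 ≤ z.im → α * z.im ≤ u z := by
    intro z hz
    rcases hz.eq_or_lt with hz | hz
    · rw [← hz, h0 z hz.ge]; simp
    · rw [← le_div_iff₀ hz]; exact csInf_le hTb ⟨z, hz, rfl⟩
  have hβ : ∀ z : ℂ, 0 ≤ z.im → u z ≤ β * z.im := by
    intro z hz
    rcases hz.eq_or_lt with hz | hz
    · rw [← hz, h0 z hz.ge]; simp
    · rw [← div_le_iff₀ hz]; exact le_csSup hTa ⟨z, hz, rfl⟩
  have himh : ∀ (c : ℝ) (z : ℂ), HarmonicAt (fun z : ℂ => c * z.im) z := by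
    intro c z
    have : (fun z : ℂ => c * z.im) = fun z => ((-c * Complex.I) * z).re := by
      funext z; simp
    rw [this]
    exact AnalyticAt.harmonicAt_re (by fun_prop)
  have hαβ : β ≤ α := by
    by_contra hcon
    push Not at hcon
    have hv := fun {R : ℝ} (hR : 0 < R) {z : ℂ} => hopf (v := fun z => u z - α * z.im) (by fun_prop)
      (fun z hz => by linarith [hα z hz])
      (fun z hz => harmAt_sub (h.harm z (mem_univ _) (hp z hz)) (himh α z)) (R := R) hR (z := z)
    have hw := fun {R : ℝ} (hR : 0 < R) {z : ℂ} => hopf (v := fun z => β * z.im - u z) (by fun_prop)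
      (fun z hz => by linarith [hβ z hz])
      (fun z hz => harmAt_sub (himh β z) (h.harm z (mem_univ _) (hp z hz))) (R := R) hR (z := z)
    by_cases hcase : ∀ N : ℝ, ∃ R ≥ N, 4 * R * (β - α) ≤ u (8 * R * Complex.I) - α * (8 * R)
    · have : α + (β - α) / 15 ≤ α := by
        refine le_csInf hTne ?_
        rintro _ ⟨z, hz, rfl⟩
        have hz : 0 < z.im := hz
        simp only
        rw [le_div_iff₀ hz]
        obtain ⟨R, hR, hR'⟩ := hcase (max 1 (max |z.re| (2 * z.im)))
        have hR0 : 0 < R := by linarith [(le_max_left _ _).trans hR]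
        have h1 := hv hR0 hz.le (((le_max_left _ _).trans (le_max_right _ _)).trans hR)
          (((le_max_right _ _).trans (le_max_right _ _)).trans hR)
        have e : (8 * (R:ℂ) * Complex.I).im = 8 * R := by simp
        simp only [e] at h1
        have h2 : 4 * R * (β - α) * z.im ≤ 60 * R * (u z - α * z.im) := (by gcongr : _ ≤ _).trans h1
        have h3 : 4 * (β - α) * z.im ≤ 60 * (u z - α * z.im) := by
          refine le_of_mul_le_mul_left ?_ hR0
          linarith
        linarith
      linarith
    · push Not at hcase
      obtain ⟨N, hN⟩ := hcase
      have : β ≤ β - (β - α) / 15 := by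
        refine csSup_le hTne ?_
        rintro _ ⟨z, hz, rfl⟩
        have hz : 0 < z.im := hz
        simp only
        rw [div_le_iff₀ hz]
        set R := max N (max 1 (max |z.re| (2 * z.im))) with hR'
        have hR : max 1 (max |z.re| (2 * z.im)) ≤ R := le_max_right _ _
        have hR0 : 0 < R := by linarith [(le_max_left _ _).trans hR]
        have h1 := hw hR0 hz.le (((le_max_left _ _).trans (le_max_right _ _)).trans hR)
          (((le_max_right _ _).trans (le_max_right _ _)).trans hR)
        have e : (8 * (R:ℂ) * Complex.I).im = 8 * R := by simp
        simp only [e] at h1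
        have h4 := hN R (le_max_left _ _)
        have h5 : 4 * R * (β - α) ≤ β * (8 * R) - u (8 * R * Complex.I) := by linarith
        have h2 : 4 * R * (β - α) * z.im ≤ 60 * R * (β * z.im - u z) := (by gcongr : _ ≤ _).trans h1
        have h3 : 4 * (β - α) * z.im ≤ 60 * (β * z.im - u z) := by
          refine le_of_mul_le_mul_left ?_ hR0
          linarith
        linarith
      linarith
  have hlin : ∀ z : ℂ, 0 ≤ z.im → u z = β * z.im := by
    intro z hz
    refine le_antisymm (hβ z hz) ((mul_le_mul_of_nonneg_right hαβ hz).trans (hα z hz))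
  refine ⟨β, ?_, hlin⟩
  have := hlin Complex.I (by simp)
  simp at this
  rw [← this]; exact hI

end Part08

section Part09

open InnerProductSpace

theorem deriv_re_pos {H : ℂ → ℂ} {w : ℂ} {r : ℝ} (hr : 0 < r) (hH : DifferentiableOn ℂ H (Metric.ball w r))
    (hpos : ∀ z ∈ Metric.ball w r, 0 < (H z).re) : ‖deriv H w‖ * r ≤ 2 * (H w).re := by
  have hw : w ∈ Metric.ball w r := Metric.mem_ball_self hr
  set b : ℂ := (starRingEnd ℂ) (H w) with hb
  have hne : ∀ z ∈ Metric.ball w r, H z + b ≠ 0 := by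
    intro z hz h0
    have := congrArg Complex.re h0
    simp [hb] at this
    have := hpos z hz
    have := hpos w hw
    linarith
  have key : ∀ z ∈ Metric.ball w r, ‖(H z - H w)‖ ≤ ‖H z + b‖ := by
    intro z hz
    have h1 := hpos z hz
    have h2 := hpos w hw
    rw [← sq_le_sq₀ (norm_nonneg _) (norm_nonneg _), Complex.sq_norm, Complex.sq_norm,
      Complex.normSq_apply, Complex.normSq_apply]
    simp [hb]
    nlinarith
  have hS := Complex.norm_deriv_le_div_of_mapsTo_ball (R₁ := r) (R₂ := 1)
    (f := fun z => (H z - H w) / (H z + b)) (c := w) 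
    ((hH.sub_const _).div (hH.add_const _) hne) (by
      intro z hz
      simp only [sub_self, zero_div, mem_closedBall_iff_norm, sub_zero, norm_div]
      exact div_le_one_of_le₀ (key z hz) (norm_nonneg _)) hr
  have hHd : HasDerivAt H (deriv H w) w := (hH.differentiableAt (Metric.isOpen_ball.mem_nhds hw)).hasDerivAt
  have h1 := ((hHd.sub_const (H w)).div (hHd.add_const b) (hne w hw)).deriv
  have h1' : deriv (fun z => (H z - H w) / (H z + b)) w = (deriv H w * (H w + b) - (H w - H w) * deriv H w) / (H w + b) ^ 2 := h1
  rw [h1'] at hS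
  have h2 : H w + b = ((2 * (H w).re : ℝ) : ℂ) := by
    rw [hb, Complex.add_conj]
  have hp := hpos w hw
  have h3 : (deriv H w * (H w + b) - (H w - H w) * deriv H w) / (H w + b) ^ 2 = deriv H w / (H w + b) := by
    have := hne w hw
    field_simp; ring
  rw [h3, h2, norm_div, Complex.norm_real, Real.norm_of_nonneg (by positivity), div_le_div_iff₀ (by positivity) hr] at hS
  linarith

theorem exp_lemma {X : ℂ → ℂ} (hX : Differentiable ℂ X) {D M c c1 C : ℝ} (hD : 0 < D) 
    (hM : ∀ s : ℂ, ‖X s‖ ≤ M * Real.exp (D * max s.im 0))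
    (h2 : ∀ s : ℂ, c1 ≤ s.im → 1 ≤ ‖X s‖ ∧ |Real.log ‖X s‖ - D * s.im - c| ≤ C / ‖X s‖) :
    ∃ κ k : ℂ, κ ≠ 0 ∧ ∀ s, X s = κ * Complex.exp (-(Complex.I * D * s)) + k := by
  have hM0 : 0 ≤ M := by
    have := (norm_nonneg _).trans (hM 0)
    simpa using this
  have hC0 : 0 ≤ C := by
    have h := h2 (c1 * Complex.I) (by simp)
    have h' := (abs_nonneg _).trans h.2
    by_contra hc
    have : C / ‖X (c1 * Complex.I)‖ < 0 := div_neg_of_neg_of_pos (not_le.1 hc) (by linarith [h.1])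
    linarith
  have hlow : ∀ s : ℂ, c1 ≤ s.im → Real.exp (D * s.im + c - C) ≤ ‖X s‖ := by
    intro s hs
    obtain ⟨ha, hb⟩ := h2 s hs
    have h3 : C / ‖X s‖ ≤ C := div_le_self hC0 ha
    rw [← Real.le_log_iff_exp_le (by linarith)]
    linarith [(abs_le.1 hb).1]
  set C3 : ℝ := C * Real.exp (C - c) * Real.exp C + 1 with hC3
  have hC3p : 0 < C3 := by positivity
  set Y : ℂ → ℂ := fun s => X s * Complex.exp (Complex.I * D * s - c) with hY
  have hYd : Differentiable ℂ Y := by simp only [hY]; fun_prop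
  have hYn : ∀ s, ‖Y s‖ = ‖X s‖ * Real.exp (-(D * s.im) - c) := by
    intro s
    simp only [hY, norm_mul, Complex.norm_exp]
    congr 2
    simp
  have hY1 : ∀ s : ℂ, c1 ≤ s.im → |‖Y s‖ - 1| ≤ C3 * Real.exp (-(D * s.im)) := by
    intro s hs
    obtain ⟨ha, hb⟩ := h2 s hs
    set t := Real.log ‖X s‖ - D * s.im - c with ht
    have e1 : ‖Y s‖ = Real.exp t := by
      have e0 : t = Real.log ‖X s‖ + (-(D * s.im) - c) := by rw [ht]; ring
      rw [hYn, e0, Real.exp_add, Real.exp_log (by linarith)]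
    have h3 : |t| ≤ C := hb.trans (div_le_self hC0 ha)
    have h4 : |t| ≤ C * Real.exp (C - c) * Real.exp (-(D * s.im)) := by
      refine hb.trans ?_
      rw [mul_assoc, ← Real.exp_add, div_eq_mul_inv]
      gcongr
      rw [inv_le_comm₀ (by linarith) (Real.exp_pos _), ← Real.exp_neg]
      refine le_trans (le_of_eq ?_) (hlow s hs)
      congr 1; ring
    have h5 : |Real.exp t - 1| ≤ |t| * Real.exp |t| := by
      rcases le_total 0 t with h | h
      · rw [abs_of_nonneg h, abs_of_nonneg (by linarith [Real.one_le_exp h])]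
        have := Real.add_one_le_exp (-t)
        have h6 : Real.exp t * Real.exp (-t) = 1 := by rw [← Real.exp_add]; simp
        nlinarith [Real.exp_pos t]
      · rw [abs_of_nonpos h, abs_of_nonpos (by linarith [Real.exp_le_one_iff.2 h])]
        have := Real.add_one_le_exp t
        have := Real.one_le_exp (neg_nonneg.2 h)
        nlinarith
    rw [e1]
    calc _ ≤ |t| * Real.exp |t| := h5
      _ ≤ (C * Real.exp (C - c) * Real.exp (-(D * s.im))) * Real.exp C := by gcongr
      _ ≤ C3 * Real.exp (-(D * s.im)) := by
        rw [hC3]; nlinarith [Real.exp_pos (-(D * s.im))]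
  have hY2 : ∀ s : ℂ, c1 + 1 ≤ s.im → ‖deriv Y s‖ ≤ 6 * (C3 * Real.exp D * Real.exp (-(D * s.im))) := by
    intro s hs
    set δ := C3 * Real.exp D * Real.exp (-(D * s.im)) with hδ
    have hδ0 : 0 < δ := by positivity
    have hb : ∀ z ∈ Metric.ball s 1, |‖Y z‖ - 1| ≤ δ := by
      intro z hz
      rw [mem_ball_iff_norm] at hz
      have := (abs_lt.1 ((Complex.abs_im_le_norm _).trans_lt hz)).1
      rw [Complex.sub_im] at this
      refine (hY1 z (by linarith)).trans ?_
      rw [hδ, mul_assoc, ← Real.exp_add]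
      gcongr
      nlinarith
    have hYs : Y s ≠ 0 := by
      have := (h2 s (by linarith)).1
      rw [← norm_pos_iff, hYn]
      have := Real.exp_pos (-(D * s.im) - c)
      nlinarith
    set ω : ℂ := (starRingEnd ℂ) (Y s) / ‖Y s‖ with hω
    have hωn : ‖ω‖ = 1 := by simp [hω, hYs]
    have hωY : ω * Y s = ‖Y s‖ := by
      rw [hω, div_mul_eq_mul_div, mul_comm, Complex.mul_conj, Complex.normSq_eq_norm_sq]
      have : (‖Y s‖ : ℂ) ≠ 0 := by simpa using hYs
      field_simp; push_cast; ring
    have h3 := deriv_re_pos (H := fun z => ((1 + 2 * δ : ℝ):ℂ) - ω * Y z) (w := s) one_pos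
      (by fun_prop) (by
        intro z hz
        have h4 := (abs_le.1 (hb z hz)).2
        have h5 := Complex.re_le_norm (ω * Y z)
        rw [norm_mul, hωn, one_mul] at h5
        rw [Complex.sub_re, Complex.ofReal_re]
        linarith)
    simp only [hωY, mul_one, deriv_const_sub, norm_neg, deriv_const_mul _ hYd.differentiableAt, norm_mul, hωn, one_mul] at h3
    rw [← Complex.ofReal_sub, Complex.ofReal_re] at h3
    have h4 := (abs_le.1 (hb s (by simp))).1
    linarith
  set Q : ℂ → ℂ := fun s => deriv X s + Complex.I * D * X s with hQ
  have hXd : Differentiable ℂ (deriv X) := by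
    rw [← differentiableOn_univ]
    exact hX.differentiableOn.deriv isOpen_univ
  have hQd : Differentiable ℂ Q := by simp only [hQ]; fun_prop
  have hYQ : ∀ s, deriv Y s = Q s * Complex.exp (Complex.I * D * s - c) := by
    intro s
    have h3 : HasDerivAt (fun s : ℂ => Complex.exp (Complex.I * D * s - c)) (Complex.exp (Complex.I * D * s - c) * (Complex.I * D * 1)) s :=
      (((hasDerivAt_id s).const_mul (Complex.I * D)).sub_const (c:ℂ)).cexp
    have := ((hX s).hasDerivAt.mul h3).deriv
    have e : deriv Y s = deriv X s * Complex.exp (Complex.I * D * s - c) + X s * (Complex.exp (Complex.I * D * s - c) * (Complex.I * D * 1)) := this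
    rw [e]; simp only [hQ]; ring
  have hQb : ∀ s, ‖Q s‖ ≤ max (6 * C3 * Real.exp D * Real.exp c) (M * Real.exp (D * max (c1 + 2) 0) * (1 + D)) := by
    intro s
    by_cases hs : c1 + 1 ≤ s.im
    · refine le_trans ?_ (le_max_left _ _)
      have h3 := hY2 s hs
      rw [hYQ, norm_mul, Complex.norm_exp] at h3
      have e : (Complex.I * D * s - c).re = -(D * s.im) - c := by simp
      rw [e, sub_eq_add_neg, Real.exp_add] at h3
      have h4 := Real.exp_pos (-(D * s.im))
      have h5 : Real.exp (-c) * Real.exp c = 1 := by rw [← Real.exp_add]; simp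
      have h6 : ‖Q s‖ * Real.exp (-c) ≤ 6 * C3 * Real.exp D := by
        refine le_of_mul_le_mul_right ?_ h4
        linarith
      calc ‖Q s‖ = ‖Q s‖ * Real.exp (-c) * Real.exp c := by rw [mul_assoc, h5, mul_one]
        _ ≤ _ := by gcongr
    · refine le_trans ?_ (le_max_right _ _)
      push Not at hs
      have hb : ∀ z : ℂ, z.im ≤ c1 + 2 → ‖X z‖ ≤ M * Real.exp (D * max (c1 + 2) 0) := by
        intro z hz
        refine (hM z).trans ?_
        gcongr
      have h3 := Complex.norm_deriv_le_of_forall_mem_sphere_norm_le (c := s) (R := 1) one_pos hX.diffContOnCl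
        (C := M * Real.exp (D * max (c1 + 2) 0)) (by
          intro z hz
          apply hb
          rw [mem_sphere_iff_norm] at hz
          have := (abs_le.1 ((Complex.abs_im_le_norm _).trans hz.le)).2
          rw [Complex.sub_im] at this
          linarith)
      have h4 := hb s (by linarith)
      refine (norm_add_le _ _).trans ?_
      rw [norm_mul, norm_mul, Complex.norm_I, Complex.norm_real, Real.norm_of_nonneg hD.le, one_mul]
      rw [div_one] at h3
      nlinarith
  have hQc : ∀ s, Q s = Q 0 := fun s => hQd.apply_eq_apply_of_bounded (isBounded_iff_forall_norm_le.2 ⟨_, by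
    rintro _ ⟨s, rfl⟩; exact hQb s⟩) s 0
  have hDc : (Complex.I * D : ℂ) ≠ 0 := by simp [hD.ne']
  set k : ℂ := Q 0 / (Complex.I * D) with hk
  set W : ℂ → ℂ := fun s => (X s - k) * Complex.exp (Complex.I * D * s) with hW
  have hWd : Differentiable ℂ W := by simp only [hW]; fun_prop
  have hW0 : ∀ s, deriv W s = 0 := by
    intro s
    have h3 : HasDerivAt (fun s : ℂ => Complex.exp (Complex.I * D * s)) (Complex.exp (Complex.I * D * s) * (Complex.I * D * 1)) s :=
      (((hasDerivAt_id s).const_mul (Complex.I * D))).cexp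
    have := (((hX s).hasDerivAt.sub_const k).mul h3).deriv
    have e : deriv W s = deriv X s * Complex.exp (Complex.I * D * s) + (X s - k) * (Complex.exp (Complex.I * D * s) * (Complex.I * D * 1)) := this
    have h4 := hQc s
    have h5 : Complex.I * D * k = Q 0 := by rw [hk]; exact mul_div_cancel₀ _ hDc
    rw [e]
    have h6 : deriv X s = Q 0 - Complex.I * D * X s := by rw [← h4]; simp only [hQ]; ring
    rw [h6, ← h5]; ring
  have hWc := is_const_of_deriv_eq_zero hWd hW0
  have hXf : ∀ s, X s = W 0 * Complex.exp (-(Complex.I * D * s)) + k := by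
    intro s
    rw [← hWc s 0]
    simp only [hW]
    rw [mul_assoc, ← Complex.exp_add]
    simp
  refine ⟨W 0, k, ?_, hXf⟩
  intro h0
  set y : ℝ := max c1 ((‖k‖ + 1 - c + C) / D) with hy
  have h3 := hlow (y * Complex.I) (by simp [hy])
  rw [hXf, h0] at h3
  simp at h3
  have h4 := Real.add_one_le_exp (D * y + c - C)
  have h5 : (‖k‖ + 1 - c + C) / D ≤ y := le_max_right _ _
  rw [div_le_iff₀ hD] at h5
  linarith

end Part09

section Part10

open InnerProductSpace

variable {F S : ℂ × ℂ → ℂ × ℂ} {d : ℕ} {R : ℝ}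

theorem Cl.aff {g : ℂ → ℂ × ℂ} (h : Cl F S d R g) (t b : ℝ) (hb : b ≠ 0) :
    Cl F S d R (fun s => g (t + b * s)) := by
  have hbc : (b : ℂ) ≠ 0 := by exact_mod_cast hb
  have hsol : ∀ s : ℂ, (t : ℂ) + b * ((s - t) / b) = s := fun s => by
    rw [mul_div_cancel₀ _ hbc]; ring
  refine ⟨h.diff.comp (by fun_prop), fun m s => h.back m _, ?_, ?_, ?_⟩
  · obtain ⟨s, hs⟩ := h.zero
    exact ⟨(s - t) / b, by rw [hsol]; exact hs⟩
  · obtain ⟨s, hs⟩ := h.pos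
    exact ⟨(s - t) / b, by rw [hsol]; exact hs⟩
  · intro s hs
    have := h.fr _ ((mem_frontier_aff (t:ℂ) hbc (P := fun z => Gr F d R (g z) = 0)).1 hs)
    simpa [hb] using this

theorem HSys.Cl_iter (H : HSys F S d R) {g : ℂ → ℂ × ℂ} (h : Cl F S d R g) (k : ℕ) :
    Cl F S d R (fun s => F^[k] (g s)) := by
  have hG : ∀ s, Gr F d R (F^[k] (g s)) = d ^ k * Gr F d R (g s) := fun s => H.G_iter _ k
  have hdk : (0:ℝ) < d ^ k := pow_pos H.d0 k
  refine ⟨(H.st.diff.iterate k).comp h.diff, fun m s => ?_, ?_, ?_, ?_⟩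
  · rcases le_total m k with hm | hm
    · rw [H.SF hm]; exact H.CViter (h.back 0 s) _
    · obtain ⟨j, rfl⟩ := Nat.exists_eq_add_of_le hm
      rw [add_comm, iterate_add_apply, H.SF le_rfl]
      simpa using h.back j s
  · obtain ⟨s, hs⟩ := h.zero
    exact ⟨s, by rw [hG, hs, mul_zero]⟩
  · obtain ⟨s, hs⟩ := h.pos
    exact ⟨s, by rw [hG]; positivity⟩
  · intro s hs
    refine h.fr s ?_
    have : {s | Gr F d R (F^[k] (g s)) = 0} = {s | Gr F d R (g s) = 0} := by
      ext s
      simp only [mem_setOf_eq]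
      rw [hG]; simp [hdk.ne']
    rwa [this] at hs

theorem poly_lower (p : Polynomial ℂ) (hp : 2 ≤ p.natDegree) : ∃ c : ℝ, 0 < c ∧ ∀ A : ℝ, ∃ K : ℝ,
    ∀ z : ℂ, c * ‖z‖ ^ 2 + A * ‖z‖ - K ≤ ‖p.eval z‖ := by
  obtain ⟨B, hB0, hB⟩ := poly_bound p hp
  have hb : 0 < ‖p.leadingCoeff‖ := by
    rw [norm_pos_iff, Polynomial.leadingCoeff_ne_zero]
    rintro rfl; simp at hp
  set b := ‖p.leadingCoeff‖ with hbd
  have h1 : ∀ z : ℂ, b * ‖z‖ ^ 2 - B * ‖z‖ - b ≤ ‖p.eval z‖ := by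
    intro z
    have hz0 := norm_nonneg z
    have hpz := norm_nonneg (p.eval z)
    rcases le_total 1 ‖z‖ with hz | hz
    · by_cases hn : b * ‖z‖ ≤ B
      · nlinarith
      · push Not at hn
        have e1 : b * ‖z‖ ^ p.natDegree = ‖p.leadingCoeff * z ^ p.natDegree‖ := by
          rw [norm_mul, norm_pow]
        have e2 := norm_sub_norm_le (p.leadingCoeff * z ^ p.natDegree) (p.leadingCoeff * z ^ p.natDegree - p.eval z)
        rw [sub_sub_cancel, norm_sub_rev _ (p.eval z), ← e1] at e2
        have e3 := hB z hz
        obtain ⟨m, hm⟩ : ∃ m, p.natDegree = m + 2 := ⟨p.natDegree - 2, by omega⟩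
        rw [hm] at e2 e3
        simp only [show m + 2 - 1 = m + 1 by omega] at e3
        rw [pow_succ] at e2
        have e4 : ‖z‖ ≤ ‖z‖ ^ (m + 1) := by
          conv_lhs => rw [← pow_one ‖z‖]
          exact pow_le_pow_right₀ hz (by omega)
        nlinarith
    · have : ‖z‖ ^ 2 ≤ 1 := by nlinarith
      nlinarith
  refine ⟨b / 2, by positivity, fun A => ⟨b + (A + B) ^ 2 / (2 * b), fun z => ?_⟩⟩
  refine le_trans ?_ (h1 z)
  have : (A + B) ^ 2 / (2 * b) = (A + B) ^ 2 / b / 2 := by field_simp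
  have h3 : (A + B) ^ 2 / b + b * ‖z‖ ^ 2 - 2 * (A + B) * ‖z‖ = (b * ‖z‖ - (A + B)) ^ 2 / b := by
    field_simp; ring
  have h4 : 0 ≤ (b * ‖z‖ - (A + B)) ^ 2 / b := by positivity
  rw [this]
  nlinarith

/-- algebraic end of the no-interior lemma -/
theorem exp_contra {p1 p2 : Polynomial ℂ} {a1 a2 : ℂ} (h1 : 2 ≤ p1.natDegree) (h2 : 2 ≤ p2.natDegree)
    (ha1 : a1 ≠ 0) {R : ℝ} {x y : ℂ → ℂ} {D : ℝ} (hD : 0 < D)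
    (hrel : ∀ s, ∃ y' y'' : ℂ, x s = p1.eval (y s) - a1 * y' ∧ y s = p2.eval y' - a2 * y'' ∧
      3 * ‖y''‖ ≤ max R ‖y'‖) {κ k κ' k' : ℂ} (hκ' : κ' ≠ 0)
    (hx : ∀ s, x s = κ * Complex.exp (-(Complex.I * ((p1.natDegree * D : ℝ) : ℂ) * s)) + k)
    (hy : ∀ s, y s = κ' * Complex.exp (-(Complex.I * D * s)) + k') : False := by
  choose y' y'' hxr hyr hy'' using hrel
  set P : Polynomial ℂ := p1.comp (Polynomial.C κ' * Polynomial.X + Polynomial.C k') -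
    Polynomial.C κ * Polynomial.X ^ p1.natDegree - Polynomial.C k with hP
  have hDc : (D:ℂ) ≠ 0 := by exact_mod_cast hD.ne'
  have hE : ∀ w : ℂ, w ≠ 0 → ∃ s, Complex.exp (-(Complex.I * D * s)) = w := by
    intro w hw
    refine ⟨Complex.I * Complex.log w / D, ?_⟩
    have : -(Complex.I * D * (Complex.I * Complex.log w / D)) = Complex.log w := by
      field_simp
      rw [Complex.I_sq]; ring
    rw [this, Complex.exp_log hw]
  have hPe : ∀ s, a1 * y' s = P.eval (Complex.exp (-(Complex.I * D * s))) := by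
    intro s
    have e1 : a1 * y' s = p1.eval (y s) - x s := by rw [hxr s]; ring
    rw [e1, hx, hy]
    simp only [hP, Polynomial.eval_sub, Polynomial.eval_comp, Polynomial.eval_add, Polynomial.eval_mul,
      Polynomial.eval_C, Polynomial.eval_X, Polynomial.eval_pow]
    rw [← Complex.exp_nat_mul]
    push_cast
    have : (p1.natDegree : ℂ) * -(Complex.I * D * s) = -(Complex.I * (p1.natDegree * D) * s) := by ring
    rw [this]; ring
  have hy''b : ∀ s, ‖y'' s‖ ≤ |R| + ‖y' s‖ := by
    intro s
    have := hy'' s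
    have h3 : max R ‖y' s‖ ≤ |R| + ‖y' s‖ := max_le (by linarith [le_abs_self R, norm_nonneg (y' s)]) (by linarith [abs_nonneg R])
    linarith [norm_nonneg (y'' s)]
  -- quadratic bound
  obtain ⟨c, hc, hlow⟩ := poly_lower p2 h2
  obtain ⟨K, hK⟩ := hlow ‖a2‖
  have hquad : ∀ s, c * ‖y' s‖ ^ 2 ≤ ‖y s‖ + K + ‖a2‖ * |R| := by
    intro s
    have e1 := hK (y' s)
    have e2 : ‖p2.eval (y' s)‖ ≤ ‖y s‖ + ‖a2‖ * ‖y'' s‖ := by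
      have : p2.eval (y' s) = y s + a2 * y'' s := by rw [hyr s]; ring
      rw [this, ← norm_mul]; exact norm_add_le _ _
    have e3 : ‖a2‖ * ‖y'' s‖ ≤ ‖a2‖ * (|R| + ‖y' s‖) := by gcongr; exact hy''b s
    nlinarith
  have ha1p : 0 < ‖a1‖ := norm_pos_iff.2 ha1
  -- degree zero
  have hdeg : P.natDegree = 0 := by
    by_contra hne
    have hdeg2 : 2 ≤ (P * P).natDegree := by
      have hP0 : P ≠ 0 := by rintro h0; rw [h0] at hne; simp at hne
      rw [Polynomial.natDegree_mul hP0 hP0]; omega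
    obtain ⟨c', hc', hlow'⟩ := poly_lower _ hdeg2
    set N := ‖a1‖ ^ 2 / c with hN
    have hNp : 0 < N := by positivity
    obtain ⟨K', hK'⟩ := hlow' (N * ‖κ'‖)
    set Z := ‖k'‖ + K + ‖a2‖ * |R| with hZ
    -- choose w large
    set r : ℝ := 1 + |K' + N * Z| / c' with hr
    have hr1 : 1 ≤ r := by rw [hr]; linarith [div_nonneg (abs_nonneg (K' + N * Z)) hc'.le]
    obtain ⟨s, hs⟩ := hE (r : ℂ) (by norm_cast; linarith)
    have e1 := hK' (r:ℂ)
    rw [Polynomial.eval_mul, ← hs, ← hPe, norm_mul, norm_mul, hs] at e1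
    have e2 := hquad s
    have e3 : ‖y s‖ ≤ ‖κ'‖ * r + ‖k'‖ := by
      rw [hy, hs]
      refine (norm_add_le _ _).trans ?_
      rw [norm_mul, Complex.norm_real, Real.norm_of_nonneg (by linarith : (0:ℝ) ≤ r)]
    rw [Complex.norm_real, Real.norm_of_nonneg (by linarith : (0:ℝ) ≤ r)] at e1
    have e4 : ‖a1‖ * ‖y' s‖ * (‖a1‖ * ‖y' s‖) = N * (c * ‖y' s‖ ^ 2) := by
      rw [hN]; field_simp
    rw [e4] at e1
    have e5 : N * (c * ‖y' s‖ ^ 2) ≤ N * (‖κ'‖ * r + Z) := by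
      gcongr; rw [hZ]; linarith
    have e6 : c' * r ^ 2 ≤ K' + N * Z := by nlinarith
    have e7 : c' * r = c' + |K' + N * Z| := by rw [hr]; field_simp
    have e8 := le_abs_self (K' + N * Z)
    have e9 : c' * r ≤ c' * r ^ 2 := by gcongr; nlinarith
    linarith
  -- y bounded
  rw [Polynomial.natDegree_eq_zero] at hdeg
  obtain ⟨e, he⟩ := hdeg
  have hy'c : ∀ s, y' s = e / a1 := by
    intro s
    rw [eq_div_iff ha1, mul_comm, hPe, ← he]; simp
  set Bd := ‖p2.eval (e / a1)‖ + ‖a2‖ * (|R| + ‖e / a1‖) with hBd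
  have hyb : ∀ s, ‖y s‖ ≤ Bd := by
    intro s
    rw [hyr s, hy'c s]
    refine (norm_sub_le _ _).trans ?_
    rw [norm_mul, hBd]
    have := hy''b s
    rw [hy'c s] at this
    gcongr
  have hBd0 : 0 ≤ Bd := (norm_nonneg _).trans (hyb 0)
  have hκp : 0 < ‖κ'‖ := norm_pos_iff.2 hκ'
  set r : ℝ := (Bd + ‖k'‖ + 1) / ‖κ'‖ with hr
  have hrp : 0 < r := by positivity
  obtain ⟨s, hs⟩ := hE (r : ℂ) (by exact_mod_cast hrp.ne')
  have e1 := hyb s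
  rw [hy, hs] at e1
  have e2 := norm_sub_le (κ' * (r:ℂ) + k') k'
  rw [add_sub_cancel_right, norm_mul, Complex.norm_real, Real.norm_of_nonneg hrp.le] at e2
  have e3 : ‖κ'‖ * r = Bd + ‖k'‖ + 1 := by rw [hr]; field_simp
  linarith

theorem HSys.no_half (H : HSys F S d R) {g : ℂ → ℂ × ℂ} (h : Cl F S d R g)
    (h0 : ∀ s : ℂ, s.im ≤ 0 → Gr F d R (g s) = 0) (hp : ∀ s : ℂ, 0 < s.im → 0 < Gr F d R (g s)) : False := by
  have hR := H.hR
  obtain ⟨a, ha, hlin⟩ := linear_halfplane (H.isGLF isOpen_univ h.diff.differentiableOn) h0 hp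
  have hu : ∀ s : ℂ, Gr F d R (g s) = a * max s.im 0 := by
    intro s
    rcases le_total 0 s.im with hs | hs
    · rw [max_eq_left hs]; exact hlin s hs
    · rw [max_eq_right hs, mul_zero]; exact h0 s hs
  obtain ⟨C1, hC1, hell⟩ := H.G_ell
  obtain ⟨c0, C2, hC2, hGV⟩ := H.G_V
  have hCV : ∀ s, g s ∈ CV R := fun s => h.back 0 s
  set x : ℂ → ℂ := fun s => (g s).1 with hx
  set y : ℂ → ℂ := fun s => (g s).2 with hy
  have hxd : Differentiable ℂ x := h.diff.fst
  have hyd : Differentiable ℂ y := h.diff.snd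
  have hup : ∀ s, max R ‖x s‖ ≤ Real.exp C1 * Real.exp (a * max s.im 0) := by
    intro s
    have e1 := (abs_le.1 (hell _ (hCV s))).1
    rw [hu, ell] at e1
    rw [← Real.exp_add, ← Real.log_le_iff_le_exp (lt_of_lt_of_le (by linarith) (le_max_left _ _))]
    linarith
  have hlow : ∀ s : ℂ, Real.exp (a * s.im - C1) ≤ max R ‖x s‖ := by
    intro s
    have e1 := (abs_le.1 (hell _ (hCV s))).2
    rw [hu, ell] at e1
    rw [← Real.le_log_iff_exp_le (lt_of_lt_of_le (by linarith) (le_max_left _ _))]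
    have : a * s.im ≤ a * max s.im 0 := by gcongr; exact le_max_left _ _
    linarith
  have hlarge : ∀ B : ℝ, ∃ c1 : ℝ, 0 ≤ c1 ∧ ∀ s : ℂ, c1 ≤ s.im → B < ‖x s‖ ∧ R < ‖x s‖ := by
    intro B
    refine ⟨(C1 + Real.log (max R B + 1)) / a, ?_, ?_⟩
    · have : 0 ≤ Real.log (max R B + 1) := Real.log_nonneg (by linarith [le_max_left R B])
      positivity
    · intro s hs
      rw [div_le_iff₀ ha] at hs
      have e1 := hlow s
      have e2 : max R B + 1 ≤ Real.exp (a * s.im - C1) := by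
        rw [← Real.log_le_iff_le_exp (by linarith [le_max_left R B])]
        linarith
      have e3 := e2.trans e1
      have e4 : max R B < ‖x s‖ := by
        rcases le_max_iff.1 e3 with h | h
        · linarith [le_max_left R B]
        · linarith
      exact ⟨lt_of_le_of_lt (le_max_right _ _) e4, lt_of_le_of_lt (le_max_left _ _) e4⟩
  have hlogx : ∀ s : ℂ, 0 ≤ s.im → R < ‖x s‖ → |Real.log ‖x s‖ - a * s.im - (-c0)| ≤ C2 / ‖x s‖ := by
    intro s hs hxs
    have := hGV _ (CV_V hR (hCV s) hxs)
    rw [hlin s hs] at this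
    rw [← abs_neg]
    refine le_trans (le_of_eq ?_) this
    congr 1
    simp only [hx]; ring
  -- x exponential
  obtain ⟨κ, k, hκ, hxe⟩ : ∃ κ k : ℂ, κ ≠ 0 ∧ ∀ s, x s = κ * Complex.exp (-(Complex.I * a * s)) + k := by
    obtain ⟨c1, hc1, hl⟩ := hlarge R
    refine exp_lemma hxd ha (fun s => (le_max_right _ _).trans (hup s)) (c1 := c1) (c := -c0) (C := C2) ?_
    intro s hs
    have := (hl s hs).1
    exact ⟨by linarith, hlogx s (hc1.trans hs) this⟩
  -- relations
  obtain ⟨p1, p2, a1, a2, hd1, hd2, ha1, ha2, hT⟩ := H.two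
  have hrel : ∀ s, ∃ y' y'' : ℂ, x s = p1.eval (y s) - a1 * y' ∧ y s = p2.eval y' - a2 * y'' ∧
      3 * ‖y'‖ ≤ max R ‖y s‖ ∧ 3 * ‖y''‖ ≤ max R ‖y'‖ := by
    intro s
    have := hT _ (h.back 2 s)
    have e : F (F (S^[2] (g s))) = g s := by
      simp only [iterate_succ, iterate_zero, comp_apply, id]
      rw [H.st.ri, H.st.ri]
    rw [e] at this
    exact this
  set n1 := p1.natDegree with hn1
  have hn1p : (0:ℝ) < n1 := by exact_mod_cast (by omega : 0 < n1)
  set D := a / n1 with hD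
  have hDp : 0 < D := by positivity
  have haD : a = n1 * D := by rw [hD]; field_simp
  obtain ⟨B, hB0, hB⟩ := poly_bound p1 hd1
  have hbp : 0 < ‖p1.leadingCoeff‖ := by
    rw [norm_pos_iff, Polynomial.leadingCoeff_ne_zero]
    rintro h; rw [hn1, h] at hd1; simp at hd1
  set b := p1.leadingCoeff with hb
  set B' := B + ‖a1‖ with hB'
  set Y0 := max R (2 * B' / ‖b‖) with hY0
  have hY0R : R ≤ Y0 := le_max_left _ _
  -- y large
  obtain ⟨X0, hX0⟩ : ∃ X0 : ℝ, ∀ s, ‖y s‖ ≤ Y0 → ‖x s‖ ≤ X0 := by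
    obtain ⟨N, hN⟩ := (isCompact_closedBall (0:ℂ) Y0).exists_bound_of_continuousOn p1.continuous.continuousOn
    refine ⟨N + ‖a1‖ * Y0, fun s hs => ?_⟩
    obtain ⟨y', y'', e1, -, e3, -⟩ := hrel s
    rw [e1]
    refine (norm_sub_le _ _).trans ?_
    rw [norm_mul]
    have := hN (y s) (by simpa using hs)
    have e4 : max R ‖y s‖ ≤ Y0 := max_le hY0R hs
    have e5 : ‖y'‖ ≤ Y0 := by linarith [norm_nonneg y']
    gcongr
  obtain ⟨c1, hc1, hl⟩ := hlarge X0
  have hyl : ∀ s : ℂ, c1 ≤ s.im → Y0 < ‖y s‖ := by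
    intro s hs
    by_contra hh
    push Not at hh
    linarith [hX0 s hh, (hl s hs).1]
  set C3 := (C2 + 2 * (B' / ‖b‖)) / n1 with hC3
  set cc := (-c0 - Real.log ‖b‖) / n1 with hcc
  have hB'0 : 0 ≤ B' := by positivity
  have hC30 : 0 ≤ C3 := by positivity
  have hlogy : ∀ s : ℂ, c1 ≤ s.im → 1 ≤ ‖y s‖ ∧ |Real.log ‖y s‖ - D * s.im - cc| ≤ C3 / ‖y s‖ := by
    intro s hs
    have h1 := hyl s hs
    have hy1 : 1 ≤ ‖y s‖ := by linarith
    have hy0 : 0 < ‖y s‖ := by linarith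
    have hxR := (hl s hs).2
    refine ⟨hy1, ?_⟩
    have hyx : ‖y s‖ ≤ ‖x s‖ := (CV_V hR (hCV s) hxR).2
    have e1 := hlogx s (hc1.trans hs) hxR
    have e1' : C2 / ‖x s‖ ≤ C2 / ‖y s‖ := by gcongr
    obtain ⟨y', y'', r1, -, r3, -⟩ := hrel s
    have hyne : y s ≠ 0 := norm_pos_iff.1 hy0
    have hbne : b ≠ 0 := norm_pos_iff.1 hbp
    have e2 : |Real.log ‖x s‖ - Real.log ‖b * y s ^ n1‖| ≤ 2 * (B' / ‖b‖ / ‖y s‖) := by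
      apply abs_log_norm_le
      · exact mul_ne_zero hbne (pow_ne_zero _ hyne)
      · rw [div_div, div_le_iff₀ (by positivity)]
        have : 2 * B' / ‖b‖ ≤ ‖y s‖ := (le_max_right _ _).trans h1.le
        rw [div_le_iff₀ hbp] at this
        linarith
      · have e3 := hB (y s) hy1
        have e4 : x s - b * y s ^ n1 = (p1.eval (y s) - b * y s ^ n1) - a1 * y' := by rw [r1]; ring
        have e5 : ‖y'‖ ≤ ‖y s‖ ^ (n1 - 1) := by
          have : ‖y s‖ ≤ ‖y s‖ ^ (n1 - 1) := by
            conv_lhs => rw [← pow_one ‖y s‖]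
            exact pow_le_pow_right₀ hy1 (by omega)
          rw [max_eq_right (by linarith)] at r3
          linarith [norm_nonneg y']
        rw [e4]
        refine (norm_sub_le _ _).trans ?_
        rw [norm_mul, norm_mul, norm_pow]
        have e6 : B' / ‖b‖ / ‖y s‖ * (‖b‖ * ‖y s‖ ^ n1) = B' * ‖y s‖ ^ (n1 - 1) := by
          obtain ⟨m, hm⟩ : ∃ m, n1 = m + 1 := ⟨n1 - 1, by omega⟩
          rw [hm, Nat.add_sub_cancel, pow_succ]; field_simp
        rw [e6, hB', add_mul]
        gcongr
    rw [norm_mul, norm_pow, Real.log_mul hbp.ne' (by positivity), Real.log_pow] at e2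
    have e7 : Real.log ‖y s‖ - D * s.im - cc = ((Real.log ‖x s‖ - a * s.im - (-c0)) -
      (Real.log ‖x s‖ - (Real.log ‖b‖ + n1 * Real.log ‖y s‖))) / n1 := by
      rw [hcc, haD]; field_simp; ring
    rw [e7, abs_div, abs_of_pos hn1p, div_le_iff₀ hn1p]
    refine (abs_sub _ _).trans ?_
    have e8 : C3 / ‖y s‖ * n1 = C2 / ‖y s‖ + 2 * (B' / ‖b‖ / ‖y s‖) := by
      rw [hC3]; field_simp
    rw [e8]
    linarith
  obtain ⟨κ', k', hκ', hye⟩ : ∃ κ k : ℂ, κ ≠ 0 ∧ ∀ s, y s = κ * Complex.exp (-(Complex.I * D * s)) + k := by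
    refine exp_lemma hyd hDp (M := Real.exp (cc + C3) + Real.exp C1 * Real.exp (a * c1)) ?_ hlogy
    intro s
    have hE : 1 ≤ Real.exp (D * max s.im 0) := Real.one_le_exp (by positivity)
    rcases le_total c1 s.im with hs | hs
    · obtain ⟨e1, e2⟩ := hlogy s hs
      have e3 : C3 / ‖y s‖ ≤ C3 := div_le_self hC30 e1
      have e4 := (abs_le.1 e2).2
      have e5 : ‖y s‖ ≤ Real.exp (cc + C3) * Real.exp (D * max s.im 0) := by
        rw [max_eq_left (hc1.trans hs), ← Real.exp_add, ← Real.log_le_iff_le_exp (by linarith)]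
        linarith
      have e6 : 0 ≤ Real.exp C1 * Real.exp (a * c1) * Real.exp (D * max s.im 0) := by positivity
      rw [add_mul]; linarith
    · have e1 : 3 * ‖y s‖ ≤ max R ‖x s‖ := hCV s
      have e2 : Real.exp (a * max s.im 0) ≤ Real.exp (a * c1) := by
        gcongr; exact max_le hs hc1
      have e3 : Real.exp C1 * Real.exp (a * max s.im 0) ≤ Real.exp C1 * Real.exp (a * c1) := by gcongr
      have e4 := hup s
      have e5 : Real.exp C1 * Real.exp (a * c1) ≤ Real.exp C1 * Real.exp (a * c1) * Real.exp (D * max s.im 0) :=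
        le_mul_of_one_le_right (by positivity) hE
      have e6 : 0 ≤ Real.exp (cc + C3) * Real.exp (D * max s.im 0) := by positivity
      rw [add_mul]; linarith [norm_nonneg (y s)]
  refine exp_contra hd1 hd2 ha1 (a2 := a2) (R := R) (x := x) (y := y) hDp ?_ hκ' (κ := κ) (k := k) (k' := k') ?_ hye
  · intro s
    obtain ⟨y', y'', r1, r2, -, r4⟩ := hrel s
    exact ⟨y', y'', r1, r2, r4⟩
  · intro s; rw [← haD]; exact hxe s

theorem HSys.no_interior (H : HSys F S d R) {g : ℂ → ℂ × ℂ} (h : Cl F S d R g) {s : ℂ} (hs : s.im ≠ 0) :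
    0 < Gr F d R (g s) := by
  have hGLF := H.isGLF isOpen_univ h.diff.differentiableOn
  have hcont : Continuous (fun s => Gr F d R (g s)) := H.G_cont.comp h.diff.continuous
  have hfr : ∀ z : ℂ, z.im ≠ 0 → z ∉ frontier {z | z ∈ univ ∧ Gr F d R (g z) = 0} := by
    intro z hz hz'
    simp only [mem_univ, true_and] at hz'
    exact hz (h.fr z hz')
  have hup := dichotomy hGLF (A := {z : ℂ | 0 < z.im}) (convex_halfSpace_im_gt 0).isPreconnected (subset_univ _)
    (fun z hz => hfr z (ne_of_gt hz))
  have hdn := dichotomy hGLF (A := {z : ℂ | z.im < 0}) (convex_halfSpace_im_lt 0).isPreconnected (subset_univ _)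
    (fun z hz => hfr z (ne_of_lt hz))
  -- closure
  have hclup : (∀ z : ℂ, 0 < z.im → Gr F d R (g z) = 0) → ∀ z : ℂ, 0 ≤ z.im → Gr F d R (g z) = 0 := by
    intro hh z hz
    have hcl : IsClosed {z | Gr F d R (g z) = 0} := isClosed_eq hcont continuous_const
    have := closure_minimal (s := {z : ℂ | 0 < z.im}) (fun z hz => hh z hz) hcl
    rw [Complex.closure_setOf_lt_im] at this
    exact this hz
  have hcldn : (∀ z : ℂ, z.im < 0 → Gr F d R (g z) = 0) → ∀ z : ℂ, z.im ≤ 0 → Gr F d R (g z) = 0 := by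
    intro hh z hz
    have hcl : IsClosed {z | Gr F d R (g z) = 0} := isClosed_eq hcont continuous_const
    have := closure_minimal (s := {z : ℂ | z.im < 0}) (fun z hz => hh z hz) hcl
    rw [Complex.closure_setOf_im_lt] at this
    exact this hz
  rcases hup with hup | hup
  · rcases hdn with hdn | hdn
    · exfalso
      obtain ⟨z, hz⟩ := h.pos
      rcases le_total 0 z.im with h1 | h1
      · exact hz.ne' (hclup hup z h1)
      · exact hz.ne' (hcldn hdn z h1)
    · exfalso
      refine H.no_half (h.aff 0 (-1) (by norm_num)) ?_ ?_
      · intro z hz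
        exact hclup hup _ (by simpa using hz)
      · intro z hz
        exact hdn _ (by simpa using hz)
  · rcases hdn with hdn | hdn
    · exact (H.no_half h (hcldn hdn) hup).elim
    · rcases lt_or_gt_of_ne hs with h1 | h1
      · exact hdn s h1
      · exact hup s h1

end Part10

section Part11

open InnerProductSpace

theorem ift {E : Type*} [NormedAddCommGroup E] [NormedSpace ℂ E] [CompleteSpace E] {f : E → E} {a : E}
    (hf : ContDiffAt ℂ 1 f a) {f' : E ≃L[ℂ] E} (hf' : HasFDerivAt f (f' : E →L[ℂ] E) a) :
    ∃ B : E → E, ContDiffAt ℂ 1 B (f a) ∧ B (f a) = a ∧ (∀ᶠ y in 𝓝 (f a), f (B y) = y) ∧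
      ∀ᶠ x in 𝓝 a, B (f x) = x := by
  refine ⟨hf.localInverse hf' one_ne_zero, hf.to_localInverse hf' one_ne_zero,
    hf.localInverse_apply_image hf' one_ne_zero, ?_, ?_⟩
  · exact (hf.hasStrictFDerivAt' hf' one_ne_zero).eventually_right_inverse
  · exact (hf.hasStrictFDerivAt' hf' one_ne_zero).eventually_left_inverse

theorem root_coord {f : ℂ → ℂ} {z0 : ℂ} (hf : AnalyticAt ℂ f z0) (hne : ¬ ∀ᶠ z in 𝓝 z0, f z = f z0) :
    ∃ (l : ℕ) (B : ℂ → ℂ), 1 ≤ l ∧ AnalyticAt ℂ B 0 ∧ B 0 = z0 ∧ (∀ᶠ t in 𝓝 (0:ℂ), f (B t) = f z0 + t ^ l) ∧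
      ∀ᶠ t in 𝓝 (0:ℂ), B t = z0 → t = 0 := by
  have hf2 : AnalyticAt ℂ (fun z => f z - f z0) z0 := hf.sub analyticAt_const
  obtain ⟨l, h, hh, hh0, hev⟩ := (hf2.exists_eventuallyEq_pow_smul_nonzero_iff).2 (by
    simpa only [sub_eq_zero] using hne)
  have hl : 1 ≤ l := by
    rcases Nat.eq_zero_or_pos l with h0 | h0
    · have := hev.self_of_nhds
      simp [h0, hh0.symm] at this
    · exact h0
  have hl0 : (l : ℂ) ≠ 0 := by exact_mod_cast (by omega : l ≠ 0)
  obtain ⟨c, hc⟩ := IsAlgClosed.exists_pow_nat_eq (h z0) (by omega : 0 < l)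
  have hc0 : c ≠ 0 := by rintro rfl; rw [zero_pow (by omega)] at hc; exact hh0 hc.symm
  set r : ℂ → ℂ := fun z => c * Complex.exp (Complex.log (h z / h z0) / l) with hr
  have hra : AnalyticAt ℂ r z0 := by
    have h1 : AnalyticAt ℂ (fun z => h z / h z0) z0 := hh.div analyticAt_const hh0
    have h2 := h1.clog (by rw [div_self hh0]; exact Complex.one_mem_slitPlane)
    exact analyticAt_const.mul ((h2.div analyticAt_const hl0).cexp)
  have hr0 : r z0 = c := by simp [hr, div_self hh0]
  have hrl : ∀ᶠ z in 𝓝 z0, r z ^ l = h z := by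
    filter_upwards [hh.continuousAt.eventually_ne hh0] with z hz
    simp only [hr]
    rw [mul_pow, ← Complex.exp_nat_mul, mul_div_cancel₀ _ hl0, Complex.exp_log (div_ne_zero hz hh0), hc,
      mul_div_cancel₀ _ hh0]
  set A : ℂ → ℂ := fun z => (z - z0) * r z with hA
  have hAa : AnalyticAt ℂ A z0 := (analyticAt_id.sub analyticAt_const).mul hra
  have hA0 : A z0 = 0 := by simp [hA]
  have hAd : HasDerivAt A c z0 := by
    have : HasDerivAt A (1 * r z0 + (z0 - z0) * deriv r z0) z0 :=
      ((hasDerivAt_id z0).sub_const z0).mul hra.differentiableAt.hasDerivAt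
    rwa [hr0, one_mul, sub_self, zero_mul, add_zero] at this
  have hAl : ∀ᶠ z in 𝓝 z0, f z = f z0 + A z ^ l := by
    filter_upwards [hev, hrl] with z h1 h2
    simp only [hA]
    rw [mul_pow, h2, ← smul_eq_mul, ← h1]; ring
  obtain ⟨B, hB1, hB2, hB3, hB4⟩ := ift (f' := ContinuousLinearEquiv.unitsEquivAut ℂ (Units.mk0 c hc0))
    (hAa.contDiffAt) (by
      have e : ((ContinuousLinearEquiv.unitsEquivAut ℂ (Units.mk0 c hc0) : ℂ ≃L[ℂ] ℂ) : ℂ →L[ℂ] ℂ) =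
        ContinuousLinearMap.toSpanSingleton ℂ c := by ext; simp
      rw [e]
      exact hAd.hasFDerivAt)
  rw [hA0] at hB1 hB2 hB3
  have hBc : Tendsto B (𝓝 0) (𝓝 z0) := by
    have := hB1.continuousAt.tendsto
    rwa [hB2] at this
  refine ⟨l, B, hl, ?_, hB2, ?_, ?_⟩
  · rw [Complex.analyticAt_iff_eventually_differentiableAt]
    filter_upwards [hB1.eventually (by simp)] with t ht
    exact ht.differentiableAt one_ne_zero
  · filter_upwards [hBc.eventually hAl, hB3] with t h1 h2
    rw [h1, h2]
  · filter_upwards [hB3] with t h2 h3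
    rw [← h2, h3, hA0]

theorem local_curve {X Y : ℂ → ℂ} {s0 z0 : ℂ} (hX : AnalyticAt ℂ X s0) (hY : AnalyticAt ℂ Y z0)
    (hXn : ¬ ∀ᶠ z in 𝓝 s0, X z = X s0) (hYn : ¬ ∀ᶠ z in 𝓝 z0, Y z = Y z0) (h : X s0 = Y z0) :
    ∃ s ζ : ℂ → ℂ, AnalyticAt ℂ s 0 ∧ AnalyticAt ℂ ζ 0 ∧ s 0 = s0 ∧ ζ 0 = z0 ∧
      (∀ᶠ t in 𝓝 (0:ℂ), X (s t) = Y (ζ t)) ∧ ¬ ∀ᶠ t in 𝓝 (0:ℂ), ζ t = z0 := by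
  obtain ⟨l, B, hl, hB, hB0, hB1, hB2⟩ := root_coord hX hXn
  obtain ⟨m, B', hm, hB', hB0', hB1', hB2'⟩ := root_coord hY hYn
  have t1 : Tendsto (fun t : ℂ => t ^ m) (𝓝 0) (𝓝 0) := by
    have : ContinuousAt (fun t : ℂ => t ^ m) 0 := by fun_prop
    simpa [ContinuousAt, zero_pow (by omega : m ≠ 0)] using this
  have t2 : Tendsto (fun t : ℂ => t ^ l) (𝓝 0) (𝓝 0) := by
    have : ContinuousAt (fun t : ℂ => t ^ l) 0 := by fun_prop
    simpa [ContinuousAt, zero_pow (by omega : l ≠ 0)] using this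
  refine ⟨fun t => B (t ^ m), fun t => B' (t ^ l), ?_, ?_, ?_, ?_, ?_, ?_⟩
  · exact AnalyticAt.comp_of_eq hB (by fun_prop) (by simp [zero_pow (by omega : m ≠ 0)])
  · exact AnalyticAt.comp_of_eq hB' (by fun_prop) (by simp [zero_pow (by omega : l ≠ 0)])
  · simp [zero_pow (by omega : m ≠ 0), hB0]
  · simp [zero_pow (by omega : l ≠ 0), hB0']
  · filter_upwards [t1.eventually hB1, t2.eventually hB1'] with t h1 h2
    rw [h1, h2, h, ← pow_mul, ← pow_mul, mul_comm]
  · intro hh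
    have : ∀ᶠ t in 𝓝 (0:ℂ), t = 0 := by
      filter_upwards [hh, t2.eventually hB2'] with t h1 h2
      exact eq_zero_of_pow_eq_zero (h2 h1)
    have h3 : ∀ᶠ t in 𝓝[≠] (0:ℂ), t = 0 := this.filter_mono nhdsWithin_le_nhds
    have h4 : ∀ᶠ t in 𝓝[≠] (0:ℂ), t ≠ 0 := eventually_mem_nhdsWithin
    obtain ⟨t, h5, h6⟩ := (h3.and h4).exists
    exact h6 h5

theorem entire_not_evconst {X : ℂ → ℂ} (hX : Differentiable ℂ X) (hne : ∃ a b, X a ≠ X b) (s0 : ℂ) :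
    ¬ ∀ᶠ z in 𝓝 s0, X z = X s0 := by
  intro h
  obtain ⟨a, b, hab⟩ := hne
  have hXa : AnalyticOnNhd ℂ X univ := fun z _ => hX.analyticAt z
  have := hXa.eqOn_of_preconnected_of_eventuallyEq (g := fun _ => X s0) (fun z _ => analyticAt_const) isPreconnected_univ (mem_univ s0) h
  exact hab ((this (mem_univ a)).trans (this (mem_univ b)).symm)

theorem entire_unbounded {X : ℂ → ℂ} (hX : Differentiable ℂ X) (hne : ∃ a b, X a ≠ X b) (M : ℝ) :
    ∃ s, M < ‖X s‖ := by
  by_contra hh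
  push Not at hh
  obtain ⟨a, b, hab⟩ := hne
  refine hab (hX.apply_eq_apply_of_bounded ?_ a b)
  refine (Metric.isBounded_iff_subset_closedBall 0).2 ⟨M, ?_⟩
  rintro _ ⟨s, rfl⟩
  simpa using hh s

theorem entire_dense {X : ℂ → ℂ} (hX : Differentiable ℂ X) (hne : ∃ a b, X a ≠ X b) (c : ℂ) {ε : ℝ} (hε : 0 < ε) :
    ∃ s, ‖X s - c‖ < ε := by
  by_contra hh
  push Not at hh
  have h0 : ∀ s, X s - c ≠ 0 := fun s h => by have := hh s; rw [h, norm_zero] at this; linarith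
  have hd : Differentiable ℂ (fun s => (X s - c)⁻¹) := (hX.sub_const c).inv h0
  obtain ⟨a, b, hab⟩ := hne
  have := hd.apply_eq_apply_of_bounded (by
    refine (Metric.isBounded_iff_subset_closedBall 0).2 ⟨ε⁻¹, ?_⟩
    rintro _ ⟨s, rfl⟩
    simp only [mem_closedBall_zero_iff, norm_inv]
    exact inv_anti₀ hε (hh s)) a b
  exact hab (by simpa using this)

theorem mpZ {X Y A B : ℂ → ℂ} (hX : Differentiable ℂ X) (hY : Differentiable ℂ Y) (hA : Differentiable ℂ A)
    (hB : Differentiable ℂ B) (hXn : ∃ a b, X a ≠ X b) (hYn : ∃ a b, Y a ≠ Y b) {ρ m : ℝ} (hm : 0 < m)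
    {P : ℂ → ℂ} (hP : DifferentiableOn ℂ P (Metric.ball 0 ρ)) (hPc : ContinuousOn P (Metric.closedBall 0 ρ))
    (hD : ∀ s ζ : ℂ, ‖ζ‖ ≤ ρ → X s = Y ζ → m ≤ ‖A s - B ζ‖)
    (hbd : ∀ s ζ : ℂ, ‖ζ‖ = ρ → X s = Y ζ → -Real.log ‖A s - B ζ‖ ≤ (P ζ).re)
    (s1 ζ1 : ℂ) (h1 : ‖ζ1‖ ≤ ρ) (h1' : X s1 = Y ζ1) : -Real.log ‖A s1 - B ζ1‖ ≤ (P ζ1).re := by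
  by_contra hcon
  push Not at hcon
  obtain ⟨MY, hMY⟩ := (isCompact_closedBall (0:ℂ) ρ).exists_bound_of_continuousOn hY.continuous.continuousOn
  obtain ⟨MP, hMP⟩ := (isCompact_closedBall (0:ℂ) ρ).exists_bound_of_continuousOn hPc
  obtain ⟨s', hs'⟩ := entire_unbounded hX hXn MY
  obtain ⟨c0, hc0, hfar⟩ : ∃ c0 > 0, ∀ s ζ : ℂ, ‖ζ‖ ≤ ρ → X s = Y ζ → c0 ≤ ‖s - s'‖ := by
    have : ∀ᶠ s in 𝓝 s', MY < ‖X s‖ := hX.continuous.norm.continuousAt.eventually_const_lt hs'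
    obtain ⟨c0, hc0, h⟩ := Metric.eventually_nhds_iff_ball.1 this
    refine ⟨c0, hc0, fun s ζ hζ hs => ?_⟩
    by_contra hlt
    push Not at hlt
    have e1 := h s (by rwa [Metric.mem_ball, dist_eq_norm])
    have e2 := hMY ζ (by simpa using hζ)
    rw [hs] at e1
    linarith
  set Z : Set (ℂ × ℂ) := {w | ‖w.2‖ ≤ ρ ∧ X w.1 = Y w.2} with hZ
  set η := -Real.log ‖A s1 - B ζ1‖ - (P ζ1).re with hη
  have hηp : 0 < η := by rw [hη]; linarith
  obtain ⟨q, hq⟩ := exists_nat_gt (Real.log (‖s1 - s'‖ / c0) / η)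
  rw [div_lt_iff₀ hηp] at hq
  set Φ : ℂ × ℂ → ℝ := fun w => q * (-Real.log ‖A w.1 - B w.2‖ - (P w.2).re) - Real.log (‖w.1 - s'‖ / c0) with hΦ
  have hΦ1 : 0 < Φ (s1, ζ1) := by simp only [hΦ]; rw [← hη]; linarith
  have hfar' : ∀ w ∈ Z, 0 ≤ Real.log (‖w.1 - s'‖ / c0) := fun w hw =>
    Real.log_nonneg (by rw [one_le_div hc0]; exact hfar _ _ hw.1 hw.2)
  -- compactness
  set Bg : ℝ := c0 * Real.exp (q * (-Real.log m + MP)) with hBg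
  have hbig : ∀ w ∈ Z, 0 < Φ w → ‖w.1 - s'‖ ≤ Bg := by
    intro w hw hpos
    have e1 := hD _ _ hw.1 hw.2
    have e2 : Real.log m ≤ Real.log ‖A w.1 - B w.2‖ := Real.log_le_log hm e1
    have e3 := hMP w.2 (by simpa using hw.1)
    have e4 : -MP ≤ (P w.2).re := by
      have := Complex.abs_re_le_norm (P w.2)
      linarith [neg_abs_le (P w.2).re]
    have e5 : (q:ℝ) * (-Real.log ‖A w.1 - B w.2‖ - (P w.2).re) ≤ q * (-Real.log m + MP) := by
      gcongr; linarith
    have e6 : Real.log (‖w.1 - s'‖ / c0) ≤ q * (-Real.log m + MP) := by simp only [hΦ] at hpos; linarith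
    have e7 : 0 < ‖w.1 - s'‖ := lt_of_lt_of_le hc0 (hfar _ _ hw.1 hw.2)
    rw [Real.log_le_iff_le_exp (by positivity), div_le_iff₀ hc0] at e6
    rw [hBg]; linarith
  set K : Set (ℂ × ℂ) := Z ∩ (Metric.closedBall s' Bg ×ˢ Metric.closedBall 0 ρ) with hK
  have hZc : IsClosed Z := by
    have z1 : IsClosed {w : ℂ × ℂ | ‖w.2‖ ≤ ρ} := isClosed_le (by fun_prop) (by fun_prop)
    refine z1.inter (isClosed_eq ?_ ?_)
    · exact hX.continuous.comp continuous_fst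
    · exact hY.continuous.comp continuous_snd
  have hKc : IsCompact K := ((isCompact_closedBall _ _).prod (isCompact_closedBall _ _)).inter_left hZc
  have hmemK : ∀ w ∈ Z, 0 < Φ w → w ∈ K := fun w hw hp =>
    ⟨hw, by simpa [dist_eq_norm] using hbig w hw hp, by simpa using hw.1⟩
  have hDne : ∀ w ∈ Z, A w.1 - B w.2 ≠ 0 := fun w hw h => by
    have := hD _ _ hw.1 hw.2
    rw [h, norm_zero] at this; linarith
  have hsne : ∀ w ∈ Z, 0 < ‖w.1 - s'‖ := fun w hw => lt_of_lt_of_le hc0 (hfar _ _ hw.1 hw.2)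
  have hΦc : ContinuousOn Φ K := by
    have c1 : ContinuousOn (fun w : ℂ × ℂ => P w.2) K :=
      hPc.comp continuous_snd.continuousOn (fun w hw => by simpa using hw.1.1)
    have c2 : ContinuousOn (fun w : ℂ × ℂ => Real.log ‖A w.1 - B w.2‖) K := by
      refine ContinuousOn.log ?_ (fun w hw => norm_ne_zero_iff.2 (hDne w hw.1))
      exact (((hA.continuous.comp continuous_fst).sub (hB.continuous.comp continuous_snd)).norm).continuousOn
    have c3 : ContinuousOn (fun w : ℂ × ℂ => Real.log (‖w.1 - s'‖ / c0)) K := by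
      refine ContinuousOn.log (by fun_prop) (fun w hw => ?_)
      have := hsne w hw.1
      positivity
    exact ((c2.neg.sub (Complex.continuous_re.comp_continuousOn c1)).const_mul (q:ℝ) |>.sub c3 :)
  have h1K : (s1, ζ1) ∈ K := hmemK _ ⟨h1, h1'⟩ hΦ1
  obtain ⟨w0, hw0, hmax⟩ := hKc.exists_isMaxOn ⟨_, h1K⟩ hΦc
  have hw0p : 0 < Φ w0 := lt_of_lt_of_le hΦ1 (hmax h1K)
  -- maximizers
  have hMc : IsCompact (K ∩ {w | Φ w = Φ w0}) := by
    refine hKc.of_isClosed_subset ?_ inter_subset_left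
    exact hΦc.preimage_isClosed_of_isClosed hKc.isClosed (isClosed_singleton (x := Φ w0))
  obtain ⟨w2, hw2, hmax2⟩ := hMc.exists_isMaxOn ⟨w0, hw0, rfl⟩ 
    (Complex.continuous_re.comp continuous_snd).continuousOn
  have hw2Z : w2 ∈ Z := hw2.1.1
  have hΦ2 : Φ w2 = Φ w0 := hw2.2
  have hglob : ∀ w ∈ Z, Φ w ≤ Φ w2 := by
    intro w hw
    rw [hΦ2]
    by_cases hp : 0 < Φ w
    · exact hmax (hmemK w hw hp)
    · push Not at hp; linarith
  have hin0 : ‖w2.2‖ < ρ := by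
    refine lt_of_le_of_ne hw2Z.1 (fun heq => ?_)
    have e1 := hbd _ _ heq hw2Z.2
    have e2 := hfar' w2 hw2Z
    have e3 : (q:ℝ) * (-Real.log ‖A w2.1 - B w2.2‖ - (P w2.2).re) ≤ 0 :=
      mul_nonpos_of_nonneg_of_nonpos (Nat.cast_nonneg q) (by linarith)
    have : Φ w2 ≤ 0 := by simp only [hΦ]; linarith
    linarith
  obtain ⟨s, ζ, hsa, hζa, hs0, hζ0, hcurve, hnc⟩ := local_curve (hX.analyticAt w2.1) (hY.analyticAt w2.2)
    (entire_not_evconst hX hXn _) (entire_not_evconst hY hYn _) hw2Z.2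
  have hζin : ∀ᶠ t in 𝓝 (0:ℂ), ‖ζ t‖ < ρ := by
    have : ContinuousAt (fun t => ‖ζ t‖) 0 := hζa.continuousAt.norm
    exact this.eventually_lt_const (by simp only [hζ0]; exact hin0)
  have hin : ∀ᶠ t in 𝓝 (0:ℂ), (s t, ζ t) ∈ Z := by
    filter_upwards [hζin, hcurve] with t h2 h3 using ⟨h2.le, h3⟩
  set h : ℂ → ℂ := fun t => ((A (s t) - B (ζ t)) * Complex.exp (P (ζ t))) ^ q * (s t - s') with hh
  have hnorm : ∀ t, (s t, ζ t) ∈ Z → ‖h t‖ = c0 * Real.exp (-Φ (s t, ζ t)) := by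
    intro t ht
    have e1 : 0 < ‖A (s t) - B (ζ t)‖ := norm_pos_iff.2 (hDne _ ht)
    have e2 : 0 < ‖s t - s'‖ := hsne _ ht
    simp only [hh, hΦ, norm_mul, norm_pow, Complex.norm_exp]
    have e3 : -(q * (-Real.log ‖A (s t) - B (ζ t)‖ - (P (ζ t)).re) - Real.log (‖s t - s'‖ / c0)) =
      q * (Real.log ‖A (s t) - B (ζ t)‖ + (P (ζ t)).re) + Real.log (‖s t - s'‖ / c0) := by ring
    rw [e3, Real.exp_add, Real.exp_log (by positivity), Real.exp_nat_mul, Real.exp_add, Real.exp_log e1]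
    field_simp
  have hhd : ∀ᶠ t in 𝓝 (0:ℂ), DifferentiableAt ℂ h t := by
    filter_upwards [hζin, hsa.eventually_analyticAt, hζa.eventually_analyticAt] with t h2 h3 h4
    have hPd : DifferentiableAt ℂ P (ζ t) := hP.differentiableAt (Metric.isOpen_ball.mem_nhds (by simpa using h2))
    have d1 : DifferentiableAt ℂ (fun t => A (s t)) t := hA.differentiableAt.comp t h3.differentiableAt
    have d2 : DifferentiableAt ℂ (fun t => B (ζ t)) t := hB.differentiableAt.comp t h4.differentiableAt
    have d3 : DifferentiableAt ℂ (fun t => P (ζ t)) t := hPd.comp t h4.differentiableAt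
    exact (((d1.sub d2).mul d3.cexp).pow q).mul (h3.differentiableAt.sub_const s')
  have h0Z : (s 0, ζ 0) ∈ Z := by rw [hs0, hζ0]; exact hw2Z
  have hmin : IsLocalMin (norm ∘ h) 0 := by
    filter_upwards [hin] with t ht
    simp only [comp_apply]
    rw [hnorm t ht, hnorm 0 h0Z, hs0, hζ0]
    have := hglob _ ht
    gcongr
  have hh0 : h 0 ≠ 0 := by
    rw [← norm_pos_iff, hnorm 0 h0Z]; positivity
  have hconst := (Complex.eventually_eq_or_eq_zero_of_isLocalMin_norm hhd hmin).resolve_right hh0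
  have hre : ∀ᶠ t in 𝓝 (0:ℂ), (ζ t).re ≤ w2.2.re := by
    filter_upwards [hconst, hin] with t h2 h3
    have e1 : ‖h t‖ = ‖h 0‖ := by rw [h2]
    rw [hnorm t h3, hnorm 0 h0Z, hs0, hζ0] at e1
    have e2 : Φ (s t, ζ t) = Φ w2 := by
      have := mul_left_cancel₀ hc0.ne' e1
      have := Real.exp_injective this
      have h4 : Φ (w2.1, w2.2) = Φ w2 := rfl
      linarith
    have e3 : (s t, ζ t) ∈ K ∩ {w | Φ w = Φ w0} := ⟨hmemK _ h3 (by rw [e2, hΦ2]; exact hw0p), by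
      show Φ _ = _; rw [e2, hΦ2]⟩
    exact hmax2 e3
  -- open mapping
  rcases hζa.eventually_constant_or_nhds_le_map_nhds with h2 | h2
  · exact hnc (by rwa [hζ0] at h2)
  · have h3 : ∀ᶠ z in 𝓝 (ζ 0), z.re ≤ w2.2.re := h2 hre
    rw [hζ0] at h3
    obtain ⟨ε, hε, h4⟩ := Metric.eventually_nhds_iff_ball.1 h3
    have := h4 (w2.2 + ((ε / 2 : ℝ) : ℂ)) (by
      rw [Metric.mem_ball, dist_eq_norm, add_sub_cancel_left, Complex.norm_real, Real.norm_of_nonneg (by linarith)]; linarith)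
    simp at this
    linarith

end Part11

section Part12

open InnerProductSpace

theorem eigen_frame {D : (ℂ × ℂ) →L[ℂ] ℂ × ℂ} {vs vu : ℂ × ℂ} {ls lu : ℂ} (hs : vs ≠ 0) (hu : vu ≠ 0)
    (hDs : D vs = ls • vs) (hDu : D vu = lu • vu) (hne : ls ≠ lu) :
    ∃ L : (ℂ × ℂ) ≃L[ℂ] ℂ × ℂ, ∀ w : ℂ × ℂ, L w = w.1 • vs + w.2 • vu := by
  set l : (ℂ × ℂ) →ₗ[ℂ] ℂ × ℂ := (LinearMap.toSpanSingleton ℂ _ vs).coprod (LinearMap.toSpanSingleton ℂ _ vu) with hl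
  have hlw : ∀ w : ℂ × ℂ, l w = w.1 • vs + w.2 • vu := fun w => by simp [hl]
  have hinj : Injective l := by
    rw [injective_iff_map_eq_zero]
    intro w hw
    rw [hlw] at hw
    have h1 : w.1 • ls • vs + w.2 • lu • vu = 0 := by
      have := congrArg D hw
      simpa [hDs, hDu] using this
    have h2 : (w.2 * (lu - ls)) • vu = 0 := by
      have h3 := congrArg (fun v => ls • v) hw
      simp only [smul_add, smul_zero] at h3
      have : (w.2 * (lu - ls)) • vu = (w.1 • ls • vs + w.2 • lu • vu) - (ls • w.1 • vs + ls • w.2 • vu) := by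
        simp only [smul_smul]
        rw [mul_comm ls w.1, mul_sub, sub_smul, mul_comm ls w.2]; abel
      rw [this, h1, h3, sub_zero]
    have h3 : w.2 = 0 := by
      rcases smul_eq_zero.1 h2 with h | h
      · exact (mul_eq_zero.1 h).resolve_right (sub_ne_zero.2 hne.symm)
      · exact absurd h hu
    rw [h3, zero_smul, add_zero] at hw
    have h4 : w.1 = 0 := (smul_eq_zero.1 hw).resolve_right hs
    exact Prod.ext h4 h3
  exact ⟨(LinearEquiv.ofInjectiveEndo l hinj).toContinuousLinearEquiv, fun w => hlw w⟩

theorem quad_bound {f : ℂ → ℂ × ℂ} (hf : Differentiable ℂ f) : ∃ C r : ℝ, 0 ≤ C ∧ 0 < r ∧ ∀ ζ : ℂ, ‖ζ‖ < r →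
    ‖f ζ - f 0 - ζ • deriv f 0‖ ≤ C * ‖ζ‖ ^ 2 := by
  obtain ⟨p, hp⟩ := hf.analyticAt 0
  have h := hp.isBigO_sub_partialSum_pow 2
  obtain ⟨C, hC0, hC⟩ := h.exists_pos
  rw [Asymptotics.IsBigOWith] at hC
  obtain ⟨r, hr, hh⟩ := Metric.eventually_nhds_iff_ball.1 hC
  refine ⟨C, r, hC0.le, hr, fun ζ hζ => ?_⟩
  have := hh ζ (by simpa using hζ)
  rw [zero_add] at this
  simp only [norm_pow, norm_norm] at this
  refine le_trans (le_of_eq ?_) this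
  congr 1
  rw [FormalMultilinearSeries.partialSum, Finset.sum_range_succ, Finset.sum_range_one, sub_sub]
  congr 2
  · exact (hp.coeff_zero _).symm
  · rw [hp.deriv]
    have : (p 1) (fun _ => ζ) = ζ • (p 1) (fun _ => 1) := by
      have := (p 1).map_smul_univ (fun _ => ζ) (fun _ => 1)
      simpa using this
    rw [this]

theorem stable_core {S : ℂ × ℂ → ℂ × ℂ} (hSc : ContDiff ℂ 1 S) (h0 : S 0 = 0) {μ ν : ℂ} (hμ : 1 < ‖μ‖)
    (hν : ‖ν‖ ≤ ‖μ‖) (hD : ∀ w, fderiv ℂ S 0 w = (μ * w.1, ν * w.2)) :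
    ∃ φ : ℂ → ℂ × ℂ, Differentiable ℂ φ ∧ φ 0 = 0 ∧ (∀ ζ, S (φ ζ) = φ (μ * ζ)) ∧ ∃ ζ, φ ζ ≠ 0 := by
  have hS : Differentiable ℂ S := hSc.differentiable one_ne_zero
  set b := ‖μ‖ with hb
  have hμ0 : μ ≠ 0 := norm_pos_iff.1 (by linarith)
  set Λ := (b + b ^ 2) / 2 with hΛ
  have hΛ1 : b < Λ := by rw [hΛ]; nlinarith
  have hΛ2 : Λ < b ^ 2 := by rw [hΛ]; nlinarith
  have hΛ0 : 0 < Λ := by linarith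
  -- Lipschitz
  obtain ⟨r, hr, hlip⟩ : ∃ r > 0, ∀ w w' : ℂ × ℂ, ‖w‖ < r → ‖w'‖ < r → ‖S w - S w'‖ ≤ Λ * ‖w - w'‖ := by
    have hst : HasStrictFDerivAt S (fderiv ℂ S 0) 0 :=
      hSc.contDiffAt.hasStrictFDerivAt one_ne_zero
    have hn : ‖fderiv ℂ S 0‖ ≤ b := by
      refine ContinuousLinearMap.opNorm_le_bound _ (by linarith) (fun w => ?_)
      rw [hD, Prod.norm_def]
      simp only [norm_mul]
      refine max_le ?_ ?_
      · exact mul_le_mul le_rfl (norm_fst_le w) (norm_nonneg _) (by linarith)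
      · exact mul_le_mul hν (norm_snd_le w) (norm_nonneg _) (by linarith)
    obtain ⟨s, hs, hl⟩ := hst.exists_lipschitzOnWith_of_nnnorm_lt ⟨Λ, hΛ0.le⟩ (by
      exact NNReal.coe_lt_coe.1 (lt_of_le_of_lt hn hΛ1))
    obtain ⟨r, hr, hrs⟩ := Metric.mem_nhds_iff.1 hs
    refine ⟨r, hr, fun w w' hw hw' => ?_⟩
    have := hl.dist_le_mul w (hrs (by simpa using hw)) w' (hrs (by simpa using hw'))
    rwa [dist_eq_norm, dist_eq_norm] at this
  obtain ⟨C, r2, hC0, hr2, hq⟩ : ∃ C r : ℝ, 0 ≤ C ∧ 0 < r ∧ ∀ ζ : ℂ, ‖ζ‖ < r →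
      ‖S (ζ, 0) - (μ * ζ, 0)‖ ≤ C * ‖ζ‖ ^ 2 := by
    have hd : HasDerivAt (fun ζ : ℂ => S (ζ, 0)) (μ, 0) 0 := by
      have h1 : HasDerivAt (fun ζ : ℂ => ((ζ, 0) : ℂ × ℂ)) (1, 0) 0 := (hasDerivAt_id (0:ℂ)).prodMk (hasDerivAt_const _ _)
      have h2 : HasFDerivAt S (fderiv ℂ S 0) ((0:ℂ), (0:ℂ)) := (hS 0).hasFDerivAt
      have := HasFDerivAt.comp_hasDerivAt (f := fun ζ : ℂ => ((ζ, 0) : ℂ × ℂ)) (0:ℂ) h2 h1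
      rw [hD] at this
      have e0 : ((μ * ((1 : ℂ), (0 : ℂ)).1, ν * ((1 : ℂ), (0 : ℂ)).2) : ℂ × ℂ) = (μ, 0) := by simp
      rw [e0] at this
      exact this
    obtain ⟨C, r, hC, hr, hh⟩ := quad_bound (f := fun ζ : ℂ => S (ζ, 0)) (hS.comp (by fun_prop))
    refine ⟨C, r, hC, hr, fun ζ hζ => ?_⟩
    have := hh ζ hζ
    rw [hd.deriv] at this
    have e0 : S ((0:ℂ), (0:ℂ)) = 0 := h0
    rw [e0, sub_zero] at this
    have e : ζ • ((μ, 0) : ℂ × ℂ) = (μ * ζ, 0) := by simp [mul_comm]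
    rwa [e] at this
  set C' := C / (b ^ 2 - Λ) with hC'
  have hC'0 : 0 ≤ C' := div_nonneg hC0 (by linarith)
  have hC'e : Λ * C' + C = C' * b ^ 2 := by
    have : b ^ 2 - Λ ≠ 0 := by linarith
    rw [hC']; field_simp; ring
  obtain ⟨ρ, hρ0, hρ1, hρ2, hρ3⟩ : ∃ ρ : ℝ, 0 < ρ ∧ 2 * ρ < r ∧ ρ < r2 ∧ C' * ρ ≤ 1 / 2 := by
    refine ⟨min (r / 3) (min (r2 / 2) (1 / (2 * (C' + 1)))), by positivity, ?_, ?_, ?_⟩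
    · have := min_le_left (r / 3) (min (r2 / 2) (1 / (2 * (C' + 1)))); linarith
    · have := (min_le_right (r / 3) _).trans (min_le_left (r2 / 2) (1 / (2 * (C' + 1)))); linarith
    · have := (min_le_right (r / 3) _).trans (min_le_right (r2 / 2) (1 / (2 * (C' + 1))))
      calc C' * _ ≤ C' * (1 / (2 * (C' + 1))) := by gcongr
        _ ≤ 1 / 2 := by
          rw [mul_one_div, div_le_div_iff₀ (by positivity) (by norm_num)]; linarith
  have hpown : ∀ (i : ℕ) (w : ℂ), ‖μ ^ i * w‖ ≤ ‖μ ^ (i + 1) * w‖ := by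
    intro i w
    rw [pow_succ, mul_assoc, norm_mul, norm_mul, norm_mul]
    have : ‖w‖ ≤ ‖μ‖ * ‖w‖ := le_mul_of_one_le_left (norm_nonneg _) hμ.le
    gcongr
  have hball : ∀ (q : ℂ × ℂ) (z : ℂ), ‖z‖ < ρ → ‖q - (z, 0)‖ ≤ C' * ‖z‖ ^ 2 → ‖q‖ < r := by
    intro q z hz hq
    have e1 := norm_sub_norm_le q (z, 0)
    have e2 : ‖((z, 0) : ℂ × ℂ)‖ = ‖z‖ := by simp [Prod.norm_def]
    have e3 : C' * ‖z‖ ^ 2 ≤ 1 / 2 * ‖z‖ := by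
      rw [sq, ← mul_assoc]
      have : C' * ‖z‖ ≤ 1 / 2 := le_trans (by gcongr) hρ3
      gcongr
    linarith [norm_nonneg z]
  have hmain : ∀ (i : ℕ) (w : ℂ), ‖μ ^ i * w‖ < ρ → ‖S^[i] (w, 0) - (μ ^ i * w, 0)‖ ≤ C' * ‖μ ^ i * w‖ ^ 2 := by
    intro i
    induction i with
    | zero => intro w hw; simp; positivity
    | succ i ih =>
      intro w hw
      have hw' : ‖μ ^ i * w‖ < ρ := lt_of_le_of_lt (hpown i w) hw
      have e1 := ih w hw'
      have e2 := hball _ _ hw' e1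
      have e3 : ‖((μ ^ i * w, 0) : ℂ × ℂ)‖ < r := hball _ _ hw' (by simp; positivity)
      have e4 := hlip _ _ e2 e3
      have e5 := hq (μ ^ i * w) (by linarith)
      have e6 : μ * (μ ^ i * w) = μ ^ (i + 1) * w := by ring
      rw [iterate_succ_apply', ← e6]
      have e7 : ‖μ * (μ ^ i * w)‖ ^ 2 = b ^ 2 * ‖μ ^ i * w‖ ^ 2 := by rw [norm_mul, mul_pow]
      rw [e7]
      calc _ ≤ ‖S (S^[i] (w, 0)) - S (μ ^ i * w, 0)‖ + ‖S (μ ^ i * w, 0) - (μ * (μ ^ i * w), 0)‖ := norm_sub_le_norm_sub_add_norm_sub _ _ _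
        _ ≤ Λ * (C' * ‖μ ^ i * w‖ ^ 2) + C * ‖μ ^ i * w‖ ^ 2 := by
          refine add_le_add (e4.trans ?_) e5
          gcongr
        _ = C' * (b ^ 2 * ‖μ ^ i * w‖ ^ 2) := by rw [← mul_assoc, ← add_mul, hC'e]; ring
  have hdiff : ∀ (i : ℕ) (w : ℂ), ‖μ ^ (i + 1) * w‖ < ρ →
      ‖S^[i] (S (w, 0)) - S^[i] (μ * w, 0)‖ ≤ Λ ^ i * (C * ‖w‖ ^ 2) := by
    intro i
    induction i with
    | zero =>
      intro w hw
      have h2 : ‖w‖ < r2 := by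
        have := hpown 0 w
        simp only [zero_add, pow_zero, one_mul] at this hw
        linarith
      simpa using hq w h2
    | succ i ih =>
      intro w hw
      have hw' := lt_of_le_of_lt (hpown (i + 1) w) hw
      have e1 := ih w hw'
      have e2 : ‖S^[i] (S (w, 0))‖ < r := by
        rw [← iterate_succ_apply]
        exact hball _ _ hw' (hmain _ _ hw')
      have e3 : ‖S^[i] (μ * w, 0)‖ < r := by
        have e : μ ^ i * (μ * w) = μ ^ (i + 1) * w := by ring
        have h5 : ‖μ ^ i * (μ * w)‖ < ρ := by rw [e]; exact hw'
        exact hball _ _ h5 (hmain _ _ h5)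
      rw [iterate_succ_apply', iterate_succ_apply']
      refine (hlip _ _ e2 e3).trans ?_
      rw [pow_succ', mul_assoc]
      gcongr
  set φk : ℕ → ℂ → ℂ × ℂ := fun k ζ => S^[k] (μ⁻¹ ^ k * ζ, 0) with hφk
  have hcancel : ∀ (k : ℕ) (ζ : ℂ), μ ^ k * (μ⁻¹ ^ k * ζ) = ζ := fun k ζ => by
    rw [← mul_assoc, ← mul_pow, mul_inv_cancel₀ hμ0, one_pow, one_mul]
  set q := Λ / b ^ 2 with hqd
  have hq1 : q < 1 := by rw [hqd, div_lt_one (by positivity)]; exact hΛ2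
  have hstep : ∀ (k : ℕ) (ζ : ℂ), ‖ζ‖ < ρ → dist (φk k ζ) (φk (k + 1) ζ) ≤ (C * ρ ^ 2) * q ^ k := by
    intro k ζ hζ
    have e1 := hdiff k (μ⁻¹ ^ (k + 1) * ζ) (by rw [hcancel]; exact hζ)
    have e2 : μ * (μ⁻¹ ^ (k + 1) * ζ) = μ⁻¹ ^ k * ζ := by
      rw [pow_succ']; field_simp
    rw [e2] at e1
    rw [dist_comm, dist_eq_norm]
    simp only [hφk, iterate_succ_apply]
    refine e1.trans ?_
    have e3 : ‖μ⁻¹ ^ (k + 1) * ζ‖ ≤ (b ^ k)⁻¹ * ρ := by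
      rw [norm_mul, norm_pow, norm_inv, ← hb, inv_pow]
      have : b ^ k ≤ b ^ (k + 1) := pow_le_pow_right₀ hμ.le (by omega)
      gcongr
    calc Λ ^ k * (C * ‖μ⁻¹ ^ (k + 1) * ζ‖ ^ 2) ≤ Λ ^ k * (C * ((b ^ k)⁻¹ * ρ) ^ 2) := by gcongr
      _ = C * ρ ^ 2 * q ^ k := by
        have e4 : q ^ k = Λ ^ k / (b ^ k) ^ 2 := by
          rw [hqd, div_pow, ← pow_mul, ← pow_mul, mul_comm 2 k]
        clear_value Λ q
        rw [e4, mul_pow, inv_pow]; field_simp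
  have hlim0 : ∀ ζ : ℂ, ‖ζ‖ < ρ → ∃ l, Tendsto (fun k => φk k ζ) atTop (𝓝 l) := fun ζ hζ =>
    cauchySeq_tendsto_of_complete (cauchySeq_of_le_geometric q _ hq1 (fun k => hstep k ζ hζ))
  have hshift : ∀ (m k : ℕ) (ζ : ℂ), φk (k + m) ζ = S^[m] (φk k (μ⁻¹ ^ m * ζ)) := by
    intro m k ζ
    simp only [hφk]
    rw [← iterate_add_apply, add_comm m k]
    congr 2
    rw [pow_add]; ring
  have hexm : ∀ M : ℝ, ∃ m : ℕ, ∀ ζ : ℂ, ‖ζ‖ < M → ‖μ⁻¹ ^ m * ζ‖ < ρ := by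
    intro M
    obtain ⟨m, hm⟩ := pow_unbounded_of_one_lt (M / ρ) hμ
    refine ⟨m, fun ζ hζ => ?_⟩
    rw [norm_mul, norm_pow, norm_inv, inv_pow, inv_mul_lt_iff₀ (by positivity)]
    rw [div_lt_iff₀ hρ0] at hm
    exact hζ.trans hm
  have hlim : ∀ ζ : ℂ, ∃ l, Tendsto (fun k => φk k ζ) atTop (𝓝 l) := by
    intro ζ
    obtain ⟨m, hm⟩ := hexm (‖ζ‖ + 1)
    obtain ⟨l, hl⟩ := hlim0 _ (hm ζ (by linarith))
    refine ⟨S^[m] l, ?_⟩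
    rw [← tendsto_add_atTop_iff_nat m]
    simp only [hshift]
    exact ((hS.iterate m).continuous.tendsto l).comp hl
  choose φ hφ using hlim
  have hφd0 : DifferentiableOn ℂ φ (Metric.ball 0 ρ) := by
    have hu : TendstoUniformlyOn φk φ atTop (Metric.ball 0 ρ) := by
      rw [Metric.tendstoUniformlyOn_iff]
      intro ε hε
      have t1 : Tendsto (fun k : ℕ => (C * ρ ^ 2) * q ^ k / (1 - q)) atTop (𝓝 0) := by
        have := ((tendsto_pow_atTop_nhds_zero_of_lt_one (by positivity : 0 ≤ q) hq1).const_mul (C * ρ ^ 2)).div_const (1 - q)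
        simpa using this
      filter_upwards [t1.eventually_lt_const hε] with k hk ζ hζ
      rw [dist_comm]
      exact lt_of_le_of_lt (dist_le_of_le_geometric_of_tendsto q _ hq1 (fun k => hstep k ζ (by simpa using hζ)) (hφ ζ) k) hk
    refine hu.tendstoLocallyUniformlyOn.differentiableOn (Eventually.of_forall fun k => ?_) Metric.isOpen_ball
    exact ((hS.iterate k).comp (by fun_prop : Differentiable ℂ fun ζ : ℂ => ((μ⁻¹ ^ k * ζ, 0) : ℂ × ℂ))).differentiableOn
  have hφm : ∀ (m : ℕ) (ζ : ℂ), φ ζ = S^[m] (φ (μ⁻¹ ^ m * ζ)) := by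
    intro m ζ
    refine tendsto_nhds_unique ((tendsto_add_atTop_iff_nat m).2 (hφ ζ)) ?_
    simp only [hshift]
    exact ((hS.iterate m).continuous.tendsto _).comp (hφ _)
  refine ⟨φ, ?_, ?_, ?_, ?_⟩
  · intro ζ
    obtain ⟨m, hm⟩ := hexm (‖ζ‖ + 1)
    have e : φ = fun ζ => S^[m] (φ (μ⁻¹ ^ m * ζ)) := funext (hφm m)
    rw [e]
    have d1 : DifferentiableAt ℂ φ (μ⁻¹ ^ m * ζ) :=
      hφd0.differentiableAt (Metric.isOpen_ball.mem_nhds (by simpa using hm ζ (by linarith)))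
    have d2 : DifferentiableAt ℂ (fun ζ => φ (μ⁻¹ ^ m * ζ)) ζ :=
      DifferentiableAt.comp (g := φ) (f := fun ζ => μ⁻¹ ^ m * ζ) ζ d1 (by fun_prop)
    exact DifferentiableAt.comp (g := S^[m]) ζ (hS.iterate m).differentiableAt d2
  · refine tendsto_nhds_unique (hφ 0) ?_
    have : ∀ k, φk k 0 = 0 := by
      intro k
      simp only [hφk, mul_zero]
      exact iterate_fixed h0 k
    simp [this]
  · intro ζ
    rw [hφm 1 (μ * ζ)]
    simp [hμ0]
  · refine ⟨((ρ / 2 : ℝ) : ℂ), fun hz => ?_⟩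
    set ζ : ℂ := ((ρ / 2 : ℝ) : ℂ) with hζ
    have hn : ‖ζ‖ = ρ / 2 := by rw [hζ, Complex.norm_real, Real.norm_of_nonneg (by linarith)]
    have h3 : ∀ k, ‖φk k ζ - (ζ, 0)‖ ≤ C' * ‖ζ‖ ^ 2 := by
      intro k
      have := hmain k (μ⁻¹ ^ k * ζ) (by rw [hcancel, hn]; linarith)
      rw [hcancel] at this
      exact this
    have h4 : ‖φ ζ - (ζ, 0)‖ ≤ C' * ‖ζ‖ ^ 2 :=
      le_of_tendsto ((hφ ζ).sub_const _).norm (Eventually.of_forall h3)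
    rw [hz, zero_sub, norm_neg] at h4
    have e2 : ‖((ζ, 0) : ℂ × ℂ)‖ = ‖ζ‖ := by simp [Prod.norm_def]
    rw [e2, hn] at h4
    nlinarith

end Part12

section Part13

open InnerProductSpace

structure PSad (F : ℂ × ℂ → ℂ × ℂ) (p vs vu : ℂ × ℂ) (n : ℕ) (ls lu : ℂ) : Prop where
  hn : 1 ≤ n
  fix : F^[n] p = p
  vs0 : vs ≠ 0
  vu0 : vu ≠ 0
  Ds : fderiv ℂ (F^[n]) p vs = ls • vs
  Du : fderiv ℂ (F^[n]) p vu = lu • vu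
  ls0 : ls ≠ 0
  ls1 : ‖ls‖ < 1
  lu1 : 1 < ‖lu‖

variable {F S : ℂ × ℂ → ℂ × ℂ} {d : ℕ} {R : ℝ} {p vs vu : ℂ × ℂ} {n : ℕ} {ls lu : ℂ}

theorem HSys.VV_pos (H : HSys F S d R) {q : ℂ × ℂ} (hq : q ∈ VV R) : Gr F d R q ≠ 0 := by
  intro h
  obtain ⟨C, hC⟩ := (H.G_zero q).1 h
  have key : ∀ k : ℕ, F^[k] q ∈ VV R ∧ 2 ^ k ≤ ‖(F^[k] q).1‖ := by
    intro k
    induction k with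
    | zero => exact ⟨hq, by simpa using (H.hR.trans hq.1.le)⟩
    | succ k ih =>
      rw [iterate_succ_apply']
      have := H.st.V _ ih.1
      refine ⟨this.1, ?_⟩
      rw [pow_succ]; linarith [ih.2]
  obtain ⟨k, hk⟩ := pow_unbounded_of_one_lt C (by norm_num : (1:ℝ) < 2)
  have := (key k).2
  have h2 := hC k
  have h3 := norm_fst_le (F^[k] q)
  linarith

theorem HSys.SnF (H : HSys F S d R) (m : ℕ) (q : ℂ × ℂ) : S^[m] (F^[m] q) = q :=
  (LeftInverse.iterate H.st.li m) q
theorem HSys.FnS (H : HSys F S d R) (m : ℕ) (q : ℂ × ℂ) : F^[m] (S^[m] q) = q :=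
  (LeftInverse.iterate (f := S) (g := F) H.st.ri m) q

theorem PSad.Sp (P : PSad F p vs vu n ls lu) (H : HSys F S d R) : S^[n] p = p := by
  conv_lhs => rw [← P.fix]
  exact H.SnF n p

theorem PSad.Gp (P : PSad F p vs vu n ls lu) (H : HSys F S d R) : Gr F d R p = 0 := by
  have h := H.G_iter p n
  rw [P.fix] at h
  have h1 : (1:ℝ) < (d:ℝ) ^ n := one_lt_pow₀ (by linarith [H.d2]) (by have := P.hn; omega)
  nlinarith [H.G_nonneg p]

theorem HSys.notCV_back (H : HSys F S d R) {q : ℂ × ℂ} (hq : q ∉ CV R) (k : ℕ) :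
    S^[k] q ∉ CV R ∧ 2 ^ k * ‖q.2‖ ≤ ‖(S^[k] q).2‖ := by
  induction k with
  | zero => exact ⟨hq, by simp⟩
  | succ k ih =>
    rw [iterate_succ_apply']
    have h := H.st.W (S (S^[k] q)) (by rw [H.st.ri]; exact ih.1)
    rw [H.st.ri] at h
    refine ⟨h.1, ?_⟩
    rw [pow_succ]; linarith [h.2, ih.2]

theorem PSad.pCV (P : PSad F p vs vu n ls lu) (H : HSys F S d R) : p ∈ CV R := by
  by_contra h
  have := (H.notCV_back h n).2
  rw [P.Sp H] at this
  have h1 : (1:ℝ) < 2 ^ n := one_lt_pow₀ (by norm_num) (by have := P.hn; omega)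
  have h2 : ‖p.2‖ = 0 := by nlinarith [norm_nonneg p.2]
  apply h
  have : 0 ≤ max R ‖p.1‖ := le_trans (by linarith [H.hR]) (le_max_left _ _)
  show 3 * ‖p.2‖ ≤ max R ‖p.1‖
  rw [h2]; linarith

theorem PSad.px (P : PSad F p vs vu n ls lu) (H : HSys F S d R) : ‖p.1‖ ≤ R := by
  by_contra h
  push Not at h
  exact H.VV_pos (CV_V H.hR (P.pCV H) h) (P.Gp H)

theorem PSad.py (P : PSad F p vs vu n ls lu) (H : HSys F S d R) : 3 * ‖p.2‖ ≤ R := by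
  have h : 3 * ‖p.2‖ ≤ max R ‖p.1‖ := P.pCV H
  rwa [max_eq_left (P.px H)] at h

theorem PSad.DS (P : PSad F p vs vu n ls lu) (H : HSys F S d R) {v : ℂ × ℂ} {l : ℂ} (hl : l ≠ 0)
    (hv : fderiv ℂ (F^[n]) p v = l • v) : fderiv ℂ (S^[n]) p v = l⁻¹ • v := by
  have h1 : HasFDerivAt (F^[n]) (fderiv ℂ (F^[n]) p) p := ((H.st.diff.iterate n) p).hasFDerivAt
  have h2 : HasFDerivAt (S^[n]) (fderiv ℂ (S^[n]) p) (F^[n] p) := by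
    rw [P.fix]; exact ((H.st.diffi.iterate n) p).hasFDerivAt
  have h3 := h2.comp p h1
  have e : S^[n] ∘ F^[n] = id := funext (H.SnF n)
  rw [e] at h3
  have h4 := h3.unique (hasFDerivAt_id p)
  have h5 := congrArg (fun D => D v) h4
  simp only [ContinuousLinearMap.comp_apply, hv, map_smul, ContinuousLinearMap.id_apply] at h5
  rw [eq_inv_smul_iff₀ hl]; exact h5

theorem HSys.cdi_iter (H : HSys F S d R) (k : ℕ) : ContDiff ℂ 1 (S^[k]) := by
  induction k with
  | zero => exact contDiff_id
  | succ k ih => rw [iterate_succ]; exact ih.comp H.st.cdi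
theorem HSys.cd_iter (H : HSys F S d R) (k : ℕ) : ContDiff ℂ 1 (F^[k]) := by
  induction k with
  | zero => exact contDiff_id
  | succ k ih => rw [iterate_succ]; exact ih.comp H.st.cd

theorem PSad.frame (P : PSad F p vs vu n ls lu) :
    ∃ L : (ℂ × ℂ) ≃L[ℂ] ℂ × ℂ, ∀ w : ℂ × ℂ, L w = w.1 • vs + w.2 • vu :=
  eigen_frame P.vs0 P.vu0 P.Ds P.Du (by
    intro h
    have h1 := P.ls1
    have h2 := P.lu1
    rw [h] at h1
    linarith)

theorem PSad.stable_param (P : PSad F p vs vu n ls lu) (H : HSys F S d R) :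
    ∃ φ : ℂ → ℂ × ℂ, Differentiable ℂ φ ∧ φ 0 = p ∧ (∀ ζ, F^[n] (φ ζ) = φ (ls * ζ)) ∧ ∃ ζ, φ ζ ≠ p := by
  obtain ⟨L, hL⟩ := P.frame
  have hlu0 : lu ≠ 0 := by
    intro h
    have := P.lu1
    rw [h, norm_zero] at this
    linarith
  set Ŝ : ℂ × ℂ → ℂ × ℂ := fun w => L.symm (S^[n] (p + L w) - p) with hSh
  have hc : ContDiff ℂ 1 Ŝ :=
    L.symm.contDiff.comp (((H.cdi_iter n).comp (contDiff_const.add L.contDiff)).sub contDiff_const)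
  have h0 : Ŝ 0 = 0 := by
    simp only [hSh, map_zero, add_zero, P.Sp H, sub_self]
  have hD : HasFDerivAt Ŝ ((L.symm : (ℂ × ℂ) →L[ℂ] ℂ × ℂ).comp ((fderiv ℂ (S^[n]) p).comp (L : (ℂ × ℂ) →L[ℂ] ℂ × ℂ))) 0 := by
    have h1 : HasFDerivAt (fun w => p + L w) (L : (ℂ × ℂ) →L[ℂ] ℂ × ℂ) 0 := L.hasFDerivAt.const_add p
    have h2 : HasFDerivAt (S^[n]) (fderiv ℂ (S^[n]) p) (p + L 0) := by
      rw [map_zero, add_zero]; exact ((H.st.diffi.iterate n) p).hasFDerivAt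
    have h3 := h2.comp (0 : ℂ × ℂ) h1
    exact L.symm.hasFDerivAt.comp (0 : ℂ × ℂ) (h3.sub_const p)
  obtain ⟨φ, f1, f2, f3, f4⟩ := stable_core hc h0 (μ := ls⁻¹) (ν := lu⁻¹) (by
      rw [norm_inv]; exact (one_lt_inv₀ (norm_pos_iff.2 P.ls0)).2 P.ls1) (by
      rw [norm_inv, norm_inv]
      have := P.ls1
      have := P.lu1
      have := norm_pos_iff.2 P.ls0
      exact inv_anti₀ this (by linarith)) (by
      intro w
      rw [hD.fderiv]
      simp only [ContinuousLinearMap.comp_apply, ContinuousLinearEquiv.coe_coe, hL]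
      rw [ContinuousLinearEquiv.symm_apply_eq, hL, map_add, map_smul, map_smul, P.DS H P.ls0 P.Ds, P.DS H hlu0 P.Du]
      simp only [smul_smul, mul_comm])
  refine ⟨fun ζ => p + L (φ ζ), ?_, ?_, ?_, ?_⟩
  · exact (L.differentiable.comp f1).const_add p
  · simp only [f2, map_zero, add_zero]
  · intro ζ
    have h1 := f3 (ls * ζ)
    rw [inv_mul_cancel_left₀ P.ls0] at h1
    simp only [← h1, hSh]
    rw [ContinuousLinearEquiv.apply_symm_apply, add_sub_cancel]
    exact H.FnS n _
  · obtain ⟨ζ, hζ⟩ := f4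
    refine ⟨ζ, fun h => hζ ?_⟩
    have : L (φ ζ) = 0 := by simpa using h
    simpa using this

theorem PSad.phi_G (P : PSad F p vs vu n ls lu) (H : HSys F S d R) {φ : ℂ → ℂ × ℂ} (hφ : Differentiable ℂ φ)
    (h0 : φ 0 = p) (hT : ∀ ζ, F^[n] (φ ζ) = φ (ls * ζ)) (ζ : ℂ) : Gr F d R (φ ζ) = 0 := by
  have h1 : ∀ k : ℕ, Gr F d R (φ (ls ^ k * ζ)) = (d:ℝ) ^ (n * k) * Gr F d R (φ ζ) := by
    intro k
    induction k with
    | zero => simp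
    | succ k ih =>
      have : ls ^ (k + 1) * ζ = ls * (ls ^ k * ζ) := by ring
      rw [this, ← hT, H.G_iter, ih]; ring
  have t1 : Tendsto (fun k : ℕ => Gr F d R (φ (ls ^ k * ζ))) atTop (𝓝 0) := by
    have e : Gr F d R (φ (0 * ζ)) = 0 := by rw [zero_mul, h0, P.Gp H]
    rw [← e]
    have : Continuous (fun z => Gr F d R (φ (z * ζ))) := H.G_cont.comp (hφ.continuous.comp (by fun_prop))
    exact (this.tendsto 0).comp (tendsto_pow_atTop_nhds_zero_of_norm_lt_one P.ls1)
  refine le_antisymm (ge_of_tendsto' t1 fun k => ?_) (H.G_nonneg _)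
  rw [h1]
  exact le_mul_of_one_le_left (H.G_nonneg _) (one_le_pow₀ (by linarith [H.d2]))

theorem bounded_const {g : ℂ → ℂ × ℂ} (hg : Differentiable ℂ g) {B : ℝ} (hB : ∀ s, ‖g s‖ ≤ B) (a b : ℂ) : g a = g b := by
  refine hg.apply_eq_apply_of_bounded ?_ a b
  refine (Metric.isBounded_iff_subset_closedBall 0).2 ⟨B, ?_⟩
  rintro _ ⟨s, rfl⟩
  simpa using hB s

theorem PSad.phi_x (P : PSad F p vs vu n ls lu) (H : HSys F S d R) {φ : ℂ → ℂ × ℂ} (hφ : Differentiable ℂ φ)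
    (h0 : φ 0 = p) (hG : ∀ ζ, Gr F d R (φ ζ) = 0) (hne : ∃ ζ, φ ζ ≠ p) :
    ∃ a b, (φ a).1 ≠ (φ b).1 := by
  by_contra hcon
  push Not at hcon
  obtain ⟨M, hM⟩ := H.st.P7 (φ 0).1
  have hb : ∀ ζ, ‖φ ζ‖ ≤ max ‖(φ 0).1‖ M := by
    intro ζ
    rw [Prod.norm_def]
    refine max_le_max (by rw [hcon ζ 0]) ?_
    by_contra hh
    push Not at hh
    have h1 := hM _ hh
    rw [hcon 0 ζ] at h1
    refine H.VV_pos h1 ?_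
    have e : ((φ ζ).1, (φ ζ).2) = φ ζ := rfl
    rw [e, H.G_F, hG, mul_zero]
  obtain ⟨ζ, hζ⟩ := hne
  exact hζ ((bounded_const hφ hb ζ 0).trans h0)

theorem PSad.phi_unb (P : PSad F p vs vu n ls lu) {φ : ℂ → ℂ × ℂ} (hφ : Differentiable ℂ φ)
    (h0 : φ 0 = p) (hne : ∃ ζ, φ ζ ≠ p) (B : ℝ) : ∃ a, B < ‖φ a‖ := by
  by_contra hcon
  push Not at hcon
  obtain ⟨ζ, hζ⟩ := hne
  exact hζ ((bounded_const hφ hcon ζ 0).trans h0)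

theorem Cl.x_ne (H : HSys F S d R) {g : ℂ → ℂ × ℂ} (h : Cl F S d R g) : ∃ a b, (g a).1 ≠ (g b).1 := by
  by_contra hcon
  push Not at hcon
  have hb : ∀ s, ‖g s‖ ≤ max R ‖(g 0).1‖ := by
    intro s
    have h1 : 3 * ‖(g s).2‖ ≤ max R ‖(g s).1‖ := h.back 0 s
    rw [hcon s 0] at h1
    rw [Prod.norm_def]
    refine max_le (by rw [hcon s 0]; exact le_max_right _ _) ?_
    linarith [norm_nonneg (g s).2]
  obtain ⟨a, ha⟩ := h.zero
  obtain ⟨b, hb'⟩ := h.pos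
  rw [bounded_const h.diff hb b a, ha] at hb'
  exact lt_irrefl _ hb'

end Part13

section Part14

open InnerProductSpace

theorem pois_pack {δ : ℝ} (hδ : 0 < δ) : ∃ (Q : ℂ → ℂ) (θ : ℝ), 0 ≤ θ ∧ θ < 1 ∧
    DifferentiableOn ℂ Q (Metric.ball 0 1) ∧ ContinuousOn Q (Metric.closedBall 0 1) ∧
    (∀ ξ, ‖ξ‖ = 1 → 0 ≤ (Q ξ).re) ∧ (∀ ξ, ‖ξ‖ = 1 → δ ≤ ‖ξ - 1‖ → 1 ≤ (Q ξ).re) ∧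
    ∀ ξ, ‖ξ‖ ≤ 1 / 2 → (Q ξ).re ≤ θ := by
  obtain ⟨e, he0, he1, he2, he3⟩ : ∃ e : ℝ, 0 < e ∧ e ≤ 1 / 2 ∧ e ≤ δ / 2 ∧ e ≤ δ ^ 2 / 48 :=
    ⟨min (1/2) (min (δ / 2) (δ ^ 2 / 48)), by positivity, min_le_left _ _,
      (min_le_right _ _).trans (min_le_left _ _), (min_le_right _ _).trans (min_le_right _ _)⟩
  set c : ℝ := 1 - e with hc
  have hc0 : 0 ≤ c := by linarith
  have hc1 : c < 1 := by linarith
  set τ : ℝ := (1 - c) / (1 + c) with hτ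
  have hτ0 : 0 < τ := div_pos (by linarith) (by linarith)
  have hτ1 : τ ≤ 1 := by rw [hτ, div_le_one (by linarith)]; linarith
  set K : ℂ → ℂ := fun ξ => (1 + c * ξ) / (1 - c * ξ) with hK
  have hre : ∀ ξ, ((((1 + τ / 6 : ℝ) : ℂ) - (τ : ℂ) * K ξ)).re = 1 + τ / 6 - τ * (K ξ).re := by
    intro ξ
    rw [Complex.sub_re, Complex.re_ofReal_mul, Complex.ofReal_re]
  refine ⟨fun ξ => ((1 + τ / 6 : ℝ) : ℂ) - (τ : ℂ) * K ξ, 1 - τ / 6, by linarith, by linarith, ?_, ?_, ?_, ?_, ?_⟩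
  · intro ξ hξ
    have hne := poisson_ne hc0 hc1 (ξ := ξ) (by simpa using (le_of_lt (by simpa using hξ : ‖ξ‖ < 1)))
    refine DifferentiableAt.differentiableWithinAt ?_
    refine (differentiableAt_const _).sub ((differentiableAt_const _).mul ?_)
    exact DifferentiableAt.div (by fun_prop) (by fun_prop) hne
  · intro ξ hξ
    have hne := poisson_ne hc0 hc1 (ξ := ξ) (by simpa using hξ)
    refine ContinuousAt.continuousWithinAt ?_
    refine continuousAt_const.sub (continuousAt_const.mul ?_)
    exact ContinuousAt.div (by fun_prop) (by fun_prop) hne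
  · intro ξ hξ
    simp only [hre]
    have h1 : (K ξ).re ≤ (1 + c) / (1 - c) := by
      refine (Complex.re_le_norm _).trans ?_
      simp only [hK]
      rw [norm_div]
      have a1 : ‖1 + (c:ℂ) * ξ‖ ≤ 1 + c := by
        refine (norm_add_le _ _).trans ?_
        rw [norm_one, norm_mul, hξ, Complex.norm_real, Real.norm_of_nonneg hc0, mul_one]
      have a2 : 1 - c ≤ ‖1 - (c:ℂ) * ξ‖ := by
        have := norm_sub_norm_le (1:ℂ) ((c:ℂ) * ξ)
        rwa [norm_one, norm_mul, hξ, Complex.norm_real, Real.norm_of_nonneg hc0, mul_one] at this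
      have : 0 < 1 - c := by linarith
      gcongr
    have h2 : τ * (K ξ).re ≤ 1 := by
      have h3 : τ * ((1 + c) / (1 - c)) = 1 := by
        have : 1 - c ≠ 0 := by linarith
        have : 1 + c ≠ 0 := by linarith
        rw [hτ]; field_simp
      rw [← h3]
      gcongr
    linarith
  · intro ξ hξ hd
    simp only [hre]
    have h1 : (K ξ).re ≤ 1 / 6 := by
      simp only [hK]
      rw [poisson_re, ← Complex.sq_norm, ← Complex.sq_norm, hξ]
      have a2 : δ / 2 ≤ ‖1 - (c:ℂ) * ξ‖ := by
        have e1 : ξ - 1 = ((1 - c : ℝ) : ℂ) * ξ - (1 - (c:ℂ) * ξ) := by push_cast; ring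
        have := norm_sub_le (((1 - c : ℝ) : ℂ) * ξ) (1 - (c:ℂ) * ξ)
        rw [← e1, norm_mul, hξ, Complex.norm_real, Real.norm_of_nonneg (by linarith)] at this
        linarith
      have a3 : (δ / 2) ^ 2 ≤ ‖1 - (c:ℂ) * ξ‖ ^ 2 := by gcongr
      rw [div_le_iff₀ (lt_of_lt_of_le (by positivity) a3)]
      nlinarith
    nlinarith
  · intro ξ hξ
    simp only [hre]
    have h1 : 1 / 3 ≤ (K ξ).re := by
      simp only [hK]
      have hne := poisson_ne hc0 hc1 (ξ := ξ) (by linarith)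
      have hpos := norm_pos_iff.2 hne
      rw [poisson_re, ← Complex.sq_norm, ← Complex.sq_norm, le_div_iff₀ (by positivity), ← mul_pow]
      have a1 : ‖1 - (c:ℂ) * ξ‖ ≤ 1 + c * ‖ξ‖ := by
        refine (norm_sub_le _ _).trans ?_
        rw [norm_one, norm_mul, Complex.norm_real, Real.norm_of_nonneg hc0]
      have a2 : c * ‖ξ‖ ≤ 1 / 2 := by nlinarith [norm_nonneg ξ]
      have a3 : 0 ≤ c * ‖ξ‖ := by positivity
      have a4 : ‖1 - (c:ℂ) * ξ‖ ^ 2 ≤ (1 + c * ‖ξ‖) ^ 2 := by gcongr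
      nlinarith
    nlinarith

theorem contract {X Y A B : ℂ → ℂ} (hX : Differentiable ℂ X) (hY : Differentiable ℂ Y) (hA : Differentiable ℂ A)
    (hB : Differentiable ℂ B) (hXn : ∃ a b, X a ≠ X b) (hYn : ∃ a b, Y a ≠ Y b) {ls a : ℂ} (hl0 : ls ≠ 0)
    (hl1 : ‖ls‖ < 1) (ha : a ≠ 0) {ε c0 A0 : ℝ} (hε : 0 < ε) (hA0 : 0 ≤ A0)
    (hpos : ∀ s ζ, X s = Y ζ → 0 < ‖A s - B ζ‖)
    (hbad : ∀ (k : ℕ) (s ζ : ℂ), X s = Y ζ → ‖ls ^ k * ζ - a‖ < ε → c0 ≤ Real.log ‖A s - B ζ‖)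
    (hgrow : ∀ (j : ℕ) (s ζ : ℂ), X s = Y ζ → ‖ls‖ ^ j * ‖ζ‖ ≤ ‖a‖ / 2 → c0 - Real.log ‖A s - B ζ‖ ≤ A0 * (1 + j))
    (s ζ : ℂ) (hs : X s = Y ζ) (hζ : ‖ζ‖ ≤ ‖a‖ / 2) : c0 ≤ Real.log ‖A s - B ζ‖ := by
  have han := norm_pos_iff.2 ha
  have hln := norm_pos_iff.2 hl0
  obtain ⟨Q, θ, hθ0, hθ1, q1, q2, q3, q4, q5⟩ := pois_pack (δ := ε / ‖a‖) (by positivity)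
  obtain ⟨j0, hj0⟩ := exists_pow_lt_of_lt_one (by norm_num : (0:ℝ) < 1 / 2) hl1
  have step : ∀ (k : ℕ) (M : ℝ), 0 ≤ M →
      (∀ s ζ, X s = Y ζ → ‖ls‖ ^ (k + j0) * ‖ζ‖ ≤ ‖a‖ / 2 → c0 - Real.log ‖A s - B ζ‖ ≤ M) →
      ∀ s ζ, X s = Y ζ → ‖ls‖ ^ k * ‖ζ‖ ≤ ‖a‖ / 2 → c0 - Real.log ‖A s - B ζ‖ ≤ θ * M := by
    intro k M hM hB1 s1 ζ1 h1 h2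
    set b : ℂ := ls ^ k / a with hb
    have hb0 : b ≠ 0 := div_ne_zero (pow_ne_zero _ hl0) ha
    have hbn := norm_pos_iff.2 hb0
    have hbz : ∀ z : ℂ, ‖b * z‖ = ‖ls‖ ^ k * ‖z‖ / ‖a‖ := by
      intro z
      rw [hb, norm_mul, norm_div, norm_pow]; ring
    have hbz1 : ∀ z : ℂ, ‖z‖ ≤ ‖b‖⁻¹ → ‖b * z‖ ≤ 1 := by
      intro z hz
      rw [norm_mul]
      calc ‖b‖ * ‖z‖ ≤ ‖b‖ * ‖b‖⁻¹ := by gcongr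
        _ = 1 := mul_inv_cancel₀ hbn.ne'
    have hk : ∀ z : ℂ, ‖z‖ ≤ ‖b‖⁻¹ → ‖ls‖ ^ (k + j0) * ‖z‖ ≤ ‖a‖ / 2 := by
      intro z hz
      have h3 := hbz1 z hz
      rw [hbz, div_le_one han] at h3
      have : ‖ls‖ ^ (k + j0) * ‖z‖ = ‖ls‖ ^ j0 * (‖ls‖ ^ k * ‖z‖) := by ring
      rw [this]
      calc _ ≤ 1 / 2 * ‖a‖ := mul_le_mul hj0.le h3 (by positivity) (by norm_num)
        _ = _ := by ring
    have hmul : Differentiable ℂ (fun z : ℂ => b * z) := by fun_prop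
    have hmain := mpZ hX hY hA hB hXn hYn (ρ := ‖b‖⁻¹) (m := Real.exp (c0 - A0 * (1 + (k + j0 : ℕ)))) (Real.exp_pos _)
      (P := fun z => (M : ℂ) * Q (b * z) - (c0 : ℂ)) ?_ ?_ ?_ ?_ s1 ζ1 ?_ h1
    · rw [Complex.sub_re, Complex.re_ofReal_mul, Complex.ofReal_re] at hmain
      have h3 := q5 (b * ζ1) (by rw [hbz, div_le_iff₀ han]; linarith)
      nlinarith
    · refine (DifferentiableOn.const_mul (q1.comp hmul.differentiableOn ?_) _).sub_const _
      intro z hz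
      have hz' : ‖z‖ < ‖b‖⁻¹ := by simpa using hz
      have : ‖b * z‖ < 1 := by
        rw [norm_mul]
        calc ‖b‖ * ‖z‖ < ‖b‖ * ‖b‖⁻¹ := by gcongr
          _ = 1 := mul_inv_cancel₀ hbn.ne'
      simpa using this
    · refine (continuousOn_const.mul (q2.comp hmul.continuous.continuousOn ?_)).sub continuousOn_const
      intro z hz
      simpa using hbz1 z (by simpa using hz)
    · intro s z hz hsz
      have h3 := hgrow (k + j0) s z hsz (hk z hz)
      rw [← Real.exp_log (hpos s z hsz)]
      exact Real.exp_le_exp.2 (by linarith)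
    · intro s z hz hsz
      rw [Complex.sub_re, Complex.re_ofReal_mul, Complex.ofReal_re]
      have hz1 : ‖b * z‖ = 1 := by rw [norm_mul, hz, mul_inv_cancel₀ hbn.ne']
      rcases lt_or_ge ‖b * z - 1‖ (ε / ‖a‖) with h3 | h3
      · have h4 : ‖ls ^ k * z - a‖ < ε := by
          have e1 : ls ^ k * z - a = a * (b * z - 1) := by rw [hb]; field_simp
          rw [e1, norm_mul]
          rw [lt_div_iff₀ han] at h3
          linarith
        have h5 := hbad k s z hsz h4
        have h6 := mul_nonneg hM (q3 _ hz1)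
        linarith
      · have h4 := q4 _ hz1 h3
        have h5 := hB1 s z hsz (hk z hz.le)
        nlinarith
    · have h3 : ‖b * ζ1‖ ≤ 1 := by rw [hbz, div_le_one han]; linarith
      rw [norm_mul] at h3
      rw [← one_div, le_div_iff₀ hbn]; linarith
  have iter : ∀ (N k : ℕ) (M : ℝ), 0 ≤ M →
      (∀ s ζ, X s = Y ζ → ‖ls‖ ^ (k + N * j0) * ‖ζ‖ ≤ ‖a‖ / 2 → c0 - Real.log ‖A s - B ζ‖ ≤ M) →
      ∀ s ζ, X s = Y ζ → ‖ls‖ ^ k * ‖ζ‖ ≤ ‖a‖ / 2 → c0 - Real.log ‖A s - B ζ‖ ≤ θ ^ N * M := by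
    intro N
    induction N with
    | zero => intro k M hM h; simpa using h
    | succ N ih =>
      intro k M hM h
      have h1 := step (k + N * j0) M hM (by
        have : k + N * j0 + j0 = k + (N + 1) * j0 := by ring
        rw [this]; exact h)
      have h2 := ih k (θ * M) (by positivity) h1
      intro s ζ hs hz
      have := h2 s ζ hs hz
      rw [pow_succ]; linarith
  have hfin : ∀ N : ℕ, c0 - Real.log ‖A s - B ζ‖ ≤ θ ^ N * (A0 * (1 + (N * j0 : ℕ))) := by
    intro N
    refine iter N 0 _ (by positivity) (fun s ζ hs hz => ?_) s ζ hs (by simpa using hζ)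
    rw [zero_add] at hz
    exact hgrow _ s ζ hs hz
  have t : Tendsto (fun N : ℕ => θ ^ N * (A0 * (1 + (N * j0 : ℕ)))) atTop (𝓝 0) := by
    have t1 := tendsto_pow_atTop_nhds_zero_of_lt_one hθ0 hθ1
    have t2 := tendsto_self_mul_const_pow_of_lt_one hθ0 hθ1
    have := (t1.const_mul A0).add (t2.const_mul (A0 * j0))
    simp only [mul_zero, add_zero] at this
    refine this.congr fun N => ?_
    push_cast; ring
  linarith [ge_of_tendsto' t hfin]

end Part14

section Part15

open InnerProductSpace
variable {F S : ℂ × ℂ → ℂ × ℂ} {d : ℕ} {R : ℝ} {p vs vu : ℂ × ℂ} {n : ℕ} {ls lu : ℂ}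

theorem HSys.P4iter (H : HSys F S d R) {q : ℂ × ℂ} (hG : Gr F d R q = 0) (hy : ‖q.2‖ ≤ 3 * R) (m : ℕ) :
    ‖(F^[m] q).2‖ ≤ 3 * R := by
  induction m with
  | zero => simpa
  | succ m ih =>
    have hG' : Gr F d R (F^[m + 1] q) = 0 := by rw [H.G_iter, hG, mul_zero]
    rw [iterate_succ_apply'] at hG' ⊢
    exact H.st.P4 _ ih (fun h => H.VV_pos h hG')

theorem HSys.ybound (H : HSys F S d R) {q : ℂ × ℂ} (hG : Gr F d R q = 0) (hy : ‖q.2‖ ≤ 3 * R) : ‖q‖ ≤ 3 * R := by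
  rw [Prod.norm_def]
  refine max_le ?_ hy
  by_contra h
  push Not at h
  exact H.VV_pos (q := q) ⟨by linarith [H.hR], by linarith⟩ hG

theorem HSys.lip (H : HSys F S d R) (n : ℕ) (B : ℝ) : ∃ L : ℝ, 1 ≤ L ∧ ∀ q q' : ℂ × ℂ, ‖q‖ ≤ B → ‖q'‖ ≤ B →
    ‖F^[n] q - F^[n] q'‖ ≤ L * ‖q - q'‖ := by
  have hc : Continuous (fderiv ℂ (F^[n])) := (H.cd_iter n).continuous_fderiv one_ne_zero
  obtain ⟨L, hL⟩ := (isCompact_closedBall (0:ℂ × ℂ) B).exists_bound_of_continuousOn hc.continuousOn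
  refine ⟨max 1 L, le_max_left _ _, fun q q' hq hq' => ?_⟩
  refine Convex.norm_image_sub_le_of_norm_fderiv_le (s := Metric.closedBall (0 : ℂ × ℂ) B) (𝕜 := ℂ)
    (fun x _ => (H.st.diff.iterate n) x) (fun x hx => (hL x hx).trans (le_max_right _ _))
    (convex_closedBall _ _) (by simpa using hq') (by simpa using hq)

theorem PSad.growth (P : PSad F p vs vu n ls lu) (H : HSys F S d R) {φ : ℂ → ℂ × ℂ} (hφ : Differentiable ℂ φ)
    (h0 : φ 0 = p) (hT : ∀ ζ, F^[n] (φ ζ) = φ (ls * ζ)) (hG : ∀ ζ, Gr F d R (φ ζ) = 0)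
    {g : ℂ → ℂ × ℂ} {ε1 : ℝ} (hε : 0 < ε1) (hfar : ∀ (k : ℕ) (s : ℂ), ε1 ≤ ‖p - F^[k] (g s)‖) :
    ∃ r0 ε0 L : ℝ, 0 < r0 ∧ 0 < ε0 ∧ 1 ≤ L ∧ ∀ (j : ℕ) (ζ : ℂ), ‖(φ ζ).2‖ ≤ 3 * R → ‖ls‖ ^ j * ‖ζ‖ ≤ r0 →
      ∀ (k : ℕ) (s : ℂ), ε0 ≤ L ^ j * ‖φ ζ - F^[n * k] (g s)‖ := by
  obtain ⟨r, hr, hr'⟩ := Metric.continuousAt_iff.1 (hφ.continuous.continuousAt (x := 0)) (ε1 / 2) (by positivity)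
  obtain ⟨L, hL1, hL⟩ := H.lip n (3 * R + 1)
  refine ⟨r / 2, min (ε1 / 2) 1, L, by positivity, by positivity, hL1, ?_⟩
  intro j
  induction j with
  | zero =>
    intro ζ _ hz k s
    rw [pow_zero, one_mul] at hz ⊢
    have h1 := hr' (x := ζ) (by rw [dist_zero_right]; linarith)
    rw [h0, dist_eq_norm] at h1
    have h2 := hfar (n * k) s
    have h3 : ‖p - F^[n * k] (g s)‖ ≤ ‖φ ζ - F^[n * k] (g s)‖ + ‖φ ζ - p‖ := by
      have : p - F^[n * k] (g s) = (φ ζ - F^[n * k] (g s)) - (φ ζ - p) := by abel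
      rw [this]; exact norm_sub_le _ _
    exact (min_le_left _ _).trans (by linarith)
  | succ j ih =>
    intro ζ hy hz k s
    have hp1 : 1 ≤ L ^ (j + 1) := one_le_pow₀ hL1
    rcases le_or_gt 1 ‖φ ζ - F^[n * k] (g s)‖ with h1 | h1
    · exact (min_le_right _ _).trans (by nlinarith)
    · have h2 := H.ybound (hG ζ) hy
      have h3 : ‖F^[n * k] (g s)‖ ≤ 3 * R + 1 := by
        have := norm_sub_norm_le (F^[n * k] (g s)) (φ ζ)
        rw [norm_sub_rev] at this
        linarith
      have h4 := hL (φ ζ) _ (by linarith) h3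
      rw [hT] at h4
      have h5 := ih (ls * ζ) (by rw [← hT]; exact H.P4iter (hG ζ) hy n) (by
        rw [norm_mul, ← mul_assoc, ← pow_succ]; exact hz) (k + 1) s
      have e : F^[n * (k + 1)] (g s) = F^[n] (F^[n * k] (g s)) := by
        rw [← iterate_add_apply]; congr 2; ring
      rw [e] at h5
      refine h5.trans ?_
      rw [pow_succ, mul_assoc]
      gcongr

theorem PSad.dense (P : PSad F p vs vu n ls lu) (H : HSys F S d R) {g : ℂ → ℂ × ℂ} (h : Cl F S d R g)
    {ε1 : ℝ} (hε : 0 < ε1) : ∃ (k : ℕ) (s : ℂ), ‖p - F^[k] (g s)‖ < ε1 := by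
  by_contra hcon
  push Not at hcon
  have hR := H.hR
  obtain ⟨φ, hφ, h0, hT, hne⟩ := P.stable_param H
  have hG := P.phi_G H hφ h0 hT
  obtain ⟨r0, ε0, L, hr0, hε0, hL, hgr⟩ := P.growth H hφ h0 hT hG hε hcon
  have hxφ := P.phi_x H hφ h0 hG hne
  have hxg := h.x_ne H
  have hls := norm_pos_iff.2 P.ls0
  -- bad point
  obtain ⟨a, ha⟩ := P.phi_unb hφ h0 hne (3 * R)
  have ha3 : 3 * R < ‖(φ a).2‖ := by
    by_contra hh
    push Not at hh
    linarith [H.ybound (hG a) hh]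
  have ha0 : a ≠ 0 := by
    rintro rfl
    rw [h0] at ha3
    linarith [P.py H]
  obtain ⟨ε, hεp, hεb⟩ := Metric.continuousAt_iff.1 ((hφ.continuous.snd).continuousAt (x := a)) (‖(φ a).2‖ - 3 * R) (by linarith)
  have hbad0 : ∀ z, ‖z - a‖ < ε → 3 * R < ‖(φ z).2‖ := by
    intro z hz
    have h1 := hεb (x := z) (by rwa [dist_eq_norm])
    rw [dist_eq_norm, norm_sub_rev] at h1
    have := norm_sub_norm_le (φ a).2 (φ z).2
    linarith
  have hbad1 : ∀ (k : ℕ) (z : ℂ), 3 * R < ‖(φ (ls ^ k * z)).2‖ → 3 * R < ‖(φ z).2‖ := by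
    intro k
    induction k with
    | zero => intro z hz; simpa using hz
    | succ k ih =>
      intro z hz
      have e : ls ^ (k + 1) * z = ls ^ k * (ls * z) := by ring
      rw [e] at hz
      have h1 := ih _ hz
      by_contra hh
      push Not at hh
      have := H.P4iter (hG z) hh n
      rw [hT] at this
      linarith
  have hD : ∀ s z, (g s).1 = (φ z).1 → ‖(g s).2 - (φ z).2‖ = ‖φ z - g s‖ := by
    intro s z hsz
    rw [norm_sub_rev, Prod.norm_def, Prod.fst_sub, Prod.snd_sub, hsz, sub_self, norm_zero]
    exact (max_eq_right (norm_nonneg _)).symm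
  have hbad2 : ∀ s z, (g s).1 = (φ z).1 → 3 * R ≤ ‖(φ z).2‖ → 2 * R ≤ ‖(g s).2 - (φ z).2‖ := by
    intro s z hsz hz
    have h1 : 3 * ‖(g s).2‖ ≤ max R ‖(g s).1‖ := h.back 0 s
    have h2 := norm_sub_norm_le (φ z).2 (g s).2
    rw [norm_sub_rev] at h2
    have h3 : max R ‖(g s).1‖ ≤ ‖(φ z).2‖ := by
      refine max_le (by linarith) ?_
      by_contra hh
      push Not at hh
      rw [hsz] at hh
      exact H.VV_pos (q := φ z) ⟨by linarith, hh.le⟩ (hG z)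
    linarith
  have hpos : ∀ s z, (g s).1 = (φ z).1 → 0 < ‖(g s).2 - (φ z).2‖ := by
    intro s z hsz
    rcases le_or_gt (3 * R) ‖(φ z).2‖ with h1 | h1
    · linarith [hbad2 s z hsz h1]
    · obtain ⟨j, hj⟩ : ∃ j : ℕ, ‖ls‖ ^ j * ‖z‖ ≤ r0 := by
        obtain ⟨j, hj⟩ := exists_pow_lt_of_lt_one (show 0 < r0 / (‖z‖ + 1) by positivity) P.ls1
        refine ⟨j, ?_⟩
        rw [lt_div_iff₀ (by positivity)] at hj
        nlinarith [pow_pos hls j]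
      have := hgr j z h1.le hj 0 s
      rw [hD s z hsz]
      simp only [mul_zero, iterate_zero, id_eq] at this
      by_contra hh
      have h0' : ‖φ z - g s‖ = 0 := le_antisymm (not_lt.1 hh) (norm_nonneg _)
      rw [h0', mul_zero] at this
      linarith
  obtain ⟨J, hJ⟩ : ∃ J : ℕ, ‖ls‖ ^ J * (‖a‖ / 2) ≤ r0 := by
    obtain ⟨j, hj⟩ := exists_pow_lt_of_lt_one (show 0 < r0 / (‖a‖ / 2 + 1) by positivity) P.ls1
    refine ⟨j, ?_⟩
    rw [lt_div_iff₀ (by positivity)] at hj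
    nlinarith [pow_pos hls j]
  have hlogL : 0 ≤ Real.log L := Real.log_nonneg hL
  set A0 : ℝ := |Real.log (2 * R) - Real.log ε0| + (J + 1) * Real.log L with hA0
  have hA0p : 0 ≤ A0 := by positivity
  have hfinal : ∀ s z, (g s).1 = (φ z).1 → ‖z‖ ≤ ‖a‖ / 2 → Real.log (2 * R) ≤ Real.log ‖(g s).2 - (φ z).2‖ := by
    intro s z hsz hz
    refine contract (X := fun s => (g s).1) (Y := fun z => (φ z).1) (A := fun s => (g s).2) (B := fun z => (φ z).2)
      h.diff.fst hφ.fst h.diff.snd hφ.snd hxg hxφ P.ls0 P.ls1 ha0 hεp hA0p hpos ?_ ?_ s z hsz hz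
    · intro k s z hsz hz
      exact Real.log_le_log (by linarith) (hbad2 s z hsz (hbad1 k z (hbad0 _ hz)).le)
    · intro j s z hsz hz
      rcases le_or_gt (3 * R) ‖(φ z).2‖ with h1 | h1
      · have := Real.log_le_log (by linarith) (hbad2 s z hsz h1)
        have h3 : 0 ≤ A0 * (1 + j) := by positivity
        linarith
      · have h2 := hgr (J + j) z h1.le (by
          rw [pow_add, mul_assoc]
          refine le_trans ?_ hJ
          gcongr) 0 s
        simp only [mul_zero, iterate_zero, id_eq] at h2
        rw [← hD s z hsz] at h2
        have h3 := Real.log_le_log hε0 h2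
        rw [Real.log_mul (by positivity) (hpos s z hsz).ne', Real.log_pow] at h3
        have h4 := le_abs_self (Real.log (2 * R) - Real.log ε0)
        have h5 : 0 ≤ |Real.log (2 * R) - Real.log ε0| := abs_nonneg _
        have h6 : A0 * (1 + j) = |Real.log (2 * R) - Real.log ε0| + |Real.log (2 * R) - Real.log ε0| * j +
          (J * j + J + j + 1) * Real.log L := by rw [hA0]; ring
        push_cast at h3
        rw [h6]
        have h7 : 0 ≤ |Real.log (2 * R) - Real.log ε0| * j := by positivity
        have h8 : 0 ≤ (J * j : ℝ) * Real.log L := by positivity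
        nlinarith
  -- contradiction
  have hopen : 𝓝 ((φ 0).1) ≤ map (fun z => (φ z).1) (𝓝 0) :=
    ((hφ.fst.analyticAt 0).eventually_constant_or_nhds_le_map_nhds).resolve_left (entire_not_evconst hφ.fst hxφ 0)
  obtain ⟨r, hr, hr'⟩ := Metric.continuousAt_iff.1 (hφ.continuous.continuousAt (x := 0)) (1 / 2) (by norm_num)
  have hm : (fun z => (φ z).1) '' (Metric.ball 0 (min r (‖a‖ / 2))) ∈ 𝓝 ((φ 0).1) :=
    hopen (image_mem_map (Metric.ball_mem_nhds _ (by have := norm_pos_iff.2 ha0; positivity)))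
  obtain ⟨e, he, he'⟩ := Metric.mem_nhds_iff.1 hm
  obtain ⟨s, hs⟩ := entire_dense h.diff.fst hxg (φ 0).1 he
  obtain ⟨z, hz, hzs⟩ := he' (show (g s).1 ∈ Metric.ball ((φ 0).1) e by rwa [Metric.mem_ball, dist_eq_norm])
  have hz' : ‖z‖ < min r (‖a‖ / 2) := by simpa using hz
  have h1 := hfinal s z hzs.symm (hz'.le.trans (min_le_right _ _))
  have h2 := (Real.log_le_log_iff (by linarith) (hpos s z hzs.symm)).1 h1
  have h3 := hr' (x := z) (by rw [dist_zero_right]; exact hz'.trans_le (min_le_left _ _))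
  rw [h0, dist_eq_norm] at h3
  have h4 : 3 * ‖(g s).2‖ ≤ max R ‖(g s).1‖ := h.back 0 s
  have h5 := norm_fst_le (φ z - p)
  have h6 := norm_snd_le (φ z - p)
  rw [Prod.fst_sub] at h5
  rw [Prod.snd_sub] at h6
  have h7 := norm_sub_norm_le (φ z).1 p.1
  have h8 := norm_sub_norm_le (φ z).2 p.2
  have h9 := norm_sub_le (g s).2 (φ z).2
  have hpx := P.px H
  have hpy := P.py H
  have h10 : max R ‖(g s).1‖ ≤ R + 1 / 2 := max_le (by linarith) (by
    have : (g s).1 = (φ z).1 := hzs.symm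
    rw [this]; linarith)
  linarith

end Part15

section Part16

open InnerProductSpace
variable {F S : ℂ × ℂ → ℂ × ℂ} {d : ℕ} {R : ℝ} {p vs vu : ℂ × ℂ} {n : ℕ} {ls lu : ℂ}

theorem ulim_ball (𝒰 : Ultrafilter ℕ) {x : ℕ → ℂ} {r : ℝ} (hx : ∀ᶠ j in (𝒰 : Filter ℕ), ‖x j‖ ≤ r) :
    ∃ x0 : ℂ, ‖x0‖ ≤ r ∧ Tendsto x (𝒰 : Filter ℕ) (𝓝 x0) := by
  obtain ⟨x0, h1, h2⟩ := (isCompact_closedBall (0:ℂ) r).ultrafilter_le_nhds' (𝒰.map x) (by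
    show x ⁻¹' _ ∈ (𝒰 : Filter ℕ)
    filter_upwards [hx] with j hj
    simpa using hj)
  exact ⟨x0, by simpa using h1, h2⟩

theorem HSys.Cl_G_cont (H : HSys F S d R) {g : ℂ → ℂ × ℂ} (h : Cl F S d R g) : Continuous (fun s => Gr F d R (g s)) :=
  H.G_cont.comp h.diff.continuous

theorem HSys.Cl_real (H : HSys F S d R) {g : ℂ → ℂ × ℂ} (h : Cl F S d R g) {s : ℂ} (hs : Gr F d R (g s) = 0) : s.im = 0 := by
  by_contra hh
  exact (H.no_interior h hh).ne' hs

theorem HSys.Cl_fr (H : HSys F S d R) {g : ℂ → ℂ × ℂ} (h : Cl F S d R g) {s : ℂ} (hs : Gr F d R (g s) = 0) :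
    s ∈ frontier {z | Gr F d R (g z) = 0} := by
  refine ⟨subset_closure hs, fun hi => ?_⟩
  rw [mem_interior_iff_mem_nhds, Metric.mem_nhds_iff] at hi
  obtain ⟨e, he, hb⟩ := hi
  have h1 : s + (e / 2 : ℝ) * Complex.I ∈ Metric.ball s e := by
    rw [Metric.mem_ball, dist_eq_norm, add_sub_cancel_left, norm_mul, Complex.norm_I, Complex.norm_real,
      Real.norm_of_nonneg (by positivity)]
    linarith
  have h2 := H.Cl_real h (hb h1)
  have h3 := H.Cl_real h hs
  simp [h3] at h2
  linarith

theorem HSys.blowupCl (H : HSys F S d R) (𝒰 : Ultrafilter ℕ) {h : ℕ → ℂ → ℂ × ℂ} (hCl : ∀ j, Cl F S d R (h j))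
    (h0 : ∀ j, Gr F d R (h j 0) = 0) {C0 : ℝ}
    (hC : ∀ᶠ j in (𝒰 : Filter ℕ), ∀ s : ℂ, ‖s‖ ≤ 1 / 2 → Gr F d R (h j s) ≤ C0)
    (h1 : ∀ᶠ j in (𝒰 : Filter ℕ), ∃ s : ℂ, ‖s‖ ≤ 1 ∧ 1 ≤ Gr F d R (h j s)) :
    ∃ g', Cl F S d R g' ∧ ∀ (x : ℕ → ℂ) (x0 : ℂ), Tendsto x (𝒰 : Filter ℕ) (𝓝 x0) →
      Tendsto (fun j => h j (x j)) (𝒰 : Filter ℕ) (𝓝 (g' x0)) := by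
  have e : ∀ j, {z | z ∈ (univ : Set ℂ) ∧ Gr F d R (h j z) = 0} = {z | Gr F d R (h j z) = 0} := fun j => by simp
  obtain ⟨g', h2, h3⟩ := H.blowup 𝒰 (fun _ => univ) h C0 (fun _ => isOpen_univ) (fun j => (hCl j).diff.differentiableOn)
    (fun r => Eventually.of_forall fun j => subset_univ _)
    (fun m r => Eventually.of_forall fun j s _ => (hCl j).back m s)
    (fun r δ hδ => Eventually.of_forall fun j a ha b hb _ _ => by
      rw [e] at ha hb
      rw [Complex.sub_im, (hCl j).fr a ha, (hCl j).fr b hb, sub_zero, abs_zero]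
      positivity)
    (Eventually.of_forall fun j => by rw [e]; exact H.Cl_fr (hCl j) (h0 j)) hC h1
  refine ⟨g', h2, fun x x0 hx => ?_⟩
  rw [tendstoLocallyUniformlyOn_univ] at h3
  exact h3.tendsto_comp h2.diff.continuous.continuousAt hx

theorem HSys.Cl_Siter (H : HSys F S d R) {g : ℂ → ℂ × ℂ} (h : Cl F S d R g) (k : ℕ) :
    Cl F S d R (fun s => S^[k] (g s)) ∧ ∀ s, Gr F d R (g s) = d ^ k * Gr F d R (S^[k] (g s)) := by
  have hG : ∀ s, Gr F d R (g s) = d ^ k * Gr F d R (S^[k] (g s)) := fun s => by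
    rw [← H.G_iter, H.FnS]
  have hdk : (0:ℝ) < d ^ k := pow_pos H.d0 k
  refine ⟨⟨(H.st.diffi.iterate k).comp h.diff, fun m s => ?_, ?_, ?_, ?_⟩, hG⟩
  · rw [← iterate_add_apply]; exact h.back _ s
  · obtain ⟨s, hs⟩ := h.zero
    refine ⟨s, ?_⟩
    rw [hG] at hs
    exact (mul_eq_zero.1 hs).resolve_left hdk.ne'
  · obtain ⟨s, hs⟩ := h.pos
    rw [hG] at hs
    exact ⟨s, (mul_pos_iff_of_pos_left hdk).1 hs⟩
  · intro s hs
    refine h.fr s ?_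
    have : {s | Gr F d R (g s) = 0} = {s | Gr F d R (S^[k] (g s)) = 0} := by
      ext s
      simp only [mem_setOf_eq]
      rw [hG]; simp [hdk.ne']
    rwa [this]

theorem HSys.Cl_unb (H : HSys F S d R) {g : ℂ → ℂ × ℂ} (h : Cl F S d R g) : ∃ s, 1 ≤ Gr F d R (g s) := by
  by_contra hcon
  push Not at hcon
  obtain ⟨B, _, hB⟩ := H.CV_bound 1
  have hb : ∀ s, ‖g s‖ ≤ B := fun s => hB _ (h.back 0 s) (hcon s).le
  obtain ⟨a, ha⟩ := h.zero
  obtain ⟨b, hb'⟩ := h.pos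
  rw [bounded_const h.diff hb b a, ha] at hb'
  exact lt_irrefl _ hb'

theorem HSys.center (H : HSys F S d R) {g : ℂ → ℂ × ℂ} (h : Cl F S d R g) (s : ℂ) :
    ∃ (g' : ℂ → ℂ × ℂ) (s' : ℂ), Cl F S d R g' ∧ Gr F d R (g' 0) = 0 ∧ g' s' = g s ∧
      ∀ z ∈ Metric.ball s' ‖s'‖, 0 < Gr F d R (g' z) := by
  have hcl : IsClosed {z | Gr F d R (g z) = 0} := isClosed_eq (H.Cl_G_cont h) continuous_const
  obtain ⟨t, ht, htd⟩ := hcl.exists_infDist_eq_dist h.zero s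
  have htr : ((t.re : ℝ) : ℂ) = t := Complex.ext rfl (by simp [H.Cl_real h ht])
  refine ⟨_, s - t, h.aff t.re 1 one_ne_zero, ?_, ?_, ?_⟩
  · simpa [htr] using ht
  · simp [htr]
  · intro z hz
    refine lt_of_le_of_ne (H.G_nonneg _) (fun hh => ?_)
    simp only [htr, Complex.ofReal_one, one_mul] at hh
    have h1 := Metric.infDist_le_dist_of_mem (x := s) (show t + z ∈ {z | Gr F d R (g z) = 0} from hh.symm)
    rw [htd, dist_eq_norm, dist_eq_norm] at h1
    rw [Metric.mem_ball, dist_eq_norm, norm_sub_rev] at hz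
    have : s - (t + z) = s - t - z := by ring
    rw [this] at h1
    linarith

theorem HSys.scaleA (H : HSys F S d R) {g : ℂ → ℂ × ℂ} (h : Cl F S d R g) (h0 : Gr F d R (g 0) = 0) {s' : ℂ}
    (hpos : ∀ z ∈ Metric.ball s' ‖s'‖, 0 < Gr F d R (g z)) (hA : ∃ s : ℂ, ‖s‖ ≤ ‖s'‖ ∧ 1 ≤ Gr F d R (g s)) :
    ∃ (h' : ℂ → ℂ × ℂ) (σ : ℂ), Cl F S d R h' ∧ Gr F d R (h' 0) = 0 ∧ ‖σ‖ = 1 ∧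
      (∀ z ∈ Metric.ball σ 1, 0 < Gr F d R (h' z)) ∧ Gr F d R (h' σ) ≤ Gr F d R (g s') ∧
      (∀ s : ℂ, ‖s‖ ≤ 1 → Gr F d R (h' s) ≤ d) ∧ ∃ s : ℂ, ‖s‖ ≤ 1 ∧ 1 ≤ Gr F d R (h' s) := by
  have hd2 := H.d2
  obtain ⟨s1, hs1, hs1'⟩ := hA
  have hr : 0 < ‖s'‖ := by
    by_contra hh
    have h2 : ‖s'‖ = 0 := le_antisymm (not_lt.1 hh) (norm_nonneg _)
    have h3 : s1 = 0 := norm_le_zero_iff.1 (by linarith)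
    rw [h3, h0] at hs1'
    linarith
  set r := ‖s'‖ with hrd
  obtain ⟨sm, hsm, hmax⟩ := (isCompact_closedBall (0:ℂ) r).exists_isMaxOn ⟨0, by simp [hr.le]⟩ (H.Cl_G_cont h).continuousOn
  have hM1 : 1 ≤ Gr F d R (g sm) := hs1'.trans (hmax (show s1 ∈ Metric.closedBall 0 r by simpa using hs1))
  obtain ⟨m, hm1, hm2⟩ := exists_nat_pow_near hM1 (by linarith : (1:ℝ) < d)
  obtain ⟨hS, hSG⟩ := H.Cl_Siter h m
  have hdm : (0:ℝ) < (d:ℝ) ^ m := pow_pos H.d0 m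
  have hSG' : ∀ s, Gr F d R (S^[m] (g s)) = Gr F d R (g s) / d ^ m := fun s => by
    rw [hSG]; field_simp
  have hrc : ((r:ℝ):ℂ) ≠ 0 := by exact_mod_cast hr.ne'
  have key := hS.aff 0 r hr.ne'
  simp only [Complex.ofReal_zero, zero_add] at key
  refine ⟨fun s => S^[m] (g (r * s)), s' / r, key, ?_, ?_, ?_, ?_, ?_, ?_⟩
  · simp only [mul_zero, hSG', h0, zero_div]
  · rw [norm_div, Complex.norm_real, Real.norm_of_nonneg hr.le, ← hrd, div_self hr.ne']
  · intro z hz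
    simp only [hSG']
    refine div_pos (hpos _ ?_) hdm
    rw [Metric.mem_ball, dist_eq_norm] at hz ⊢
    have : (r:ℂ) * z - s' = r * (z - s' / r) := by field_simp
    rw [this, norm_mul, Complex.norm_real, Real.norm_of_nonneg hr.le]
    nlinarith
  · simp only [hSG']
    rw [mul_div_cancel₀ _ hrc]
    exact div_le_self (H.G_nonneg _) (one_le_pow₀ (by linarith))
  · intro s hs
    simp only [hSG']
    rw [div_le_iff₀ hdm]
    have h1 : Gr F d R (g (r * s)) ≤ Gr F d R (g sm) := hmax (show (r:ℂ) * s ∈ Metric.closedBall 0 r by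
      rw [mem_closedBall_zero_iff, norm_mul, Complex.norm_real, Real.norm_of_nonneg hr.le]
      nlinarith)
    rw [pow_succ] at hm2
    linarith
  · refine ⟨sm / r, ?_, ?_⟩
    · rw [norm_div, Complex.norm_real, Real.norm_of_nonneg hr.le, div_le_one hr]
      simpa using hsm
    · simp only [hSG']
      rw [mul_div_cancel₀ _ hrc, le_div_iff₀ hdm]
      linarith

theorem HSys.scaleB (H : HSys F S d R) {g : ℂ → ℂ × ℂ} (h : Cl F S d R g) (h0 : Gr F d R (g 0) = 0) {s' : ℂ}
    (hA : ¬ ∃ s : ℂ, ‖s‖ ≤ ‖s'‖ ∧ 1 ≤ Gr F d R (g s)) :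
    ∃ (h' : ℂ → ℂ × ℂ) (σ : ℂ), Cl F S d R h' ∧ Gr F d R (h' 0) = 0 ∧ ‖σ‖ ≤ 1 ∧ h' σ = g s' ∧
      (∀ s : ℂ, ‖s‖ ≤ 1 / 2 → Gr F d R (h' s) ≤ 1) ∧ ∃ s : ℂ, ‖s‖ ≤ 1 ∧ 1 ≤ Gr F d R (h' s) := by
  push Not at hA
  have hcl : IsClosed {z | 1 ≤ Gr F d R (g z)} := isClosed_le continuous_const (H.Cl_G_cont h)
  obtain ⟨t, ht, htd⟩ := hcl.exists_infDist_eq_dist (H.Cl_unb h) 0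
  rw [dist_zero_left] at htd
  have ht' : 1 ≤ Gr F d R (g t) := ht
  have hr : 0 < ‖t‖ := by
    rw [norm_pos_iff]
    rintro rfl
    rw [h0] at ht'
    linarith
  set r := ‖t‖ with hrd
  have hsr : ‖s'‖ ≤ r := by
    by_contra hh
    push Not at hh
    linarith [hA t hh.le]
  have hin : ∀ z : ℂ, ‖z‖ < r → Gr F d R (g z) < 1 := by
    intro z hz
    by_contra hh
    push Not at hh
    have := Metric.infDist_le_dist_of_mem (x := 0) (show z ∈ {z | 1 ≤ Gr F d R (g z)} from hh)
    rw [htd, dist_zero_left] at this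
    linarith
  have hrc : ((r:ℝ):ℂ) ≠ 0 := by exact_mod_cast hr.ne'
  have key := h.aff 0 r hr.ne'
  simp only [Complex.ofReal_zero, zero_add] at key
  refine ⟨fun s => g (r * s), s' / r, key, ?_, ?_, ?_, ?_, ?_⟩
  · simpa using h0
  · rw [norm_div, Complex.norm_real, Real.norm_of_nonneg hr.le, div_le_one hr]; exact hsr
  · simp only [mul_div_cancel₀ _ hrc]
  · intro s hs
    refine (hin _ ?_).le
    rw [norm_mul, Complex.norm_real, Real.norm_of_nonneg hr.le]
    nlinarith
  · refine ⟨t / r, ?_, ?_⟩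
    · rw [norm_div, Complex.norm_real, Real.norm_of_nonneg hr.le, ← hrd, div_self hr.ne']
    · simpa only [mul_div_cancel₀ _ hrc] using ht'

theorem PSad.lemmaP (P : PSad F p vs vu n ls lu) (H : HSys F S d R) {g : ℂ → ℂ × ℂ} (h : Cl F S d R g) :
    ∃ g', Cl F S d R g' ∧ g' 0 = p := by
  have hex : ∀ j : ℕ, ∃ (g' : ℂ → ℂ × ℂ) (s' : ℂ), Cl F S d R g' ∧ Gr F d R (g' 0) = 0 ∧
      ‖p - g' s'‖ < 1 / ((j:ℝ) + 1) ∧ ∀ z ∈ Metric.ball s' ‖s'‖, 0 < Gr F d R (g' z) := by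
    intro j
    obtain ⟨k, s, hks⟩ := P.dense H h (ε1 := 1 / ((j:ℝ) + 1)) (by positivity)
    obtain ⟨g', s', h1, h2, h3, h4⟩ := H.center (H.Cl_iter h k) s
    exact ⟨g', s', h1, h2, by rw [h3]; exact hks, h4⟩
  choose gj sj c1 c2 c3 c4 using hex
  have hlim : Tendsto (fun j => gj j (sj j)) atTop (𝓝 p) := by
    rw [tendsto_iff_norm_sub_tendsto_zero]
    refine squeeze_zero (fun _ => norm_nonneg _) (fun j => ?_) tendsto_one_div_add_atTop_nhds_zero_nat
    rw [norm_sub_rev]; exact (c3 j).le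
  have hG0 : Tendsto (fun j => Gr F d R (gj j (sj j))) atTop (𝓝 0) := by
    have := (H.G_cont.tendsto p).comp hlim
    rwa [P.Gp H] at this
  set 𝒰 : Ultrafilter ℕ := hyperfilter ℕ with h𝒰
  have hle : (𝒰 : Filter ℕ) ≤ atTop := Nat.hyperfilter_le_atTop
  rcases 𝒰.em (fun j => ∃ s : ℂ, ‖s‖ ≤ ‖sj j‖ ∧ 1 ≤ Gr F d R (gj j s)) with hA | hB
  · exfalso
    have hex2 : ∀ j : ℕ, ∃ (h' : ℂ → ℂ × ℂ) (σ : ℂ), Cl F S d R h' ∧ Gr F d R (h' 0) = 0 ∧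
        ((∃ s : ℂ, ‖s‖ ≤ ‖sj j‖ ∧ 1 ≤ Gr F d R (gj j s)) → ‖σ‖ = 1 ∧
        (∀ z ∈ Metric.ball σ 1, 0 < Gr F d R (h' z)) ∧ Gr F d R (h' σ) ≤ Gr F d R (gj j (sj j)) ∧
        (∀ s : ℂ, ‖s‖ ≤ 1 → Gr F d R (h' s) ≤ d) ∧ ∃ s : ℂ, ‖s‖ ≤ 1 ∧ 1 ≤ Gr F d R (h' s)) := by
      intro j
      by_cases hj : ∃ s : ℂ, ‖s‖ ≤ ‖sj j‖ ∧ 1 ≤ Gr F d R (gj j s)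
      · obtain ⟨h', σ, a1, a2, a3⟩ := H.scaleA (c1 j) (c2 j) (c4 j) hj
        exact ⟨h', σ, a1, a2, fun _ => a3⟩
      · exact ⟨gj j, 0, c1 j, c2 j, fun hh => absurd hh hj⟩
    choose h' σ a1 a2 a3 using hex2
    obtain ⟨g', e1, e2⟩ := H.blowupCl 𝒰 a1 a2 (C0 := d)
      (hA.mono fun j hj s hs => (a3 j hj).2.2.2.1 s (by linarith)) (hA.mono fun j hj => (a3 j hj).2.2.2.2)
    obtain ⟨σ0, s1, s2⟩ := ulim_ball 𝒰 (hA.mono fun j hj => (a3 j hj).1.le)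
    obtain ⟨w, hw1, hw2⟩ : ∃ w : ℂ, ‖w‖ = 1 / 4 ∧ (σ0 + w).im ≠ 0 := by
      by_cases hh : σ0.im = 0
      · exact ⟨(1 / 4 : ℝ) * Complex.I, by simp, by simp [hh]⟩
      · exact ⟨((1 / 4 : ℝ) : ℂ), by simp, by simpa using hh⟩
    have t1 := e2 (fun j => σ j + w) (σ0 + w) (s2.add_const w)
    have t2 := (H.G_cont.tendsto _).comp t1
    have t3 : Tendsto (fun j => 2 * Gr F d R (gj j (sj j))) (𝒰 : Filter ℕ) (𝓝 0) := by
      simpa using (hG0.mono_left hle).const_mul 2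
    have := le_of_tendsto_of_tendsto t2 t3 (hA.mono fun j hj => by
      obtain ⟨b1, b2, b3, _⟩ := a3 j hj
      have hh := ((H.isGLF isOpen_univ (a1 j).diff.differentiableOn).harnack (subset_univ _) b2 (z := σ j + w) (by
        rw [Metric.mem_ball, dist_eq_norm, add_sub_cancel_left, hw1]; norm_num)).1
      rw [add_sub_cancel_left, hw1] at hh
      simp only [comp]
      have := H.G_nonneg (h' j (σ j))
      linarith)
    linarith [H.no_interior e1 hw2]
  · have hex2 : ∀ j : ℕ, ∃ (h' : ℂ → ℂ × ℂ) (σ : ℂ), Cl F S d R h' ∧ Gr F d R (h' 0) = 0 ∧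
        ((¬ ∃ s : ℂ, ‖s‖ ≤ ‖sj j‖ ∧ 1 ≤ Gr F d R (gj j s)) → ‖σ‖ ≤ 1 ∧ h' σ = gj j (sj j) ∧
        (∀ s : ℂ, ‖s‖ ≤ 1 / 2 → Gr F d R (h' s) ≤ 1) ∧ ∃ s : ℂ, ‖s‖ ≤ 1 ∧ 1 ≤ Gr F d R (h' s)) := by
      intro j
      by_cases hj : ∃ s : ℂ, ‖s‖ ≤ ‖sj j‖ ∧ 1 ≤ Gr F d R (gj j s)
      · exact ⟨gj j, 0, c1 j, c2 j, fun hh => absurd hj hh⟩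
      · obtain ⟨h', σ, a1, a2, a3⟩ := H.scaleB (c1 j) (c2 j) hj
        exact ⟨h', σ, a1, a2, fun _ => a3⟩
    choose h' σ a1 a2 a3 using hex2
    obtain ⟨g', e1, e2⟩ := H.blowupCl 𝒰 a1 a2 (C0 := 1)
      (hB.mono fun j hj => (a3 j hj).2.2.1) (hB.mono fun j hj => (a3 j hj).2.2.2)
    obtain ⟨σ0, s1, s2⟩ := ulim_ball 𝒰 (hB.mono fun j hj => (a3 j hj).1)
    have t1 := e2 σ σ0 s2
    have t2 : Tendsto (fun j => h' j (σ j)) (𝒰 : Filter ℕ) (𝓝 p) :=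
      (hlim.mono_left hle).congr' (hB.mono fun j hj => (a3 j hj).2.1.symm)
    have hp : g' σ0 = p := tendsto_nhds_unique t1 t2
    have hre : σ0.im = 0 := H.Cl_real e1 (by rw [hp, P.Gp H])
    have htr : ((σ0.re : ℝ) : ℂ) = σ0 := Complex.ext rfl (by simp [hre])
    exact ⟨_, e1.aff σ0.re 1 one_ne_zero, by simp [htr, hp]⟩

end Part16

section Part17

open InnerProductSpace

variable {F S : ℂ × ℂ → ℂ × ℂ} {d : ℕ} {R : ℝ} {p vs vu : ℂ × ℂ} {n : ℕ} {ls lu : ℂ}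

theorem GLF.not_isolated {u : ℂ → ℝ} (h : GLF univ u) (h0 : u 0 = 0) : ∃ z, z ≠ 0 ∧ u z = 0 := by
  by_contra hcon
  push Not at hcon
  have hpos : ∀ z, z ≠ 0 → 0 < u z := fun z hz => lt_of_le_of_ne (h.nonneg z trivial) (hcon z hz).symm
  have huc : Continuous u := continuousOn_univ.1 h.cont
  obtain ⟨z1, hz1, hmin⟩ := (isCompact_sphere (0:ℂ) 1).exists_isMinOn ⟨1, by simp⟩ huc.continuousOn
  set m := u z1 with hm
  have hm0 : 0 < m := hpos z1 (by rintro rfl; simp at hz1)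
  have key : ∀ z : ℂ, z ≠ 0 → ‖z‖ < 1 → ∀ ε > 0, m - u z + ε * Real.log ‖z‖ ≤ 0 := by
    intro z hz hz1 ε hε
    set δ := min (‖z‖ / 2) (Real.exp (-(m / ε))) with hδ
    have hzp : 0 < ‖z‖ := norm_pos_iff.2 hz
    have hδ0 : 0 < δ := lt_min (by positivity) (Real.exp_pos _)
    have hδz : δ < ‖z‖ := lt_of_le_of_lt (min_le_left _ _) (by linarith)
    set B : Set ℂ := {w | δ < ‖w‖ ∧ ‖w‖ < 1} with hB
    have hBo : IsOpen B := (isOpen_lt continuous_const continuous_norm).inter (isOpen_lt continuous_norm continuous_const)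
    have hcl : closure B ⊆ {w | δ ≤ ‖w‖ ∧ ‖w‖ ≤ 1} := by
      refine closure_minimal (fun w hw => ⟨hw.1.le, hw.2.le⟩) ?_
      exact (isClosed_le continuous_const continuous_norm).inter (isClosed_le continuous_norm continuous_const)
    have hne : ∀ w ∈ closure B, w ≠ 0 := by
      rintro w hw rfl
      have := (hcl hw).1
      simp at this; linarith
    refine mp_core hBo ((Metric.isBounded_ball (x := (0:ℂ)) (r := 1)).subset (fun w hw => by simpa using hw.2) : Bornology.IsBounded B)
      (v := fun z => m - u z + ε * Real.log ‖z‖) ?_ ?_ ?_ z (subset_closure ⟨hδz, hz1⟩)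
    · refine ContinuousOn.add (continuousOn_const.sub huc.continuousOn) (continuousOn_const.mul ?_)
      exact ContinuousOn.log continuous_norm.continuousOn (fun w hw => (norm_pos_iff.2 (hne w hw)).ne')
    · intro w hw
      have hw1 := hcl hw.1
      have hw2 : w ∉ B := by rw [← hBo.interior_eq]; exact hw.2
      rcases hw1.1.eq_or_lt with h1 | h1
      · have h2 : Real.log ‖w‖ ≤ -(m / ε) := by
          rw [← h1, ← Real.log_exp (-(m / ε))]
          exact Real.log_le_log hδ0 (min_le_right _ _)
        have h3 : ε * Real.log ‖w‖ ≤ ε * (-(m / ε)) := mul_le_mul_of_nonneg_left h2 hε.le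
        have h4 : ε * (-(m / ε)) = - m := by field_simp
        have := h.nonneg w trivial
        show m - u w + ε * Real.log ‖w‖ ≤ 0
        linarith
      · have h2 : ‖w‖ = 1 := by
          by_contra h3
          exact hw2 ⟨h1, lt_of_le_of_ne hw1.2 h3⟩
        have h5 : m ≤ u w := hmin (by simpa using h2 : w ∈ Metric.sphere (0:ℂ) 1)
        show m - u w + ε * Real.log ‖w‖ ≤ 0
        rw [h2]; simp; linarith
    · intro w hw _
      have hw0 := hne w (subset_closure hw)
      have h1 : HarmonicAt (fun z : ℂ => Real.log ‖z‖) w :=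
        AnalyticAt.harmonicAt_log_norm (f := fun z => z) analyticAt_id hw0
      have h2 := HarmonicAt.const_smul (c := ε) h1
      have h3 := harmAt_sub h2 (h.harm w trivial (hpos w hw0))
      have h4 : HarmonicAt (fun _ : ℂ => m) w := by
        have := AnalyticAt.harmonicAt_re (f := fun _ : ℂ => (m:ℂ)) (x := w) analyticAt_const
        simpa using this
      have h5 := HarmonicAt.add h4 h3
      convert h5 using 2
      simp; ring
  have key2 : ∀ z : ℂ, z ≠ 0 → ‖z‖ < 1 → m ≤ u z := by
    intro z hz hz1
    have hl : Real.log ‖z‖ < 0 := Real.log_neg (norm_pos_iff.2 hz) hz1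
    by_contra hc
    push Not at hc
    have := key z hz hz1 ((m - u z) / (2 * (-Real.log ‖z‖))) (by apply div_pos <;> linarith)
    have e : (m - u z) / (2 * (-Real.log ‖z‖)) * Real.log ‖z‖ = -(m - u z) / 2 := by
      have := hl.ne
      field_simp
    rw [e] at this
    linarith
  have hev : ∀ᶠ z in 𝓝 (0:ℂ), u z < m := huc.continuousAt.eventually_lt continuousAt_const (by rw [h0]; exact hm0)
  obtain ⟨r, hr, hb⟩ := Metric.eventually_nhds_iff.1 hev
  set t : ℝ := min (r / 2) (1 / 2)
  have ht : 0 < t := lt_min (by positivity) (by norm_num)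
  have hn : ‖(t:ℂ)‖ = t := by rw [Complex.norm_real, Real.norm_of_nonneg ht.le]
  have h1 := hb (y := (t:ℂ)) (by rw [dist_zero_right, hn]; exact lt_of_le_of_lt (min_le_left _ _) (by linarith))
  have h2 := key2 (t:ℂ) (by exact_mod_cast ht.ne') (by rw [hn]; exact lt_of_le_of_lt (min_le_right _ _) (by norm_num))
  linarith

/-- backward iterates of a limit curve through the saddle converge to the saddle -/
theorem PSad.back_conv (P : PSad F p vs vu n ls lu) (H : HSys F S d R) {g : ℂ → ℂ × ℂ} (h : Cl F S d R g)
    (h0 : g 0 = p) {ε : ℝ} (hε : 0 < ε) : ∃ J : ℕ, ∀ j ≥ J, ∀ s : ℂ, ‖s‖ ≤ 1 → ‖(S^[n])^[j] (g s) - p‖ < ε := by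
  obtain ⟨B, _, hB⟩ := H.CV_bound 1
  set ρ : ℝ := 2 + 2 * (2 * |B| + 1) / ε with hρ
  have hBe : 0 < 2 * |B| + 1 := by positivity
  have hρ2 : 2 ≤ ρ := by rw [hρ]; have : 0 ≤ 2 * (2 * |B| + 1) / ε := by positivity
                         linarith
  obtain ⟨M, hM⟩ := (isCompact_closedBall (0:ℂ) ρ).exists_bound_of_continuousOn (H.Cl_G_cont h).continuousOn
  have hd := H.d2
  obtain ⟨J, hJ⟩ := pow_unbounded_of_one_lt M (by linarith : (1:ℝ) < d)
  refine ⟨J, fun j hj s hs => ?_⟩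
  rw [← iterate_mul]
  obtain ⟨h1, h2⟩ := H.Cl_Siter h (n * j)
  set gj := fun s => S^[n * j] (g s) with hgj
  have hgj0 : gj 0 = p := by
    show S^[n * j] (g 0) = p
    rw [h0, iterate_mul]
    exact iterate_fixed (P.Sp H) j
  have hbd : ∀ z ∈ Metric.ball (0:ℂ) ρ, ‖gj z‖ ≤ B := by
    intro z hz
    refine hB _ (h1.back 0 z) ?_
    have h3 := hM z (Metric.ball_subset_closedBall hz)
    rw [Real.norm_of_nonneg (H.G_nonneg _)] at h3
    have h4 : (d:ℝ) ^ J ≤ d ^ (n * j) := pow_le_pow_right₀ (by linarith) (hj.trans (Nat.le_mul_of_pos_left _ P.hn))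
    have h5 := h2 z
    have h6 := H.G_nonneg (gj z)
    by_contra hc
    push Not at hc
    have h7 : (0:ℝ) < d ^ (n * j) := pow_pos H.d0 _
    have : Gr F d R (g z) = d ^ (n * j) * Gr F d R (gj z) := h5
    nlinarith
  have hmaps : MapsTo gj (Metric.ball 0 ρ) (Metric.ball (gj 0) (2 * |B| + 1)) := by
    intro z hz
    rw [Metric.mem_ball, dist_eq_norm]
    have h3 := hbd z hz
    have h4 := hbd 0 (Metric.mem_ball_self (by linarith))
    have := norm_sub_le (gj z) (gj 0)
    have := le_abs_self B
    linarith
  have h3 := Complex.dist_le_div_mul_dist_of_mapsTo_ball h1.diff.differentiableOn (hmaps.mono_right Metric.ball_subset_closedBall) (z := s)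
    (by rw [Metric.mem_ball, dist_zero_right]; linarith)
  rw [hgj0, dist_eq_norm, dist_zero_right] at h3
  refine lt_of_le_of_lt h3 ?_
  have h4 : (2 * |B| + 1) / ρ < ε := by
    rw [div_lt_iff₀ (by linarith), hρ, mul_add, mul_div_cancel₀ _ hε.ne']
    nlinarith
  have h5 : 0 ≤ (2 * |B| + 1) / ρ := by positivity
  nlinarith [norm_nonneg s]

end Part17

section Part18

open InnerProductSpace

variable {F S : ℂ × ℂ → ℂ × ℂ} {d : ℕ} {R : ℝ} {p vs vu : ℂ × ℂ} {n : ℕ} {ls lu : ℂ}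

theorem PSad.lu0 (P : PSad F p vs vu n ls lu) : lu ≠ 0 := by
  intro h
  have := P.lu1
  rw [h, norm_zero] at this
  linarith

theorem PSad.psi_deriv (P : PSad F p vs vu n ls lu) (H : HSys F S d R) {ψ : ℂ → ℂ × ℂ} (hψ : Differentiable ℂ ψ)
    (hinj : Injective ψ) (h0 : ψ 0 = p) (hT : ∀ ζ, F^[n] (ψ ζ) = ψ (lu * ζ)) :
    ∃ v, PSad F p vs v n ls lu ∧ HasDerivAt ψ v 0 := by
  have ha : AnalyticAt ℂ (fun z => ψ z - p) 0 := (hψ.analyticAt 0).sub analyticAt_const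
  obtain ⟨m, h, hh, hh0, hev⟩ := (ha.exists_eventuallyEq_pow_smul_nonzero_iff).2 (by
    intro hc
    obtain ⟨r, hr, hb⟩ := Metric.eventually_nhds_iff.1 hc
    have h1 := hb (y := ((r / 2 : ℝ) : ℂ)) (by
      rw [dist_zero_right, Complex.norm_real, Real.norm_of_nonneg (by positivity)]; linarith)
    rw [← h0, sub_eq_zero] at h1
    have := hinj h1
    have h2 : r / 2 = 0 := by exact_mod_cast this
    linarith)
  simp only [sub_zero] at hev
  have hm : 1 ≤ m := by
    rcases Nat.eq_zero_or_pos m with h1 | h1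
    · have := hev.self_of_nhds
      simp [h1, h0] at this
      exact absurd this.symm hh0
    · exact h1
  have hlu0 := P.lu0
  set D := fderiv ℂ (F^[n]) p with hD
  have hTd : HasFDerivAt (F^[n]) D p := ((H.st.diff.iterate n) p).hasFDerivAt
  have hhc : Tendsto h (𝓝[≠] 0) (𝓝 (h 0)) := hh.continuousAt.tendsto.mono_left nhdsWithin_le_nhds
  have hlt : Tendsto (fun ζ : ℂ => lu * ζ) (𝓝 0) (𝓝 0) := by
    have : ContinuousAt (fun ζ : ℂ => lu * ζ) 0 := by fun_prop
    simpa [ContinuousAt] using this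
  have hhc2 : Tendsto (fun ζ => h (lu * ζ)) (𝓝[≠] 0) (𝓝 (h 0)) :=
    (hh.continuousAt.tendsto.comp hlt).mono_left nhdsWithin_le_nhds
  have hle : ∀ ε > 0, ‖lu ^ m • h 0 - D (h 0)‖ ≤ ε * ‖h 0‖ := by
    intro ε hε
    have h1 := hTd.isLittleO.def hε
    have hψt : Tendsto ψ (𝓝 0) (𝓝 p) := by rw [← h0]; exact hψ.continuous.tendsto 0
    have h2 := hψt.eventually h1
    have h3 : ∀ᶠ ζ in 𝓝[≠] (0:ℂ), ‖lu ^ m • h (lu * ζ) - D (h ζ)‖ ≤ ε * ‖h ζ‖ := by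
      have h2' := h2.filter_mono (nhdsWithin_le_nhds (s := {0}ᶜ))
      have h4 := hev.filter_mono (nhdsWithin_le_nhds (s := {0}ᶜ))
      have h5 := (hlt.eventually hev).filter_mono (nhdsWithin_le_nhds (s := {0}ᶜ))
      filter_upwards [h2', h4, h5, self_mem_nhdsWithin] with ζ h2 h4 h5 hζ
      have hζ' : ζ ≠ 0 := hζ
      rw [P.fix, hT, h4, h5, map_smul, mul_pow, mul_comm, mul_smul, ← smul_sub, norm_smul, norm_smul] at h2
      have : 0 < ‖ζ ^ m‖ := norm_pos_iff.2 (pow_ne_zero _ hζ')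
      refine le_of_mul_le_mul_left ?_ this
      linarith
    exact le_of_tendsto_of_tendsto ((hhc2.const_smul _).sub ((D.continuous.tendsto _).comp hhc)).norm
      (hhc.norm.const_mul ε) h3
  have hDh : D (h 0) = lu ^ m • h 0 := by
    have hn : 0 < ‖h 0‖ := norm_pos_iff.2 hh0
    have : ‖lu ^ m • h 0 - D (h 0)‖ ≤ 0 := by
      by_contra hc
      push Not at hc
      have := hle (‖lu ^ m • h 0 - D (h 0)‖ / (2 * ‖h 0‖)) (by positivity)
      have e : ‖lu ^ m • h 0 - D (h 0)‖ / (2 * ‖h 0‖) * ‖h 0‖ = ‖lu ^ m • h 0 - D (h 0)‖ / 2 := by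
        field_simp
      rw [e] at this
      linarith
    exact (sub_eq_zero.1 (norm_le_zero_iff.1 this)).symm
  obtain ⟨L, hL⟩ := P.frame
  set w := L.symm (h 0) with hw
  have hhw : h 0 = w.1 • vs + w.2 • vu := by rw [← hL, hw, ContinuousLinearEquiv.apply_symm_apply]
  have hLe : L (ls * w.1, lu * w.2) = L (lu ^ m * w.1, lu ^ m * w.2) := by
    rw [hL, hL]
    have : D (h 0) = (ls * w.1) • vs + (lu * w.2) • vu := by
      rw [hhw, map_add, map_smul, map_smul, P.Ds, P.Du, smul_smul, smul_smul, mul_comm, mul_comm lu]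
    show (ls * w.1) • vs + (lu * w.2) • vu = (lu ^ m * w.1) • vs + (lu ^ m * w.2) • vu
    rw [← this, hDh, hhw, smul_add, smul_smul, smul_smul]
  have hpe := L.injective hLe
  have e1 : ls * w.1 = lu ^ m * w.1 := congrArg Prod.fst hpe
  have e2 : lu * w.2 = lu ^ m * w.2 := congrArg Prod.snd hpe
  have hlum : 1 < ‖lu ^ m‖ := by rw [norm_pow]; exact one_lt_pow₀ P.lu1 (by omega)
  have hw1 : w.1 = 0 := by
    by_contra hc
    have := mul_right_cancel₀ hc e1
    rw [← this] at hlum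
    linarith [P.ls1]
  have hw2 : w.2 ≠ 0 := by
    intro hc
    rw [hw1, hc] at hhw
    simp at hhw
    exact hh0 hhw
  have e3 := mul_right_cancel₀ hw2 e2
  have hm1 : m = 1 := by
    by_contra hc
    have h2 : ‖lu‖ = ‖lu‖ ^ m := by rw [← norm_pow, ← e3]
    have h3 : ‖lu‖ ^ 1 < ‖lu‖ ^ m := pow_lt_pow_right₀ P.lu1 (by omega)
    rw [pow_one] at h3
    linarith
  subst hm1
  refine ⟨h 0, ⟨P.hn, P.fix, P.vs0, hh0, P.Ds, ?_, P.ls0, P.ls1, P.lu1⟩, ?_⟩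
  · have := hDh
    rw [pow_one] at this
    exact this
  · have h1 : HasDerivAt (fun ζ : ℂ => ζ • h ζ) ((0:ℂ) • deriv h 0 + (1:ℂ) • h 0) 0 :=
      (hasDerivAt_id (0:ℂ)).smul hh.differentiableAt.hasDerivAt
    rw [zero_smul, zero_add, one_smul] at h1
    have h2 : HasDerivAt (fun z => ψ z - p) (h 0) 0 := h1.congr_of_eventuallyEq (by
      filter_upwards [hev] with z hz
      rw [hz, pow_one])
    have h3 := h2.add_const p
    simp only [sub_add_cancel] at h3
    exact h3

end Part18

section Part19

open InnerProductSpace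

variable {F S : ℂ × ℂ → ℂ × ℂ} {d : ℕ} {R : ℝ} {p vs vu : ℂ × ℂ} {n : ℕ} {ls lu : ℂ}

theorem PSad.chart (P : PSad F p vs vu n ls lu) (H : HSys F S d R) {ψ : ℂ → ℂ × ℂ} (hψ : Differentiable ℂ ψ)
    (hder : HasDerivAt ψ vu 0) (h0 : ψ 0 = p) (hT : ∀ ζ, F^[n] (ψ ζ) = ψ (lu * ζ)) :
    ∃ (B : ℂ × ℂ → ℂ × ℂ) (θ : ℝ), 0 ≤ θ ∧ θ < 1 ∧ B p = 0 ∧ (∀ᶠ q in 𝓝 p, DifferentiableAt ℂ B q) ∧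
      (∀ᶠ q in 𝓝 p, ψ (B q).2 + (B q).1 • vs = q) ∧
      ∀ᶠ q in 𝓝 p, ‖(B (F^[n] q)).1‖ ≤ θ * ‖(B q).1‖ := by
  obtain ⟨L, hL⟩ := P.frame
  set Ψ : ℂ × ℂ → ℂ × ℂ := fun w => ψ w.2 + w.1 • vs with hΨ
  have hΨ0 : Ψ 0 = p := by simp [hΨ, h0]
  have hψc : ContDiff ℂ 1 ψ := hψ.contDiff
  have hΨc : ContDiff ℂ 1 Ψ := (hψc.comp contDiff_snd).add (contDiff_fst.smul contDiff_const)
  have hΨd : HasFDerivAt Ψ (L : (ℂ × ℂ) →L[ℂ] ℂ × ℂ) 0 := by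
    have h1 : HasFDerivAt (fun w : ℂ × ℂ => ψ w.2)
        ((ContinuousLinearMap.toSpanSingleton ℂ vu).comp (ContinuousLinearMap.snd ℂ ℂ ℂ)) 0 :=
      HasFDerivAt.comp (g := ψ) (f := Prod.snd) (0 : ℂ × ℂ) hder.hasFDerivAt hasFDerivAt_snd
    have h2 : HasFDerivAt (fun w : ℂ × ℂ => w.1 • vs)
        ((ContinuousLinearMap.toSpanSingleton ℂ vs).comp (ContinuousLinearMap.fst ℂ ℂ ℂ)) 0 :=
      HasFDerivAt.comp (g := fun z : ℂ => z • vs) (f := Prod.fst) (0 : ℂ × ℂ)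
        (ContinuousLinearMap.toSpanSingleton ℂ vs).hasFDerivAt hasFDerivAt_fst
    have h3 := h1.add h2
    have e : (L : (ℂ × ℂ) →L[ℂ] ℂ × ℂ) = (ContinuousLinearMap.toSpanSingleton ℂ vu).comp (ContinuousLinearMap.snd ℂ ℂ ℂ)
        + (ContinuousLinearMap.toSpanSingleton ℂ vs).comp (ContinuousLinearMap.fst ℂ ℂ ℂ) := by
      refine ContinuousLinearMap.ext fun w => ?_
      simp only [ContinuousLinearEquiv.coe_coe, hL, ContinuousLinearMap.add_apply, ContinuousLinearMap.comp_apply,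
        ContinuousLinearMap.toSpanSingleton_apply, ContinuousLinearMap.coe_fst', ContinuousLinearMap.coe_snd']
      exact add_comm _ _
    rw [e]; exact h3
  obtain ⟨B, hB1, hB2, hB3, hB4⟩ := ift hΨc.contDiffAt hΨd
  rw [hΨ0] at hB1 hB2 hB3
  have hTc := H.cd_iter n
  -- derivative of `B` at `p`
  have hBd : HasFDerivAt B (L.symm : (ℂ × ℂ) →L[ℂ] ℂ × ℂ) p := by
    have h1 := (hB1.differentiableAt one_ne_zero).hasFDerivAt
    have h2 : HasFDerivAt (B ∘ Ψ) ((fderiv ℂ B p).comp (L : (ℂ × ℂ) →L[ℂ] ℂ × ℂ)) 0 :=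
      HasFDerivAt.comp (0 : ℂ × ℂ) (by rw [hΨ0]; exact h1) hΨd
    have h3 : HasFDerivAt (B ∘ Ψ) (ContinuousLinearMap.id ℂ (ℂ × ℂ)) 0 :=
      (hasFDerivAt_id (0 : ℂ × ℂ)).congr_of_eventuallyEq hB4
    have h4 := h2.unique h3
    have e : fderiv ℂ B p = L.symm := by
      refine ContinuousLinearMap.ext fun w => ?_
      have := congrArg (fun A : (ℂ × ℂ) →L[ℂ] ℂ × ℂ => A (L.symm w)) h4
      simp only [ContinuousLinearMap.comp_apply, ContinuousLinearEquiv.coe_coe,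
        ContinuousLinearEquiv.apply_symm_apply, ContinuousLinearMap.id_apply] at this
      exact this
    rw [← e]; exact h1
  have hBev : ∀ᶠ q in 𝓝 p, DifferentiableAt ℂ B q := by
    have := hB1.eventually (by simp)
    filter_upwards [this] with q hq using hq.differentiableAt one_ne_zero
  -- conjugated map
  set N : ℂ × ℂ → ℂ := fun w => (B (F^[n] (Ψ w))).1 with hN
  have hTΨ0 : F^[n] (Ψ 0) = p := by rw [hΨ0, P.fix]
  have hNc : ContDiffAt ℂ 1 N 0 := by
    have h1 : ContDiffAt ℂ 1 (fun w => F^[n] (Ψ w)) 0 := (hTc.comp hΨc).contDiffAt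
    have h2 : ContDiffAt ℂ 1 (fun w => B (F^[n] (Ψ w))) 0 :=
      ContDiffAt.comp (g := B) (0 : ℂ × ℂ) (by rw [hTΨ0]; exact hB1) h1
    exact contDiff_fst.contDiffAt.comp (0 : ℂ × ℂ) h2
  have hNd : HasFDerivAt N ((ContinuousLinearMap.fst ℂ ℂ ℂ).comp ((L.symm : (ℂ × ℂ) →L[ℂ] ℂ × ℂ).comp
      ((fderiv ℂ (F^[n]) p).comp (L : (ℂ × ℂ) →L[ℂ] ℂ × ℂ)))) 0 := by
    have h1 : HasFDerivAt (F^[n]) (fderiv ℂ (F^[n]) p) (Ψ 0) := by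
      rw [hΨ0]; exact ((H.st.diff.iterate n) p).hasFDerivAt
    have h2 := h1.comp (0 : ℂ × ℂ) hΨd
    have h3 : HasFDerivAt B (L.symm : (ℂ × ℂ) →L[ℂ] ℂ × ℂ) ((F^[n] ∘ Ψ) 0) := by
      show HasFDerivAt B (L.symm : (ℂ × ℂ) →L[ℂ] ℂ × ℂ) (F^[n] (Ψ 0))
      rw [hTΨ0]; exact hBd
    have h4 := h3.comp (0 : ℂ × ℂ) h2
    exact (hasFDerivAt_fst (p := B (F^[n] (Ψ 0)))).comp (0 : ℂ × ℂ) h4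
  have hstrict := hNc.hasStrictFDerivAt' hNd one_ne_zero
  set N' := (ContinuousLinearMap.fst ℂ ℂ ℂ).comp ((L.symm : (ℂ × ℂ) →L[ℂ] ℂ × ℂ).comp
      ((fderiv ℂ (F^[n]) p).comp (L : (ℂ × ℂ) →L[ℂ] ℂ × ℂ))) with hN'
  have hN'v : ∀ w : ℂ, N' (w, 0) = ls * w := by
    intro w
    have e1 : L (w, 0) = w • vs := by rw [hL]; simp
    have e2 : L.symm (fderiv ℂ (F^[n]) p (L (w, 0))) = (ls * w, 0) := by
      rw [ContinuousLinearEquiv.symm_apply_eq, e1, map_smul, P.Ds, hL, smul_smul, mul_comm]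
      simp
    show (L.symm (fderiv ℂ (F^[n]) p (L (w, 0)))).1 = ls * w
    rw [e2]
  have hls1 := P.ls1
  set c : ℝ := (1 - ‖ls‖) / 2 with hc
  have hc0 : 0 < c := by rw [hc]; linarith
  have hlo := hstrict.isLittleO.def hc0
  rw [nhds_prod_eq] at hlo
  have hpair : Tendsto (fun w : ℂ × ℂ => (w, ((0:ℂ), w.2))) (𝓝 0) (𝓝 (0 : ℂ × ℂ) ×ˢ 𝓝 (0 : ℂ × ℂ)) := by
    refine Tendsto.prodMk tendsto_id ?_
    have : Continuous (fun w : ℂ × ℂ => ((0:ℂ), w.2)) := by fun_prop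
    have := this.tendsto 0
    exact this
  have hlo2 := hpair.eventually hlo
  have hNz : ∀ᶠ w in 𝓝 (0 : ℂ × ℂ), N (0, w.2) = 0 := by
    have ht : Tendsto (fun w : ℂ × ℂ => ((0:ℂ), lu * w.2)) (𝓝 0) (𝓝 0) := by
      have : Continuous (fun w : ℂ × ℂ => ((0:ℂ), lu * w.2)) := by fun_prop
      have := this.tendsto 0
      simp only [Prod.snd_zero, mul_zero] at this
      exact this
    filter_upwards [ht.eventually hB4] with w hw
    have e : F^[n] (Ψ (0, w.2)) = Ψ (0, lu * w.2) := by simp [hΨ, hT]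
    show (B (F^[n] (Ψ (0, w.2)))).1 = 0
    rw [e, hw]
  have hcon : ∀ᶠ w in 𝓝 (0 : ℂ × ℂ), ‖N w‖ ≤ (c + ‖ls‖) * ‖w.1‖ := by
    filter_upwards [hlo2, hNz] with w h1 h2
    have e : w - (0, w.2) = (w.1, 0) := by ext <;> simp
    simp only [e, h2, hN'v, sub_zero] at h1
    have e2 : ‖((w.1, 0) : ℂ × ℂ)‖ = ‖w.1‖ := by simp [Prod.norm_def]
    rw [e2] at h1
    have h3 : ‖N w‖ ≤ ‖N w - ls * w.1‖ + ‖ls * w.1‖ := by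
      have := norm_add_le (N w - ls * w.1) (ls * w.1)
      rwa [sub_add_cancel] at this
    rw [norm_mul] at h3
    linarith
  have hBt : Tendsto B (𝓝 p) (𝓝 0) := by
    have := hB1.continuousAt.tendsto
    rwa [hB2] at this
  refine ⟨B, c + ‖ls‖, by positivity, by rw [hc]; linarith, hB2, hBev, hB3, ?_⟩
  filter_upwards [hBt.eventually hcon, hB3] with q h1 h2
  have e : N (B q) = (B (F^[n] q)).1 := by
    show (B (F^[n] (Ψ (B q)))).1 = _
    rw [h2]
  rwa [e] at h1

theorem PSad.sigma (P : PSad F p vs vu n ls lu) (H : HSys F S d R) {ψ : ℂ → ℂ × ℂ} (hψ : Differentiable ℂ ψ)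
    (hder : HasDerivAt ψ vu 0) (h0 : ψ 0 = p) (hT : ∀ ζ, F^[n] (ψ ζ) = ψ (lu * ζ))
    {g : ℂ → ℂ × ℂ} (h : Cl F S d R g) (hg0 : g 0 = p) :
    ∃ σ : ℂ → ℂ, AnalyticAt ℂ σ 0 ∧ σ 0 = 0 ∧ (∀ᶠ s in 𝓝 0, g s = ψ (σ s)) ∧ ¬ ∀ᶠ s in 𝓝 0, σ s = 0 := by
  obtain ⟨B, θ, hθ0, hθ1, hBp, hBd, hBi, hBc⟩ := P.chart H hψ hder h0 hT
  have hB1 : ∀ᶠ q in 𝓝 p, ‖(B q).1‖ ≤ 1 := by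
    have hc : ContinuousAt (fun q => ‖(B q).1‖) p := by
      have := hBd.self_of_nhds.continuousAt
      fun_prop
    have h1 : ∀ᶠ q in 𝓝 p, ‖(B q).1‖ < 1 := hc.eventually_lt continuousAt_const (by simp [hBp])
    exact h1.mono fun q hq => hq.le
  obtain ⟨ε, hε, hall⟩ := Metric.eventually_nhds_iff.1 (hBd.and (hBi.and (hBc.and hB1)))
  obtain ⟨J, hJ⟩ := P.back_conv H h hg0 hε
  set q : ℕ → ℂ → ℂ × ℂ := fun j s => (S^[n])^[j] (g s) with hq
  have hTq : ∀ j s, F^[n] (q (j + 1) s) = q j s := by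
    intro j s
    show F^[n] ((S^[n])^[j + 1] (g s)) = _
    rw [iterate_succ_apply', H.FnS]
  have hprop : ∀ j ≥ J, ∀ s : ℂ, ‖s‖ ≤ 1 → _ := fun j hj s hs => hall (y := q j s) (by
    rw [dist_eq_norm]; exact hJ j hj s hs)
  have hdec : ∀ (i : ℕ) (s : ℂ), ‖s‖ ≤ 1 → ‖(B (q J s)).1‖ ≤ θ ^ i * ‖(B (q (J + i) s)).1‖ := by
    intro i s hs
    induction i with
    | zero => simp
    | succ i ih =>
      have h1 := (hprop (J + i + 1) (by omega) s hs).2.2.1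
      rw [hTq] at h1
      calc _ ≤ _ := ih
        _ ≤ θ ^ i * (θ * ‖(B (q (J + i + 1) s)).1‖) := mul_le_mul_of_nonneg_left h1 (by positivity)
        _ = _ := by rw [pow_succ]; ring_nf
  have hz : ∀ s : ℂ, ‖s‖ ≤ 1 → (B (q J s)).1 = 0 := by
    intro s hs
    have h1 : ∀ i : ℕ, ‖(B (q J s)).1‖ ≤ θ ^ i := fun i => by
      have h2 := hdec i s hs
      have h3 := (hprop (J + i) (by omega) s hs).2.2.2
      have h4 : 0 ≤ θ ^ i := by positivity
      nlinarith
    have h2 : ‖(B (q J s)).1‖ ≤ 0 :=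
      ge_of_tendsto' (tendsto_pow_atTop_nhds_zero_of_lt_one hθ0 hθ1) h1
    exact norm_le_zero_iff.1 h2
  set σ : ℂ → ℂ := fun s => lu ^ J * (B (q J s)).2 with hσ
  have hgσ : ∀ s : ℂ, ‖s‖ ≤ 1 → g s = ψ (σ s) := by
    intro s hs
    have h1 := (hprop J le_rfl s hs).2.1
    rw [hz s hs, zero_smul, add_zero] at h1
    have h2 : ∀ (j : ℕ) (ζ : ℂ), (F^[n])^[j] (ψ ζ) = ψ (lu ^ j * ζ) := by
      intro j ζ
      induction j with
      | zero => simp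
      | succ j ih => rw [iterate_succ_apply', ih, hT, pow_succ]; congr 1; ring
    have h3 : (F^[n])^[J] (q J s) = g s := by
      show (F^[n])^[J] ((S^[n])^[J] (g s)) = g s
      rw [← iterate_mul, ← iterate_mul, H.FnS]
    rw [← h3, ← h1, h2]
  have hdiff : DifferentiableOn ℂ σ (Metric.ball 0 1) := by
    intro s hs
    have hs' : ‖s‖ ≤ 1 := by
      rw [Metric.mem_ball, dist_zero_right] at hs; exact hs.le
    have h1 := (hprop J le_rfl s hs').1
    have h2 : DifferentiableAt ℂ (q J) s := by
      have : q J = fun s => S^[n * J] (g s) := by ext1 s; show (S^[n])^[J] (g s) = _; rw [iterate_mul]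
      rw [this]
      exact (H.Cl_Siter h (n * J)).1.diff s
    have h3 : DifferentiableAt ℂ (fun s => B (q J s)) s := DifferentiableAt.comp (g := B) s h1 h2
    exact ((h3.snd).const_mul _).differentiableWithinAt
  have hball : Metric.ball (0:ℂ) 1 ∈ 𝓝 (0:ℂ) := Metric.ball_mem_nhds _ one_pos
  refine ⟨σ, hdiff.analyticAt hball, ?_, ?_, ?_⟩
  · have : q J 0 = p := by
      show (S^[n])^[J] (g 0) = p
      rw [hg0]; exact iterate_fixed (P.Sp H) J
    show lu ^ J * (B (q J 0)).2 = 0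
    rw [this, hBp]; simp
  · filter_upwards [hball] with s hs
    rw [Metric.mem_ball, dist_zero_right] at hs
    exact hgσ s hs.le
  · intro hcon
    refine entire_not_evconst (X := fun s => (g s).1) (h.diff.fst) (h.x_ne H) 0 ?_
    filter_upwards [hcon, hball] with s h1 hs
    rw [Metric.mem_ball, dist_zero_right] at hs
    rw [hgσ s hs.le, h1, hg0, h0]

end Part19

section Part20

open InnerProductSpace

variable {F S : ℂ × ℂ → ℂ × ℂ} {d : ℕ} {R : ℝ} {p vs vu : ℂ × ℂ} {n : ℕ} {ls lu : ℂ}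

theorem near_line {E : Set ℂ} {σ : ℂ → ℂ} (hσ : AnalyticAt ℂ σ 0) (h0 : σ 0 = 0) (hne : ¬ ∀ᶠ s in 𝓝 0, σ s = 0)
    (hE : ∀ᶠ s in 𝓝 0, σ s ∈ E → s.im = 0) :
    ∃ c : ℂ, c ≠ 0 ∧ ∀ δ > 0, ∀ᶠ ζ in 𝓝 (0:ℂ), ζ ∈ E → |(ζ / c).im| ≤ δ * ‖ζ / c‖ := by
  obtain ⟨m, h, hh, hh0, hev⟩ := (hσ.exists_eventuallyEq_pow_smul_nonzero_iff).2 hne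
  simp only [sub_zero, smul_eq_mul] at hev
  refine ⟨h 0, hh0, fun δ hδ => ?_⟩
  have hop : 𝓝 (0:ℂ) ≤ map σ (𝓝 0) := by
    have := hσ.eventually_constant_or_nhds_le_map_nhds
    rw [h0] at this
    exact this.resolve_left hne
  refine hop ?_
  show ∀ᶠ s in 𝓝 0, σ s ∈ E → |(σ s / h 0).im| ≤ δ * ‖σ s / h 0‖
  have hc : ContinuousAt (fun s => h s / h 0) 0 := hh.continuousAt.div_const _
  have h1 : ∀ᶠ s in 𝓝 0, |(h s / h 0).im| < δ * ‖h s / h 0‖ := by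
    refine ContinuousAt.eventually_lt (f := fun s => |(h s / h 0).im|) (g := fun s => δ * ‖h s / h 0‖) ?_ ?_ ?_
    · exact (Complex.continuous_im.continuousAt.comp hc).abs
    · exact continuousAt_const.mul hc.norm
    · simp only [div_self hh0]; simpa using hδ
  filter_upwards [hev, h1, hE] with s h2 h3 h4 h5
  have h6 := h4 h5
  have hs : s = (s.re : ℂ) := by apply Complex.ext <;> simp [h6]
  have e : σ s / h 0 = ((s.re ^ m : ℝ) : ℂ) * (h s / h 0) := by
    rw [h2]
    conv_lhs => rw [hs]
    push_cast
    rw [← hs]; ring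
  rw [e, Complex.im_ofReal_mul, abs_mul, norm_mul, Complex.norm_real, Real.norm_eq_abs]
  nlinarith [abs_nonneg (s.re ^ m)]

theorem lu_real {E : Set ℂ} {c : ℂ} (hc : c ≠ 0)
    (hE : ∀ δ > 0, ∀ᶠ ζ in 𝓝 (0:ℂ), ζ ∈ E → |(ζ / c).im| ≤ δ * ‖ζ / c‖) {lu : ℂ} (hlu : 1 < ‖lu‖)
    (hinv : ∀ ζ, ζ ∈ E → lu⁻¹ * ζ ∈ E) {ζ : ℂ} (hζ : ζ ∈ E) (hζ0 : ζ ≠ 0) : lu.im = 0 ∧ (ζ / c).im = 0 := by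
  set w := lu⁻¹ with hw
  have hlu0 : lu ≠ 0 := by rintro rfl; simp at hlu; linarith
  have hw0 : w ≠ 0 := inv_ne_zero hlu0
  have hw1 : ‖w‖ < 1 := by rw [hw, norm_inv]; exact inv_lt_one_of_one_lt₀ hlu
  have hmem : ∀ k : ℕ, w ^ k * ζ ∈ E := by
    intro k
    induction k with
    | zero => simpa using hζ
    | succ k ih => rw [pow_succ', mul_assoc]; exact hinv _ ih
  have hlim : Tendsto (fun k : ℕ => w ^ k * ζ) atTop (𝓝 0) := by
    have := (tendsto_pow_atTop_nhds_zero_of_norm_lt_one hw1).mul_const ζ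
    simpa using this
  set x := ζ / c with hx
  have hx0 : x ≠ 0 := div_ne_zero hζ0 hc
  have hk : ∀ δ > 0, ∃ k : ℕ, |(w ^ k * x).im| ≤ δ * ‖w ^ k * x‖ ∧ |(w * (w ^ k * x)).im| ≤ δ * ‖w * (w ^ k * x)‖ := by
    intro δ hδ
    have h1 := hlim.eventually (hE δ hδ)
    obtain ⟨K, hK⟩ := eventually_atTop.1 h1
    have e : ∀ k : ℕ, w ^ k * ζ / c = w ^ k * x := fun k => by rw [hx]; ring
    refine ⟨K, ?_, ?_⟩
    · have := hK K le_rfl (hmem K)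
      rwa [e] at this
    · have := hK (K + 1) (by omega) (hmem _)
      rwa [e, pow_succ', mul_assoc] at this
  have hwim : w.im = 0 := by
    by_contra hc
    have hwi : 0 < |w.im| := abs_pos.2 hc
    have hwn : 0 < ‖w‖ := norm_pos_iff.2 hw0
    obtain ⟨k, h1, h2⟩ := hk (min (1 / 2) (|w.im| / (8 * ‖w‖))) (lt_min (by norm_num) (by positivity))
    set δ := min (1 / 2) (|w.im| / (8 * ‖w‖)) with hδ
    set X := w ^ k * x with hX
    have hXn : 0 < ‖X‖ := norm_pos_iff.2 (mul_ne_zero (pow_ne_zero _ hw0) hx0)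
    have hδ0 : 0 < δ := lt_min (by norm_num) (by positivity)
    have hδ1 : δ ≤ 1 / 2 := min_le_left _ _
    have hδ2 : δ * ‖w‖ ≤ |w.im| / 8 := by
      have : δ ≤ |w.im| / (8 * ‖w‖) := min_le_right _ _
      rw [le_div_iff₀ (by positivity)] at this
      linarith
    have h3 : ‖X‖ ≤ |X.re| + |X.im| := Complex.norm_le_abs_re_add_abs_im X
    have h4 : ‖X‖ / 2 ≤ |X.re| := by nlinarith
    rw [Complex.mul_im, norm_mul] at h2
    have h5 : |w.im * X.re| ≤ |w.re * X.im + w.im * X.re| + |w.re * X.im| := by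
      have := abs_sub (w.re * X.im + w.im * X.re) (w.re * X.im)
      rwa [add_sub_cancel_left] at this
    rw [abs_mul, abs_mul w.re] at h5
    have h6 : |w.re| ≤ ‖w‖ := Complex.abs_re_le_norm w
    have h7 : |w.re| * |X.im| ≤ ‖w‖ * (δ * ‖X‖) := mul_le_mul h6 h1 (abs_nonneg _) hwn.le
    have h8 : |w.im| * (‖X‖ / 2) ≤ |w.im| * |X.re| := mul_le_mul_of_nonneg_left h4 hwi.le
    have h9 : δ * ‖w‖ * ‖X‖ ≤ |w.im| / 8 * ‖X‖ := mul_le_mul_of_nonneg_right hδ2 hXn.le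
    have h10 : 0 < |w.im| * ‖X‖ := mul_pos hwi hXn
    nlinarith
  have hwr : w = (w.re : ℂ) := by apply Complex.ext <;> simp [hwim]
  refine ⟨?_, ?_⟩
  · have : lu = ((w.re)⁻¹ : ℝ) := by
      rw [Complex.ofReal_inv, ← hwr, hw, inv_inv]
    rw [this, Complex.ofReal_im]
  · by_contra hc
    have hxi : 0 < |x.im| := abs_pos.2 hc
    have hxn : 0 < ‖x‖ := norm_pos_iff.2 hx0
    obtain ⟨k, h1, -⟩ := hk (|x.im| / (2 * ‖x‖)) (by positivity)
    have e : w ^ k * x = ((w.re ^ k : ℝ) : ℂ) * x := by push_cast; rw [← hwr]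
    have hwk : 0 < |w.re ^ k| := abs_pos.2 (pow_ne_zero _ (by intro h; rw [h] at hwr; simp at hwr; exact hw0 hwr))
    rw [e, Complex.im_ofReal_mul, abs_mul, norm_mul, Complex.norm_real, Real.norm_eq_abs] at h1
    have e2 : |x.im| / (2 * ‖x‖) * (|w.re ^ k| * ‖x‖) = |w.re ^ k| * (|x.im| / 2) := by field_simp
    rw [e2] at h1
    have := le_of_mul_le_mul_left h1 hwk
    linarith

theorem PSad.final (P : PSad F p vs vu n ls lu) (H : HSys F S d R) {ψ : ℂ → ℂ × ℂ} (hψ : Differentiable ℂ ψ)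
    (hinj : Injective ψ) (h0 : ψ 0 = p) (hT : ∀ ζ, F^[n] (ψ ζ) = ψ (lu * ζ)) {g : ℂ → ℂ × ℂ} (h : Cl F S d R g) :
    (∃ v : ℂ, v ≠ 0 ∧ frontier (ψ ⁻¹' Kplus F) ⊆ {w : ℂ | ∃ t : ℝ, w = (t : ℂ) * v}) ∧ lu.im = 0 := by
  obtain ⟨g1, h1, hg1⟩ := P.lemmaP H h
  obtain ⟨v, P', hder⟩ := P.psi_deriv H hψ hinj h0 hT
  obtain ⟨σ, hσ, hσ0, hgσ, hσne⟩ := P'.sigma H hψ hder h0 hT h1 hg1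
  have hlu0 := P.lu0
  set E : Set ℂ := {ζ | Gr F d R (ψ ζ) = 0} with hE
  have hEK : ψ ⁻¹' Kplus F = E := by
    ext ζ; exact (H.G_zero _).symm
  have hEc : IsClosed E := isClosed_eq (H.G_cont.comp hψ.continuous) continuous_const
  have hEr : ∀ᶠ s in 𝓝 0, σ s ∈ E → s.im = 0 := by
    filter_upwards [hgσ] with s hs hsE
    have : Gr F d R (ψ (σ s)) = 0 := hsE
    rw [← hs] at this
    exact H.Cl_real h1 this
  obtain ⟨c, hc, hline⟩ := near_line hσ hσ0 hσne hEr
  have hinv : ∀ ζ, ζ ∈ E → lu⁻¹ * ζ ∈ E := by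
    intro ζ hζ
    have h2 := hT (lu⁻¹ * ζ)
    rw [mul_inv_cancel_left₀ hlu0] at h2
    show Gr F d R (ψ (lu⁻¹ * ζ)) = 0
    rw [← H.G_iter_zero _ n, h2]
    exact hζ
  have hGLF : GLF univ (fun ζ => Gr F d R (ψ ζ)) := H.isGLF isOpen_univ hψ.differentiableOn
  obtain ⟨z, hz0, hz⟩ := hGLF.not_isolated (by show Gr F d R (ψ 0) = 0; rw [h0]; exact P.Gp H)
  refine ⟨⟨c, hc, ?_⟩, (lu_real hc hline P.lu1 hinv hz hz0).1⟩
  intro w hw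
  rw [hEK] at hw
  have hwE : w ∈ E := hEc.frontier_subset hw
  by_cases hw0 : w = 0
  · exact ⟨0, by simp [hw0]⟩
  · have h2 := (lu_real hc hline P.lu1 hinv hwE hw0).2
    refine ⟨(w / c).re, ?_⟩
    have : w / c = ((w / c).re : ℂ) := by apply Complex.ext <;> simp [h2]
    rw [← this, div_mul_cancel₀ _ hc]

theorem polyMap_diff {u : ℂ × ℂ → ℂ × ℂ} (h : IsPolyMap u) : Differentiable ℂ u := by
  obtain ⟨A, B, hAB⟩ := h
  have key : ∀ A : MvPolynomial (Fin 2) ℂ, Differentiable ℂ (fun z : ℂ × ℂ => MvPolynomial.eval ![z.1, z.2] A) := by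
    intro A
    induction A using MvPolynomial.induction_on with
    | C a => simp
    | add a b ha hb => simp only [map_add]; exact ha.add hb
    | mul_X a i ha =>
      simp only [map_mul, MvPolynomial.eval_X]
      refine ha.mul ?_
      fin_cases i
      · simpa using differentiable_fst
      · simpa using differentiable_snd
  have : u = fun z => (MvPolynomial.eval ![z.1, z.2] A, MvPolynomial.eval ![z.1, z.2] B) := funext hAB
  rw [this]
  exact (key A).prodMk (key B)

theorem bdd_image {u : ℂ × ℂ → ℂ × ℂ} (h : Continuous u) (C : ℝ) : ∃ C', ∀ q, ‖q‖ ≤ C → ‖u q‖ ≤ C' := by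
  obtain ⟨C', hC'⟩ := (isCompact_closedBall (0 : ℂ × ℂ) C).exists_bound_of_continuousOn h.continuousOn
  exact ⟨C', fun q hq => hC' q (by simpa using hq)⟩

theorem main_thm (f : ℂ × ℂ → ℂ × ℂ) (γ : ℂ → ℂ × ℂ)
    (hf : IsLoxodromic f) (hγ : IsTransversal f γ)
    (hcurve : ∃ (I : Set ℝ) (η : ℝ → ℂ), IsOpen I ∧ I.OrdConnected ∧
        Set.InjOn η I ∧ ContDiffOn ℝ 1 η I ∧ (∀ t ∈ I, deriv η t ≠ 0) ∧
        juliaSlice f γ ⊆ η '' I) :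
    ∀ (p : ℂ × ℂ) (n : ℕ) (ls lu : ℂ) (ψ : ℂ → ℂ × ℂ),
      IsSaddle f p n ls lu → IsUnstableParam f n lu p ψ →
      (∃ v : ℂ, v ≠ 0 ∧
        frontier (ψ ⁻¹' Kplus f) ⊆ {w : ℂ | ∃ t : ℝ, w = (t : ℂ) * v}) ∧ lu.im = 0 := by
  obtain ⟨-, u, ui, hs, ⟨hu, G, hG, hGu, huG⟩, hui, huu, hne, hH, hfu⟩ := hf
  have hGui : G = ui := by
    funext z
    have := hui (G z)
    rw [huG] at this
    exact this.symm
  rw [hGui] at hG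
  have hud := polyMap_diff hu
  have huid := polyMap_diff hG
  obtain ⟨R, d, S, -, hR, hst, htwo⟩ := henon_system hs hH hne 1
  set F := hs.foldr (fun h acc => h ∘ acc) id with hF
  have H : HSys F S d R := ⟨hst, htwo, hR⟩
  have hit : ∀ (k : ℕ) (z : ℂ × ℂ), u (f^[k] z) = F^[k] (u z) := by
    intro k z
    induction k with
    | zero => rfl
    | succ k ih => rw [iterate_succ_apply', iterate_succ_apply', hfu, huu, ih]
  have hit2 : ∀ (k : ℕ) (z : ℂ × ℂ), f^[k] z = ui (F^[k] (u z)) := by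
    intro k z
    rw [← hit, hui]
  have hK : ∀ z, u z ∈ Kplus F ↔ z ∈ Kplus f := by
    intro z
    constructor
    · rintro ⟨C, hC⟩
      obtain ⟨C', hC'⟩ := bdd_image huid.continuous C
      exact ⟨C', fun k => by rw [hit2]; exact hC' _ (hC k)⟩
    · rintro ⟨C, hC⟩
      obtain ⟨C', hC'⟩ := bdd_image hud.continuous C
      exact ⟨C', fun k => by rw [← hit]; exact hC' _ (hC k)⟩
  obtain ⟨I, η, hI, -, hinj, hC, hder, hsub⟩ := hcurve
  obtain ⟨-, hγd, ⟨z1, hz1, hz1'⟩, hγ2⟩ := hγ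
  obtain ⟨g, hg⟩ := H.phase1 (γ := fun z => u (γ z)) (hud.comp_differentiableOn hγd)
    ⟨z1, hz1, (hK _).2 hz1'⟩ (fun hcon => hγ2 fun z hz => (hK _).1 (hcon z hz)) hI hinj hC hder (by
      have : juliaSlice F (fun z => u (γ z)) = juliaSlice f γ := by
        simp only [juliaSlice, hK]
      rw [this]; exact hsub)
  intro p n ls lu ψ hsad hψ
  obtain ⟨hn, hfix, ⟨vs, hvs, hDs⟩, ⟨vu, hvu, hDu⟩, hls, hlu⟩ := hsad
  obtain ⟨hψi, hψd, hψ0, hψT⟩ := hψ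
  have hfd : Differentiable ℂ f := by
    have : f = fun z => ui (F (u z)) := funext hfu
    rw [this]
    exact huid.comp (H.st.diff.comp hud)
  -- conjugated derivative
  have hDu' : Injective (fderiv ℂ u p) := by
    have h1 := (huid (u p)).hasFDerivAt.comp p (hud p).hasFDerivAt
    have h2 : HasFDerivAt (ui ∘ u) (ContinuousLinearMap.id ℂ (ℂ × ℂ)) p :=
      (hasFDerivAt_id p).congr_of_eventuallyEq (Eventually.of_forall hui)
    have h3 := h1.unique h2
    intro a b hab
    have ha := congrArg (fun A : (ℂ × ℂ) →L[ℂ] ℂ × ℂ => A a) h3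
    have hb := congrArg (fun A : (ℂ × ℂ) →L[ℂ] ℂ × ℂ => A b) h3
    simp only [ContinuousLinearMap.comp_apply, ContinuousLinearMap.id_apply] at ha hb
    rw [← ha, ← hb, hab]
  have hfixF : F^[n] (u p) = u p := by rw [← hit, hfix]
  have hconj : ∀ w, fderiv ℂ (F^[n]) (u p) (fderiv ℂ u p w) = fderiv ℂ u p (fderiv ℂ (f^[n]) p w) := by
    intro w
    have h1 : HasFDerivAt (F^[n] ∘ u) ((fderiv ℂ (F^[n]) (u p)).comp (fderiv ℂ u p)) p :=
      ((H.st.diff.iterate n) (u p)).hasFDerivAt.comp p (hud p).hasFDerivAt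
    have h2 : HasFDerivAt (u ∘ f^[n]) ((fderiv ℂ u p).comp (fderiv ℂ (f^[n]) p)) p :=
      HasFDerivAt.comp p (by rw [hfix]; exact (hud p).hasFDerivAt) ((hfd.iterate n) p).hasFDerivAt
    have e : F^[n] ∘ u = u ∘ f^[n] := funext fun z => (hit n z).symm
    rw [e] at h1
    exact congrArg (fun A : (ℂ × ℂ) →L[ℂ] ℂ × ℂ => A w) (h1.unique h2)
  have hne0 : ∀ v : ℂ × ℂ, v ≠ 0 → fderiv ℂ u p v ≠ 0 := by
    intro v hv h
    exact hv (hDu' (by rw [h, map_zero]))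
  have hDinj : Injective (fderiv ℂ (F^[n]) (u p)) := by
    have h1 : HasFDerivAt (S^[n] ∘ F^[n]) ((fderiv ℂ (S^[n]) (F^[n] (u p))).comp (fderiv ℂ (F^[n]) (u p))) (u p) :=
      ((H.st.diffi.iterate n) (F^[n] (u p))).hasFDerivAt.comp (u p) ((H.st.diff.iterate n) (u p)).hasFDerivAt
    have h2 : HasFDerivAt (S^[n] ∘ F^[n]) (ContinuousLinearMap.id ℂ (ℂ × ℂ)) (u p) :=
      (hasFDerivAt_id (u p)).congr_of_eventuallyEq (Eventually.of_forall (H.SnF n))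
    have h3 := h1.unique h2
    intro a b hab
    have ha := congrArg (fun A : (ℂ × ℂ) →L[ℂ] ℂ × ℂ => A a) h3
    have hb := congrArg (fun A : (ℂ × ℂ) →L[ℂ] ℂ × ℂ => A b) h3
    simp only [ContinuousLinearMap.comp_apply, ContinuousLinearMap.id_apply] at ha hb
    rw [← ha, ← hb, hab]
  have hDs' : fderiv ℂ (F^[n]) (u p) (fderiv ℂ u p vs) = ls • fderiv ℂ u p vs := by rw [hconj, hDs, map_smul]
  have hDu'' : fderiv ℂ (F^[n]) (u p) (fderiv ℂ u p vu) = lu • fderiv ℂ u p vu := by rw [hconj, hDu, map_smul]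
  have hls0 : ls ≠ 0 := by
    rintro rfl
    rw [zero_smul] at hDs'
    exact hne0 vs hvs (hDinj (by rw [hDs', map_zero]))
  have P : PSad F (u p) (fderiv ℂ u p vs) (fderiv ℂ u p vu) n ls lu :=
    ⟨hn, hfixF, hne0 vs hvs, hne0 vu hvu, hDs', hDu'', hls0, hls, hlu⟩
  have hres := P.final H (ψ := fun ζ => u (ψ ζ)) (hud.comp hψd)
    (fun a b hab => hψi (by
      have := congrArg ui hab
      simpa only [hui] using this)) (by show u (ψ 0) = u p; rw [hψ0])
    (fun ζ => by show F^[n] (u (ψ ζ)) = u (ψ (lu * ζ)); rw [← hit, hψT]) hg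
  have e : (fun ζ => u (ψ ζ)) ⁻¹' Kplus F = ψ ⁻¹' Kplus f := by
    ext ζ; exact hK _
  rw [e] at hres
  exact hres

end Part20

/-- if the Julia slice of some transversal to `J⁺` is contained in a `C¹`
smooth curve, then for every saddle periodic point and every unstable parametrization
`ψ`, the frontier of `ψ⁻¹(K⁺)` is contained in a real line through the origin; in
particular the unstable multiplier is real. -/
theorem contained_in_C1_curve_implies_unstably_real (f : ℂ × ℂ → ℂ × ℂ) (γ : ℂ → ℂ × ℂ)
    (hf : IsLoxodromic f) (hγ : IsTransversal f γ)
    (hcurve : ∃ (I : Set ℝ) (η : ℝ → ℂ), IsOpen I ∧ I.OrdConnected ∧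
        Set.InjOn η I ∧ ContDiffOn ℝ 1 η I ∧ (∀ t ∈ I, deriv η t ≠ 0) ∧
        juliaSlice f γ ⊆ η '' I) :
    ∀ (p : ℂ × ℂ) (n : ℕ) (ls lu : ℂ) (ψ : ℂ → ℂ × ℂ),
      IsSaddle f p n ls lu → IsUnstableParam f n lu p ψ →
      (∃ v : ℂ, v ≠ 0 ∧
        frontier (ψ ⁻¹' Kplus f) ⊆ {w : ℂ | ∃ t : ℝ, w = (t : ℂ) * v}) ∧ lu.im = 0 :=
  main_thm f γ hf hγ hcurve
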